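/- Let g: ℝ → ℂ be a measurable 2π-periodic function with |g(x)| ≤ δ for some δ > 0 and every x ∈ ℝ. Then for every ε > 0 there exists a measurable set E ⊆ [0,2π] with Lebesgue measure |E| < ε such that for every x ∈ [0,2π] \ E and every integer N > 0, |S_N g(x)| ≤ C_ε δ, where C_ε = (8/(πε))^{1/2}·2^{474·4³} + π. -/

import Mathlib

section
open MeasureTheory
open scoped Real ENNReal

/-- The `N`-th partial Fourier sum of a `2π`-periodic function `f`,
`S_N f(x) = ∑_{n=-N}^{N} f̂_n e^{inx}` with `f̂_n = (1/2π) ∫₀^{2π} f(y) e^{-iny} dy`. -/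
noncomputable def partialFourierSum (N : ℕ) (f : ℝ → ℂ) (x : ℝ) : ℂ :=
  ∑ n ∈ Finset.Icc (-(N : ℤ)) (N : ℤ),
    ((((2 * π)⁻¹ : ℝ) : ℂ) *
        ∫ y in (0 : ℝ)..(2 * π), f y * Complex.exp (-(Complex.I * (n : ℂ) * (y : ℂ)))) *
      Complex.exp (Complex.I * (n : ℂ) * (x : ℂ))

end

section
namespace CT
open Finset
open scoped Classical

structure Tile where
  s : ℕ
  i : ℕ
  j : ℕ

/-- Time-frequency geometry. -/
structure Geo (X : Type) [Fintype X] where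
  C0 : ℝ
  C0_ge : 2 ^ 20 ≤ C0
  d : X → X → ℝ
  d_nonneg : ∀ x y, 0 ≤ d x y
  d_symm : ∀ x y, d x y = d y x
  d_self : ∀ x, d x x = 0
  d_tri : ∀ x y z, d x z ≤ d x y + d y z
  S : ℕ
  β : ℕ → ℝ
  β_ge : ∀ s, 1 ≤ β s
  β_succ : ∀ s, β (s + 1) = 64 * β s
  tb : ℕ → X → ℕ
  tb_mono : ∀ s s' x y, s ≤ s' → tb s x = tb s y → tb s' x = tb s' y
  tb_card : ∀ s, s ≤ S → ∀ x, ((univ.filter (fun y => tb s y = tb s x)).card : ℝ) = β s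
  d_tb : ∀ s x y, tb s x = tb s y → d x y ≤ β s
  ctr : ℕ → ℕ → X
  tb_ctr : ∀ s, s ≤ S → ∀ x, tb s (ctr s (tb s x)) = tb s x
  growth : ∀ t : ℝ, 1 ≤ t → ∀ x, ∑ y, (1 + d x y / t)⁻¹ ^ 2 ≤ C0 * t
  bdry : ∀ s, s ≤ S → ∀ t : ℝ, 1 ≤ t → ∀ x0,
    ∑ y ∈ univ.filter (fun y => tb s y = tb s x0),
      ∑ x ∈ univ.filter (fun x => tb s x ≠ tb s x0), (1 + d x y / t)⁻¹ ^ 4 ≤ C0 * t ^ 2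
  fb : ℕ → ℕ → ℕ
  fb_mono : ∀ s s' ξ η, s ≤ s' → fb s' ξ = fb s' η → fb s ξ = fb s η
  up : ℕ → ℕ → Prop
  up_congr : ∀ s s' ξ η, s < s' → fb s' ξ = fb s' η → (up s ξ ↔ up s η)
  up_lt : ∀ s ξ η, fb s ξ = fb s η → ¬ up s ξ → up s η → ξ < η
  up_ex : ∀ s ξ, s < S → ∃ η, fb s η = fb s ξ ∧ up s η

section
variable {X : Type} [Fintype X] (G : Geo X)

namespace Geo

noncomputable def wt (s : ℕ) (x y : X) : ℝ := (1 + G.d x y / G.β s)⁻¹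

/-- centre of a tile -/
def c (P : Tile) : X := G.ctr P.s P.i

def Valid (P : Tile) : Prop :=
  P.s < G.S ∧ G.tb P.s (G.c P) = P.i ∧ ∃ ξ, G.fb P.s ξ = P.j

lemma C0_pos : 0 < G.C0 := lt_of_lt_of_le (by positivity) G.C0_ge
lemma C0_one : 1 ≤ G.C0 := le_trans (by norm_num) G.C0_ge
lemma β_pos (s : ℕ) : 0 < G.β s := lt_of_lt_of_le one_pos (G.β_ge s)

lemma β_mono {s s' : ℕ} (h : s ≤ s') : G.β s ≤ G.β s' := by
  induction h with
  | refl => exact le_rfl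
  | step h ih => rw [G.β_succ]; linarith [G.β_pos (s := s), G.β_ge ‹ℕ›]

lemma β_sum_lt (s : ℕ) : ∑ k ∈ range s, G.β k ≤ G.β s := by
  induction s with
  | zero => simpa using (G.β_pos 0).le
  | succ n ih => rw [sum_range_succ, G.β_succ]; linarith [G.β_pos n]

lemma wt_pos (s : ℕ) (x y : X) : 0 < G.wt s x y := by
  have := G.d_nonneg x y; have := G.β_pos s; unfold wt; positivity

lemma wt_le_one (s : ℕ) (x y : X) : G.wt s x y ≤ 1 := by
  have h1 := G.d_nonneg x y; have h2 := G.β_pos s; unfold wt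
  apply inv_le_one_of_one_le₀
  have : 0 ≤ G.d x y / G.β s := by positivity
  linarith

lemma wt_symm (s : ℕ) (x y : X) : G.wt s x y = G.wt s y x := by
  unfold wt; rw [G.d_symm]

lemma wt_sub (s : ℕ) (x y z : X) : G.wt s x y * G.wt s y z ≤ G.wt s x z := by
  have h2 := G.β_pos s
  have a := div_nonneg (G.d_nonneg x y) h2.le
  have b := div_nonneg (G.d_nonneg y z) h2.le
  have c := div_nonneg (G.d_nonneg x z) h2.le
  unfold wt
  rw [← mul_inv]
  apply inv_anti₀ (by linarith)
  have : G.d x z / G.β s ≤ G.d x y / G.β s + G.d y z / G.β s := by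
    rw [← add_div]; exact div_le_div_of_nonneg_right (G.d_tri x y z) h2.le
  nlinarith [mul_nonneg a b]

lemma wt_mono {s s' : ℕ} (h : s ≤ s') (x y : X) : G.wt s x y ≤ G.wt s' x y := by
  have h1 := G.d_nonneg x y
  have h2 := G.β_pos s
  have h3 := G.β_pos s'
  unfold wt
  apply inv_anti₀ (by positivity)
  have := div_le_div_of_nonneg_left h1 h2 (G.β_mono h)
  linarith

lemma wt_near {s : ℕ} {k : ℝ} (hk : 0 ≤ k) (x y y' : X) (h : G.d y y' ≤ k * G.β s) :
    G.wt s x y ≤ (1 + k) * G.wt s x y' := by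
  have h2 := G.β_pos s
  have a := div_nonneg (G.d_nonneg x y) h2.le
  have b := div_nonneg (G.d_nonneg x y') h2.le
  unfold wt
  rw [← div_eq_mul_inv, le_div_iff₀ (by linarith), inv_mul_le_iff₀ (by linarith)]
  have : G.d x y' / G.β s ≤ G.d x y / G.β s + k := by
    rw [div_add' _ _ _ h2.ne']
    apply div_le_div_of_nonneg_right _ h2.le
    linarith [G.d_tri x y y']
  nlinarith [mul_nonneg a hk]

lemma wt_of_far {s : ℕ} {r : ℝ} (hr : 0 < r) (x y : X) (h : r ≤ G.d x y) :
    G.wt s x y ≤ G.β s / r := by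
  have h2 := G.β_pos s
  unfold wt
  rw [inv_le_comm₀ (by have := div_nonneg (G.d_nonneg x y) h2.le; linarith) (by positivity), inv_div]
  have := div_le_div_of_nonneg_right h h2.le
  linarith

lemma sum_wt (s : ℕ) (x : X) : ∑ y, G.wt s x y ^ 2 ≤ G.C0 * G.β s :=
  G.growth _ (G.β_ge s) x

lemma wt_pow_le (s : ℕ) (x y : X) {m n : ℕ} (h : m ≤ n) : G.wt s x y ^ n ≤ G.wt s x y ^ m :=
  pow_le_pow_of_le_one (G.wt_pos s x y).le (G.wt_le_one s x y) h

lemma sum_wt_pow (s : ℕ) (x : X) {n : ℕ} (h : 2 ≤ n) : ∑ y, G.wt s x y ^ n ≤ G.C0 * G.β s :=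
  (sum_le_sum fun y _ => G.wt_pow_le s x y h).trans (G.sum_wt s x)

/-- the points of the time interval of a tile -/
noncomputable def I (P : Tile) : Finset X := univ.filter (fun x => G.tb P.s x = P.i)

lemma mem_I {P : Tile} {x : X} : x ∈ G.I P ↔ G.tb P.s x = P.i := by simp [I]

lemma c_mem {P : Tile} (h : G.Valid P) : G.c P ∈ G.I P := G.mem_I.2 h.2.1

lemma card_I {P : Tile} (h : G.Valid P) : ((G.I P).card : ℝ) = G.β P.s := by
  rw [← G.tb_card P.s h.1.le (G.c P), h.2.1]; rfl

lemma d_I {P : Tile} (h : G.Valid P) {x : X} (hx : x ∈ G.I P) : G.d x (G.c P) ≤ G.β P.s :=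
  G.d_tb _ _ _ (by rw [h.2.1]; exact G.mem_I.1 hx)

/-- weight at the centre controlled by averages over the interval -/
lemma wt_avg {P : Tile} (h : G.Valid P) {s : ℕ} (hs : P.s ≤ s) (x : X) (m : ℕ) :
    G.β P.s * G.wt s x (G.c P) ^ m ≤ 2 ^ m * ∑ y ∈ G.I P, G.wt s x y ^ m := by
  rw [← G.card_I h, mul_sum, ← nsmul_eq_mul]
  apply Finset.card_nsmul_le_sum
  intro y hy
  rw [← mul_pow]
  apply pow_le_pow_left₀ (G.wt_pos _ _ _).le
  have := G.wt_near (s := s) (k := 1) zero_le_one x (G.c P) y (by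
    rw [G.d_symm, one_mul]; exact (G.d_I h hy).trans (G.β_mono hs))
  linarith

/-- pairwise disjoint intervals -/
def Disj (T : Finset Tile) : Prop :=
  ∀ P ∈ T, ∀ P' ∈ T, P ≠ P' → Disjoint (G.I P) (G.I P')

lemma sum_disj {T : Finset Tile} (hT : G.Disj T) {A : Finset X} (hA : ∀ P ∈ T, G.I P ⊆ A)
    {g : X → ℝ} (hg : ∀ x, 0 ≤ g x) : ∑ P ∈ T, ∑ x ∈ G.I P, g x ≤ ∑ x ∈ A, g x := by
  rw [← sum_biUnion (fun P hP P' hP' hne => hT P hP P' hP' hne)]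
  apply sum_le_sum_of_subset_of_nonneg
  · exact biUnion_subset.2 hA
  · intros; exact hg _

/-- at one scale -/
lemma sum_wt_tiles {T : Finset Tile} (hT : G.Disj T) (hv : ∀ P ∈ T, G.Valid P) {s : ℕ}
    (hs : ∀ P ∈ T, P.s = s) (x : X) {m : ℕ} (hm : 2 ≤ m) :
    ∑ P ∈ T, G.wt s x (G.c P) ^ m ≤ 4 * G.C0 := by
  have hb := G.β_pos s
  have h1 : ∑ P ∈ T, G.β s * G.wt s x (G.c P) ^ 2 ≤ 2 ^ 2 * ∑ y, G.wt s x y ^ 2 := by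
    calc _ ≤ ∑ P ∈ T, 2 ^ 2 * ∑ y ∈ G.I P, G.wt s x y ^ 2 := by
          apply sum_le_sum
          intro P hP
          have := G.wt_avg (hv P hP) (hs P hP).le x 2
          rwa [hs P hP] at this
      _ ≤ _ := by
          rw [← mul_sum]
          apply mul_le_mul_of_nonneg_left _ (by positivity)
          exact G.sum_disj hT (fun P _ => subset_univ _) (fun y => by positivity)
  have h2 := G.sum_wt s x
  rw [← mul_sum] at h1
  have h3 : ∑ P ∈ T, G.wt s x (G.c P) ^ m ≤ ∑ P ∈ T, G.wt s x (G.c P) ^ 2 :=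
    sum_le_sum fun P _ => G.wt_pow_le _ _ _ hm
  refine h3.trans ?_
  have : G.β s * ∑ P ∈ T, G.wt s x (G.c P) ^ 2 ≤ G.β s * (4 * G.C0) := by nlinarith
  exact le_of_mul_le_mul_left this hb

lemma I_subset {P : Tile} {s : ℕ} (h : G.Valid P) (hs : P.s ≤ s) {x : X} (hx : x ∈ G.I P) :
    G.tb s x = G.tb s (G.c P) :=
  G.tb_mono _ _ _ _ hs ((G.mem_I.1 hx).trans h.2.1.symm)

lemma disj_of_ne {P P' : Tile} (hs : P.s = P'.s) (h : P.i ≠ P'.i) :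
    Disjoint (G.I P) (G.I P') := by
  rw [Finset.disjoint_left]
  intro x hx hx'
  rw [mem_I] at hx hx'
  rw [hs] at hx
  exact h (hx.symm.trans hx')

/-- A packet family. -/
structure Packet (φ : Tile → X → ℂ) : Prop where
  bd : ∀ P, G.Valid P → ∀ x, ‖φ P x‖ ≤ G.C0 / √(G.β P.s) * G.wt P.s x (G.c P) ^ 6
  orth : ∀ P P', G.Valid P → G.Valid P' → P.s ≤ P'.s →
    ∑ x, φ P x * (starRingEnd ℂ) (φ P' x) ≠ 0 →
    ∃ ξ, G.fb P.s ξ = P.j ∧ G.fb P'.s ξ = P'.j ∧ ¬ G.up P.s ξ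

/-- Low pass kernels. -/
def LowPass (ψ : Tile → X → ℂ) : Prop :=
  ∀ s, s ≤ G.S → ∀ ξ0 : ℕ, ∃ K : X → X → ℂ,
    (∀ x y, ‖K x y‖ ≤ G.C0 / G.β s * G.wt s x y ^ 2) ∧
    ∀ P, G.Valid P → G.fb P.s ξ0 = P.j →
      (s ≤ P.s → ∀ x, ∑ y, K x y * ψ P y = ψ P x) ∧
      (P.s < s → G.up P.s ξ0 → ∀ x, ∑ y, K x y * ψ P y = 0)

noncomputable def ip (φ : Tile → X → ℂ) (P P' : Tile) : ℂ :=
  ∑ x, φ P x * (starRingEnd ℂ) (φ P' x)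

lemma ip_symm (φ : Tile → X → ℂ) (P P' : Tile) : ‖ip φ P P'‖ = ‖ip φ P' P‖ := by
  have : ip φ P' P = (starRingEnd ℂ) (ip φ P P') := by
    simp [ip, map_sum, mul_comm]
  rw [this, RCLike.norm_conj]

lemma ip_bd {φ : Tile → X → ℂ} (hφ : G.Packet φ) {P P' : Tile} (h : G.Valid P)
    (h' : G.Valid P') (hs : P'.s ≤ P.s) :
    ‖ip φ P P'‖ ≤ G.C0 ^ 3 * (√(G.β P'.s) / √(G.β P.s)) * G.wt P.s (G.c P) (G.c P') ^ 4 := by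
  have hC := G.C0_pos
  have hb : 0 < √(G.β P.s) := Real.sqrt_pos.2 (G.β_pos _)
  have hb' : 0 < √(G.β P'.s) := Real.sqrt_pos.2 (G.β_pos _)
  have hb2 : √(G.β P'.s) * √(G.β P'.s) = G.β P'.s := Real.mul_self_sqrt (G.β_pos _).le
  have key : ∀ x, ‖φ P x * (starRingEnd ℂ) (φ P' x)‖ ≤
      G.C0 ^ 2 / (√(G.β P.s) * √(G.β P'.s)) * G.wt P.s (G.c P) (G.c P') ^ 4 *
        G.wt P'.s (G.c P') x ^ 2 := by
    intro x
    rw [norm_mul, RCLike.norm_conj]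
    have w1 := G.wt_pos P.s x (G.c P)
    have w2 := G.wt_pos P'.s x (G.c P')
    have e1 : G.wt P.s x (G.c P) ^ 6 ≤ G.wt P.s x (G.c P) ^ 4 := G.wt_pow_le _ _ _ (by norm_num)
    have e2 : G.wt P.s x (G.c P) ^ 4 * G.wt P'.s x (G.c P') ^ 4 ≤
        G.wt P.s (G.c P) (G.c P') ^ 4 := by
      rw [← mul_pow]
      apply pow_le_pow_left₀ (by positivity)
      refine le_trans ?_ (G.wt_sub P.s (G.c P) x (G.c P'))
      rw [G.wt_symm P.s (G.c P) x]
      exact mul_le_mul_of_nonneg_left (G.wt_mono hs _ _) w1.le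
    calc _ ≤ (G.C0 / √(G.β P.s) * G.wt P.s x (G.c P) ^ 6) *
        (G.C0 / √(G.β P'.s) * G.wt P'.s x (G.c P') ^ 6) :=
          mul_le_mul (hφ.bd P h x) (hφ.bd P' h' x) (norm_nonneg _) (by positivity)
      _ = G.C0 ^ 2 / (√(G.β P.s) * √(G.β P'.s)) *
          (G.wt P.s x (G.c P) ^ 6 * G.wt P'.s x (G.c P') ^ 4) * G.wt P'.s x (G.c P') ^ 2 := by
          field_simp
      _ ≤ _ := by
          rw [G.wt_symm P'.s (G.c P') x]
          gcongr
          exact le_trans (mul_le_mul_of_nonneg_right e1 (by positivity)) e2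
  have w3 := G.wt_pos P.s (G.c P) (G.c P')
  calc ‖ip φ P P'‖ ≤ ∑ x, G.C0 ^ 2 / (√(G.β P.s) * √(G.β P'.s)) *
        G.wt P.s (G.c P) (G.c P') ^ 4 * G.wt P'.s (G.c P') x ^ 2 :=
        (norm_sum_le _ _).trans (sum_le_sum fun x _ => key x)
    _ ≤ G.C0 ^ 2 / (√(G.β P.s) * √(G.β P'.s)) *
        G.wt P.s (G.c P) (G.c P') ^ 4 * (G.C0 * G.β P'.s) := by
        rw [← mul_sum]
        gcongr
        exact G.sum_wt _ _
    _ = _ := by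
        have e : G.C0 * G.β P'.s = G.C0 * (√(G.β P'.s) * √(G.β P'.s)) := by rw [hb2]
        rw [e]; field_simp

/-- Schur test. -/
lemma schur {ι : Type} (T : Finset ι) (a : ι → ℝ) (k : ι → ι → ℝ) (C : ℝ)
    (hk : ∀ i j, 0 ≤ k i j) (hsym : ∀ i j, k i j = k j i)
    (h : ∀ i ∈ T, ∑ j ∈ T, k i j ≤ C) :
    ∑ i ∈ T, ∑ j ∈ T, a i * a j * k i j ≤ C * ∑ i ∈ T, a i ^ 2 := by
  have h1 : ∑ i ∈ T, ∑ j ∈ T, a i * a j * k i j ≤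
      ∑ i ∈ T, ∑ j ∈ T, (a i ^ 2 * k i j / 2 + a j ^ 2 * k i j / 2) := by
    apply sum_le_sum; intro i _; apply sum_le_sum; intro j _
    nlinarith [mul_nonneg (hk i j) (sq_nonneg (a i - a j))]
  have h2 : ∑ i ∈ T, ∑ j ∈ T, a j ^ 2 * k i j / 2 = ∑ i ∈ T, ∑ j ∈ T, a i ^ 2 * k i j / 2 := by
    rw [sum_comm]
    apply sum_congr rfl; intro i _; apply sum_congr rfl; intro j _; rw [hsym]
  have h3 : ∑ i ∈ T, ∑ j ∈ T, a i ^ 2 * k i j / 2 ≤ ∑ i ∈ T, C * a i ^ 2 / 2 := by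
    apply sum_le_sum; intro i hi
    have := h i hi
    calc _ = a i ^ 2 * (∑ j ∈ T, k i j) / 2 := by rw [mul_sum, sum_div]
      _ ≤ _ := by nlinarith [sq_nonneg (a i)]
  simp only [sum_add_distrib] at h1
  rw [h2] at h1
  have h4 : ∑ i ∈ T, C * a i ^ 2 / 2 = C * (∑ i ∈ T, a i ^ 2) / 2 := by
    rw [mul_sum, sum_div]
  linarith

end Geo
end
end CT

end

section
namespace CT
open Finset
open scoped Classical

section
variable {X : Type} [Fintype X]

/-- `TT*` lemma. -/
lemma ttstar (k : X → X → ℝ) (hk : ∀ x z, 0 ≤ k x z) (C : ℝ) (hC : 0 < C)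
    (h : ∀ x x', ∑ z, k x z * k x' z ≤ C * (k x x' + k x' x)) (g : X → ℝ) :
    ∑ x, (∑ z, k x z * g z) ^ 2 ≤ (2 * C) ^ 2 * ∑ x, g x ^ 2 := by
  -- adjoint bound
  have adj : ∀ u : X → ℝ, (∀ x, 0 ≤ u x) →
      ∑ z, (∑ x, k x z * u x) ^ 2 ≤ (2 * C) ^ 2 * ∑ x, u x ^ 2 := by
    intro u hu
    set A := ∑ z, (∑ x, k x z * u x) ^ 2 with hA
    set B := ∑ x, u x ^ 2 with hB
    have hA0 : 0 ≤ A := sum_nonneg fun _ _ => sq_nonneg _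
    have hB0 : 0 ≤ B := sum_nonneg fun _ _ => sq_nonneg _
    have e1 : A = ∑ x, ∑ x', u x * u x' * ∑ z, k x z * k x' z := by
      have : ∀ z, (∑ x, k x z * u x) ^ 2 = ∑ x, ∑ x', u x * u x' * (k x z * k x' z) := by
        intro z
        rw [sq, sum_mul_sum]
        apply sum_congr rfl; intro x _; apply sum_congr rfl; intro x' _; ring
      rw [hA, sum_congr rfl fun z _ => this z, sum_comm]
      apply sum_congr rfl; intro x _
      rw [sum_comm]
      apply sum_congr rfl; intro x' _
      rw [mul_sum]
    have e2 : ∑ x, ∑ x', u x * u x' * (C * (k x x' + k x' x)) =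
        2 * C * ∑ z, u z * ∑ x, k x z * u x := by
      have s1 : ∑ x, ∑ x', u x * u x' * (C * (k x x' + k x' x)) =
        ∑ x, ∑ x', C * (u x' * (k x x' * u x)) + ∑ x, ∑ x', C * (u x * (k x' x * u x')) := by
        rw [← sum_add_distrib]; apply sum_congr rfl; intro x _
        rw [← sum_add_distrib]; apply sum_congr rfl; intro x' _; ring
      have s2 : ∑ x, ∑ x', C * (u x' * (k x x' * u x)) = C * ∑ z, u z * ∑ x, k x z * u x := by
        rw [sum_comm, mul_sum]; apply sum_congr rfl; intro x _
        rw [mul_sum, mul_sum]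
      have s3 : ∑ x, ∑ x', C * (u x * (k x' x * u x')) = C * ∑ z, u z * ∑ x, k x z * u x := by
        rw [mul_sum]; apply sum_congr rfl; intro x _
        rw [mul_sum, mul_sum]
      rw [s1, s2, s3]; ring
    have e3 : A ≤ 2 * C * ∑ z, u z * ∑ x, k x z * u x := by
      rw [← e2, e1]
      apply sum_le_sum; intro x _; apply sum_le_sum; intro x' _
      exact mul_le_mul_of_nonneg_left (h x x') (mul_nonneg (hu _) (hu _))
    have e4 : (∑ z, u z * ∑ x, k x z * u x) ^ 2 ≤ B * A := sum_mul_sq_le_sq_mul_sq _ _ _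
    have e5 : A ^ 2 ≤ (2 * C) ^ 2 * (B * A) := by
      calc A ^ 2 ≤ (2 * C * ∑ z, u z * ∑ x, k x z * u x) ^ 2 := pow_le_pow_left₀ hA0 e3 2
        _ = (2 * C) ^ 2 * (∑ z, u z * ∑ x, k x z * u x) ^ 2 := by ring
        _ ≤ _ := mul_le_mul_of_nonneg_left e4 (by positivity)
    rcases hA0.eq_or_lt with h0 | h0
    · rw [← h0]; positivity
    · have : A * A ≤ ((2 * C) ^ 2 * B) * A := by nlinarith
      exact le_of_mul_le_mul_right this h0
  -- reduce to nonnegative g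
  set u : X → ℝ := fun x => |∑ z, k x z * g z| with hu
  set A := ∑ x, (∑ z, k x z * g z) ^ 2 with hA
  have hA0 : 0 ≤ A := sum_nonneg fun _ _ => sq_nonneg _
  have hB0 : 0 ≤ ∑ x, g x ^ 2 := sum_nonneg fun _ _ => sq_nonneg _
  have a1 : A ≤ ∑ z, |g z| * ∑ x, k x z * u x := by
    calc A ≤ ∑ x, u x * ∑ z, k x z * |g z| := by
          apply sum_le_sum; intro x _
          have : u x ≤ ∑ z, k x z * |g z| := by
            refine (abs_sum_le_sum_abs _ _).trans (sum_le_sum fun z _ => ?_)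
            rw [abs_mul, abs_of_nonneg (hk x z)]
          rw [← sq_abs, sq]
          exact mul_le_mul_of_nonneg_left this (abs_nonneg _)
      _ = _ := by
          simp only [mul_sum]
          rw [sum_comm]
          apply sum_congr rfl; intro z _; apply sum_congr rfl; intro x _; ring
  have a2 : (∑ z, |g z| * ∑ x, k x z * u x) ^ 2 ≤ (∑ z, g z ^ 2) * ((2 * C) ^ 2 * A) := by
    refine (sum_mul_sq_le_sq_mul_sq _ _ _).trans ?_
    simp only [sq_abs]
    apply mul_le_mul_of_nonneg_left _ hB0
    refine (adj u (fun x => abs_nonneg _)).trans_eq ?_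
    simp only [hu, sq_abs]; rfl
  have a3 : A ^ 2 ≤ (∑ z, g z ^ 2) * ((2 * C) ^ 2 * A) :=
    (pow_le_pow_left₀ hA0 a1 2).trans a2
  rcases hA0.eq_or_lt with h0 | h0
  · rw [← h0]; positivity
  · have : A * A ≤ ((2 * C) ^ 2 * ∑ x, g x ^ 2) * A := by nlinarith
    exact le_of_mul_le_mul_right this h0

namespace Geo
variable (G : Geo X)

/-- averages -/
noncomputable def av (s : ℕ) (g : X → ℝ) (x : X) : ℝ :=
  ∑ z, (G.β s)⁻¹ * G.wt s x z ^ 2 * g z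

lemma av_nonneg (s : ℕ) {g : X → ℝ} (hg : ∀ x, 0 ≤ g x) (x : X) : 0 ≤ G.av s g x := by
  apply sum_nonneg; intro z _
  have := G.β_pos s; have := hg z; have := G.wt_pos s x z
  positivity

/-- maximal function -/
noncomputable def mx (g : X → ℝ) (x : X) : ℝ :=
  (range (G.S + 1)).sup' ⟨0, by simp⟩ (fun s => G.av s g x)

lemma av_le_mx {s : ℕ} (hs : s ≤ G.S) (g : X → ℝ) (x : X) : G.av s g x ≤ G.mx g x :=
  le_sup' (fun s => G.av s g x) (by simp; omega)

lemma mx_nonneg {g : X → ℝ} (hg : ∀ x, 0 ≤ g x) (x : X) : 0 ≤ G.mx g x :=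
  (G.av_nonneg 0 hg x).trans (G.av_le_mx (Nat.zero_le _) g x)

lemma av_comp {s s' : ℕ} (x x' : X) :
    ∑ z, ((G.β s)⁻¹ * G.wt s x z ^ 2) * ((G.β s')⁻¹ * G.wt s' x' z ^ 2) ≤
      4 * G.C0 * ((G.β s)⁻¹ * G.wt s x x' ^ 2 + (G.β s')⁻¹ * G.wt s' x' x ^ 2) := by
  have hb := G.β_pos s
  have hb' := G.β_pos s'
  have key : ∀ z, ((G.β s)⁻¹ * G.wt s x z ^ 2) * ((G.β s')⁻¹ * G.wt s' x' z ^ 2) ≤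
      4 * (G.β s)⁻¹ * G.wt s x x' ^ 2 * ((G.β s')⁻¹ * G.wt s' x' z ^ 2) +
      4 * (G.β s')⁻¹ * G.wt s' x' x ^ 2 * ((G.β s)⁻¹ * G.wt s x z ^ 2) := by
    intro z
    have p1 := G.wt_pos s x z
    have p2 := G.wt_pos s' x' z
    have p3 := G.wt_pos s x x'
    have p4 := G.wt_pos s' x' x
    have half : ∀ (t : ℕ) (y w w' : X), G.d y w' ≤ 2 * G.d y w → G.wt t y w ≤ 2 * G.wt t y w' := by
      intro t y w w' h
      have hb := G.β_pos t
      have a := div_nonneg (G.d_nonneg y w) hb.le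
      have b := div_nonneg (G.d_nonneg y w') hb.le
      unfold wt
      rw [← div_eq_mul_inv, le_div_iff₀ (by linarith), inv_mul_le_iff₀ (by linarith)]
      have : G.d y w' / G.β t ≤ 2 * (G.d y w / G.β t) := by
        rw [← mul_div_assoc]; exact div_le_div_of_nonneg_right h hb.le
      linarith
    rcases le_total (G.d x x') (2 * G.d x z) with h | h
    · have h1 := half s x z x' h
      have h2 : G.wt s x z ^ 2 ≤ 4 * G.wt s x x' ^ 2 := by nlinarith
      have : 0 ≤ 4 * (G.β s')⁻¹ * G.wt s' x' x ^ 2 * ((G.β s)⁻¹ * G.wt s x z ^ 2) := by positivity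
      have h3 : ((G.β s)⁻¹ * G.wt s x z ^ 2) * ((G.β s')⁻¹ * G.wt s' x' z ^ 2) ≤
        ((G.β s)⁻¹ * (4 * G.wt s x x' ^ 2)) * ((G.β s')⁻¹ * G.wt s' x' z ^ 2) := by gcongr
      nlinarith
    · have h1 := half s' x' z x (by
        have := G.d_tri x z x'; rw [G.d_symm x' x, G.d_symm x' z]; linarith)
      have h2 : G.wt s' x' z ^ 2 ≤ 4 * G.wt s' x' x ^ 2 := by nlinarith
      have : 0 ≤ 4 * (G.β s)⁻¹ * G.wt s x x' ^ 2 * ((G.β s')⁻¹ * G.wt s' x' z ^ 2) := by positivity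
      have h3 : ((G.β s)⁻¹ * G.wt s x z ^ 2) * ((G.β s')⁻¹ * G.wt s' x' z ^ 2) ≤
        ((G.β s)⁻¹ * G.wt s x z ^ 2) * ((G.β s')⁻¹ * (4 * G.wt s' x' x ^ 2)) := by gcongr
      nlinarith
  have one : ∀ (t : ℕ) (y : X), ∑ z, (G.β t)⁻¹ * G.wt t y z ^ 2 ≤ G.C0 := by
    intro t y
    rw [← mul_sum, inv_mul_le_iff₀ (G.β_pos t), mul_comm]
    exact G.sum_wt t y
  refine (sum_le_sum fun z _ => key z).trans ?_
  rw [sum_add_distrib]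
  have q1 : 0 ≤ 4 * (G.β s)⁻¹ * G.wt s x x' ^ 2 := by positivity
  have q2 : 0 ≤ 4 * (G.β s')⁻¹ * G.wt s' x' x ^ 2 := by positivity
  have r1 := mul_le_mul_of_nonneg_left (one s' x') q1
  have r2 := mul_le_mul_of_nonneg_left (one s x) q2
  rw [mul_sum] at r1 r2
  linarith

lemma mx_bd (g : X → ℝ) : ∑ x, G.mx g x ^ 2 ≤ (8 * G.C0) ^ 2 * ∑ x, g x ^ 2 := by
  have hC := G.C0_pos
  have : ∀ x, ∃ s, G.mx g x = G.av s g x := fun x => by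
    obtain ⟨s, _, h⟩ := exists_mem_eq_sup' (s := range (G.S + 1)) ⟨0, by simp⟩ (fun s => G.av s g x)
    exact ⟨s, h⟩
  choose σ hσ using this
  have := ttstar (fun x z => (G.β (σ x))⁻¹ * G.wt (σ x) x z ^ 2)
    (fun x z => by have := G.β_pos (σ x); have := G.wt_pos (σ x) x z; positivity) (4 * G.C0)
    (by positivity) (fun x x' => G.av_comp x x') g
  simp only [hσ, av]
  refine this.trans_eq (by ring)

/-- expanding an `L²` norm -/
lemma sq_expand (φ : Tile → X → ℂ) (a : Tile → ℂ) (T : Finset Tile) :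
    ∑ x, ‖∑ P ∈ T, a P * φ P x‖ ^ 2 ≤ ∑ P ∈ T, ∑ P' ∈ T, ‖a P‖ * ‖a P'‖ * ‖ip φ P P'‖ := by
  have h : ((∑ x, ‖∑ P ∈ T, a P * φ P x‖ ^ 2 : ℝ) : ℂ) =
      ∑ P ∈ T, ∑ P' ∈ T, a P * (starRingEnd ℂ) (a P') * ip φ P P' := by
    push_cast
    have : ∀ x, ((‖∑ P ∈ T, a P * φ P x‖ : ℂ)) ^ 2 = ∑ P ∈ T, ∑ P' ∈ T,
        a P * (starRingEnd ℂ) (a P') * (φ P x * (starRingEnd ℂ) (φ P' x)) := by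
      intro x
      rw [← Complex.mul_conj', map_sum, sum_mul_sum]
      apply sum_congr rfl; intro P _; apply sum_congr rfl; intro P' _
      rw [map_mul]; ring
    rw [sum_congr rfl fun x _ => this x, sum_comm]
    apply sum_congr rfl; intro P _
    rw [sum_comm]
    apply sum_congr rfl; intro P' _
    rw [ip, mul_sum]
  have h0 : 0 ≤ ∑ x, ‖∑ P ∈ T, a P * φ P x‖ ^ 2 := by positivity
  have : ∑ x, ‖∑ P ∈ T, a P * φ P x‖ ^ 2 = ‖∑ P ∈ T, ∑ P' ∈ T,
      a P * (starRingEnd ℂ) (a P') * ip φ P P'‖ := by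
    rw [← h, Complex.norm_of_nonneg h0]
  rw [this]
  refine (norm_sum_le _ _).trans (sum_le_sum fun P _ => ?_)
  refine (norm_sum_le _ _).trans (sum_le_sum fun P' _ => ?_)
  rw [norm_mul, norm_mul, RCLike.norm_conj]

/-- kernel for the diagonal -/
noncomputable def dk (P P' : Tile) : ℝ :=
  if P.s = P'.s ∧ P.j = P'.j then G.C0 ^ 3 * G.wt P.s (G.c P) (G.c P') ^ 4 else 0

lemma dk_nonneg (P P' : Tile) : 0 ≤ G.dk P P' := by
  have := G.C0_pos; have := G.wt_pos P.s (G.c P) (G.c P')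
  unfold dk; split_ifs <;> positivity

lemma dk_symm (P P' : Tile) : G.dk P P' = G.dk P' P := by
  unfold dk
  by_cases h : P.s = P'.s ∧ P.j = P'.j
  · rw [if_pos h, if_pos ⟨h.1.symm, h.2.symm⟩, h.1, G.wt_symm]
  · rw [if_neg h, if_neg (fun h' => h ⟨h'.1.symm, h'.2.symm⟩)]

lemma Tile_ext {P P' : Tile} (h1 : P.s = P'.s) (h2 : P.i = P'.i) (h3 : P.j = P'.j) : P = P' := by
  cases P; cases P'; simp_all

lemma dk_sum {T : Finset Tile} (hv : ∀ P ∈ T, G.Valid P) (P : Tile) :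
    ∑ P' ∈ T, G.dk P P' ≤ 4 * G.C0 ^ 4 := by
  have hC := G.C0_pos
  unfold dk
  rw [← sum_filter, ← mul_sum]
  have := G.sum_wt_tiles (T := T.filter (fun P' => P.s = P'.s ∧ P.j = P'.j)) (s := P.s)
    (by
      intro Q hQ Q' hQ' hne
      simp only [mem_filter] at hQ hQ'
      apply G.disj_of_ne (hQ.2.1.symm.trans hQ'.2.1)
      intro hi
      exact hne (Tile_ext (hQ.2.1.symm.trans hQ'.2.1) hi (hQ.2.2.symm.trans hQ'.2.2)))
    (fun Q hQ => hv Q (mem_filter.1 hQ).1) (fun Q hQ => (mem_filter.1 hQ).2.1.symm) (G.c P)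
    (m := 4) (by norm_num)
  calc _ ≤ G.C0 ^ 3 * (4 * G.C0) := mul_le_mul_of_nonneg_left this (by positivity)
    _ = _ := by ring

lemma ip_dk {φ : Tile → X → ℂ} (hφ : G.Packet φ) {P P' : Tile} (h : G.Valid P)
    (h' : G.Valid P') (hs : P.s = P'.s) : ‖ip φ P P'‖ ≤ G.dk P P' := by
  unfold dk
  by_cases hj : P.j = P'.j
  · rw [if_pos ⟨hs, hj⟩]
    have := G.ip_bd hφ h h' hs.symm.le
    have hb : √(G.β P'.s) ≠ 0 := (Real.sqrt_pos.2 (G.β_pos _)).ne'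
    rwa [hs, div_self hb, mul_one, ← hs] at this
  · rw [if_neg (fun h => hj h.2)]
    have : ip φ P P' = 0 := by
      by_contra h0
      obtain ⟨ξ, h1, h2, _⟩ := hφ.orth P P' h h' hs.le h0
      rw [← hs] at h2
      exact hj (h1.symm.trans h2)
    simp [this]

end Geo
end
end CT

end

section
namespace CT
open Finset
open scoped Classical

section
variable {X : Type} [Fintype X]

namespace Geo
variable (G : Geo X)

def Le (P P' : Tile) : Prop :=
  P.s ≤ P'.s ∧ G.tb P'.s (G.c P) = P'.i ∧ ∀ ξ, G.fb P'.s ξ = P'.j → G.fb P.s ξ = P.j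

def InTree (s i ξ : ℕ) (P : Tile) : Prop :=
  P.s ≤ s ∧ G.tb s (G.c P) = i ∧ G.fb P.s ξ = P.j

def Energy (a : Tile → ℂ) (𝒬 : Finset Tile) (e : ℝ) : Prop :=
  ∀ s i ξ, s < G.S → ∀ T ⊆ 𝒬, (∀ P ∈ T, G.InTree s i ξ P ∧ G.up P.s ξ) →
    ∑ P ∈ T, ‖a P‖ ^ 2 ≤ e ^ 2 * G.β s

noncomputable def ms (E : Finset X) (N : X → ℕ) (P : Tile) (l : ℕ) : Finset X :=
  E.filter (fun x => G.fb P.s (N x) = P.j ∧ G.d x (G.c P) ≤ 2 ^ l * G.β P.s)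

def Mass (E : Finset X) (N : X → ℕ) (𝒬 : Finset Tile) (μ : ℝ) : Prop :=
  ∀ P ∈ 𝒬, ∀ P', G.Valid P' → G.Le P P' → ∀ l : ℕ,
    ((G.ms E N P' l).card : ℝ) ≤ μ * 4 ^ l * G.β P'.s

def act (N : X → ℕ) (P : Tile) (x : X) : Prop := G.fb P.s (N x) = P.j ∧ G.up P.s (N x)

noncomputable def Tf (N : X → ℕ) (a : Tile → ℂ) (ψ : Tile → X → ℂ) (T : Finset Tile) (x : X) : ℂ :=
  ∑ P ∈ T, if G.act N P x then a P * ψ P x else 0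

structure TD (E : Finset X) (N : X → ℕ) (a : Tile → ℂ) (ψ : Tile → X → ℂ) (T : Finset Tile)
    (s0 i0 ξ0 : ℕ) (e μ : ℝ) : Prop where
  hψ : G.Packet ψ
  hL : G.LowPass ψ
  hv : ∀ P ∈ T, G.Valid P
  hs0 : s0 < G.S
  tr : ∀ P ∈ T, G.InTree s0 i0 ξ0 P
  he : 0 ≤ e
  hμ : 0 ≤ μ
  en : G.Energy a T e
  ma : G.Mass E N T μ

lemma Le_refl {P : Tile} (h : G.Valid P) : G.Le P P := ⟨le_rfl, h.2.1, fun _ h => h⟩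

lemma wt_ratio {s : ℕ} {k : ℝ} (hk : 1 ≤ k) (x x' y : X) (h : G.d x' y ≤ k * G.d x y) :
    G.wt s x y ≤ k * G.wt s x' y := by
  have hb := G.β_pos s
  have a := div_nonneg (G.d_nonneg x y) hb.le
  have b := div_nonneg (G.d_nonneg x' y) hb.le
  unfold wt
  rw [← div_eq_mul_inv, le_div_iff₀ (by linarith), inv_mul_le_iff₀ (by linarith)]
  have : G.d x' y / G.β s ≤ k * (G.d x y / G.β s) := by
    rw [← mul_div_assoc]; exact div_le_div_of_nonneg_right h hb.le
  linarith

lemma Energy.single {a : Tile → ℂ} {T : Finset Tile} {e : ℝ} (he : 0 ≤ e) (h : G.Energy a T e)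
    {P : Tile} (hP : P ∈ T) (hv : G.Valid P) : ‖a P‖ ≤ e * √(G.β P.s) := by
  obtain ⟨ξ, hξ⟩ := hv.2.2
  obtain ⟨η, h1, h2⟩ := G.up_ex P.s ξ hv.1
  have := h P.s P.i η hv.1 {P} (by simpa using hP) (by
    intro Q hQ
    rw [mem_singleton] at hQ
    subst hQ
    exact ⟨⟨le_rfl, hv.2.1, h1.trans hξ⟩, h2⟩)
  rw [sum_singleton] at this
  apply le_of_sq_le_sq _ (by positivity)
  rwa [mul_pow, Real.sq_sqrt (G.β_pos _).le]

lemma massw {E : Finset X} {N : X → ℕ} {T : Finset Tile} {μ : ℝ} (hμ : 0 ≤ μ)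
    (h : G.Mass E N T μ) {P : Tile} (hP : P ∈ T) (hv : G.Valid P) :
    ∑ x ∈ E.filter (fun x => G.fb P.s (N x) = P.j), G.wt P.s x (G.c P) ^ 3 ≤
      16 * μ * G.β P.s := by
  have hb := G.β_pos P.s
  obtain ⟨m, hm⟩ : ∃ m : ℕ, ∀ x, G.d x (G.c P) ≤ 2 ^ m * G.β P.s := by
    obtain ⟨m, hm⟩ := pow_unbounded_of_one_lt (∑ x, G.d x (G.c P)) (one_lt_two)
    refine ⟨m, fun x => ?_⟩
    have h1 : G.d x (G.c P) ≤ ∑ x, G.d x (G.c P) :=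
      single_le_sum (f := fun x => G.d x (G.c P)) (fun x _ => G.d_nonneg _ _) (mem_univ x)
    have h2 := G.β_ge P.s
    have : (2:ℝ) ^ m ≤ 2 ^ m * G.β P.s := le_mul_of_one_le_right (by positivity) h2
    linarith
  have key : ∀ x, G.wt P.s x (G.c P) ^ 3 ≤ ∑ l ∈ range (m + 1),
      if G.d x (G.c P) ≤ 2 ^ l * G.β P.s then 8 * (1 / 8 : ℝ) ^ l else 0 := by
    intro x
    have hex : ∃ l : ℕ, G.d x (G.c P) ≤ 2 ^ l * G.β P.s := ⟨m, hm x⟩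
    have hl := Nat.find_spec hex
    have hle : Nat.find hex ≤ m := Nat.find_min' hex (hm x)
    set l := Nat.find hex with hldef
    have : G.wt P.s x (G.c P) ^ 3 ≤ 8 * (1 / 8 : ℝ) ^ l := by
      have w0 := G.wt_pos P.s x (G.c P)
      rcases Nat.eq_zero_or_pos l with h0 | h0
      · rw [h0]
        have : G.wt P.s x (G.c P) ^ 3 ≤ 1 := pow_le_one₀ w0.le (G.wt_le_one _ _ _)
        norm_num; linarith
      · have hn := Nat.find_min hex (m := l - 1) (by omega)
        push Not at hn
        have := G.wt_of_far (s := P.s) (r := 2 ^ (l - 1) * G.β P.s) (by positivity) x (G.c P) hn.le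
        have e1 : G.β P.s / (2 ^ (l - 1) * G.β P.s) = 2 * (1 / 2) ^ l := by
          obtain ⟨k, hk⟩ : ∃ k, l = k + 1 := ⟨l - 1, by omega⟩
          rw [hk]
          simp only [Nat.add_sub_cancel]
          rw [pow_succ]; field_simp; rw [← mul_pow]; norm_num
        rw [e1] at this
        calc _ ≤ (2 * (1 / 2 : ℝ) ^ l) ^ 3 := pow_le_pow_left₀ w0.le this 3
          _ = 8 * (1 / 8 : ℝ) ^ l := by
            rw [mul_pow, ← pow_mul, mul_comm l 3, pow_mul]; norm_num
    refine this.trans ?_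
    have h0 : ∀ k ∈ range (m + 1), (0:ℝ) ≤
      if G.d x (G.c P) ≤ 2 ^ k * G.β P.s then 8 * (1 / 8 : ℝ) ^ k else 0 := by
      intro k _; split_ifs <;> positivity
    refine le_trans (le_of_eq ?_) (single_le_sum h0 (mem_range.2 (Nat.lt_succ_of_le hle)))
    rw [if_pos hl]
  calc _ ≤ ∑ x ∈ E.filter (fun x => G.fb P.s (N x) = P.j), ∑ l ∈ range (m + 1),
      (if G.d x (G.c P) ≤ 2 ^ l * G.β P.s then 8 * (1 / 8 : ℝ) ^ l else 0) :=
        sum_le_sum fun x _ => key x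
    _ = ∑ l ∈ range (m + 1), ((G.ms E N P l).card : ℝ) * (8 * (1 / 8 : ℝ) ^ l) := by
        rw [sum_comm]
        apply sum_congr rfl; intro l _
        rw [← sum_filter, filter_filter, sum_const, nsmul_eq_mul, ms]
    _ ≤ ∑ l ∈ range (m + 1), (μ * 4 ^ l * G.β P.s) * (8 * (1 / 8 : ℝ) ^ l) := by
        apply sum_le_sum; intro l _
        exact mul_le_mul_of_nonneg_right (h P hP P hv (G.Le_refl hv) l) (by positivity)
    _ = 8 * μ * G.β P.s * ∑ l ∈ range (m + 1), (1 / 2 : ℝ) ^ l := by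
        rw [mul_sum]; apply sum_congr rfl; intro l _
        have : (1 / 2 : ℝ) ^ l = 4 ^ l * (1 / 8) ^ l := by rw [← mul_pow]; norm_num
        rw [this]; ring
    _ ≤ 8 * μ * G.β P.s * 2 := by
        apply mul_le_mul_of_nonneg_left _ (by positivity)
        have := sum_geometric_two_le (m + 1)
        simpa using this
    _ = _ := by ring

section
variable {G} {E : Finset X} {N : X → ℕ} {a : Tile → ℂ} {ψ : Tile → X → ℂ} {T : Finset Tile}
    {s0 i0 ξ0 : ℕ} {e μ : ℝ}

lemma TD.disj (D : G.TD E N a ψ T s0 i0 ξ0 e μ) (s : ℕ) : G.Disj (T.filter (fun P => P.s = s)) := by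
  intro P hP P' hP' hne
  simp only [mem_filter] at hP hP'
  apply G.disj_of_ne (hP.2.trans hP'.2.symm)
  intro hi
  apply hne
  apply Tile_ext (hP.2.trans hP'.2.symm) hi
  rw [← (D.tr P hP.1).2.2, ← (D.tr P' hP'.1).2.2, hP.2, hP'.2]

lemma TD.sum1 (D : G.TD E N a ψ T s0 i0 ξ0 e μ) (s : ℕ) :
    ∑ P ∈ T.filter (fun P => P.s = s), G.β P.s ≤ G.β s0 := by
  rcases T.eq_empty_or_nonempty with rfl | ⟨P1, hP1⟩
  · simpa using (G.β_pos s0).le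
  have h1 : ∑ P ∈ T.filter (fun P => P.s = s), G.β P.s =
      ∑ P ∈ T.filter (fun P => P.s = s), ∑ x ∈ G.I P, (1:ℝ) := by
    apply sum_congr rfl; intro P hP
    rw [← G.card_I (D.hv P (mem_filter.1 hP).1)]; simp
  rw [h1]
  refine (G.sum_disj (D.disj s) (A := univ.filter (fun y => G.tb s0 y = G.tb s0 (G.c P1))) ?_
    (fun _ => zero_le_one)).trans ?_
  · intro P hP x hx
    have hP := (mem_filter.1 hP).1
    simp only [mem_filter, mem_univ, true_and]
    rw [G.I_subset (D.hv P hP) (D.tr P hP).1 hx, (D.tr P hP).2.1, (D.tr P1 hP1).2.1]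
  · rw [sum_const, nsmul_eq_mul, mul_one, G.tb_card s0 D.hs0.le]

/-- sums over the tiles of a tree, organised by scales -/
lemma sum_scales (T : Finset Tile) (m : ℕ) (hT : ∀ P ∈ T, P.s < m) (f : Tile → ℝ) :
    ∑ P ∈ T, f P = ∑ s ∈ range m, ∑ P ∈ T.filter (fun P => P.s = s), f P :=
  (sum_fiberwise_of_maps_to (fun P hP => mem_range.2 (hT P hP)) f).symm

lemma TD.sum2 (D : G.TD E N a ψ T s0 i0 ξ0 e μ) : ∑ P ∈ T, G.β P.s ^ 2 ≤ 2 * G.β s0 ^ 2 := by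
  have hb := G.β_pos s0
  rw [sum_scales T (s0 + 1) (fun P hP => Nat.lt_succ_of_le (D.tr P hP).1)]
  calc _ ≤ ∑ s ∈ range (s0 + 1), G.β s * G.β s0 := by
        apply sum_le_sum; intro s _
        calc _ = G.β s * ∑ P ∈ T.filter (fun P => P.s = s), G.β P.s := by
              rw [mul_sum]; apply sum_congr rfl; intro P hP
              rw [(mem_filter.1 hP).2]; ring
          _ ≤ _ := mul_le_mul_of_nonneg_left (D.sum1 s) (G.β_pos s).le
    _ = (∑ s ∈ range (s0 + 1), G.β s) * G.β s0 := by rw [sum_mul]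
    _ ≤ (2 * G.β s0) * G.β s0 := by
        apply mul_le_mul_of_nonneg_right _ hb.le
        rw [sum_range_succ]; linarith [G.β_sum_lt s0]
    _ = _ := by ring

lemma TD.term (D : G.TD E N a ψ T s0 i0 ξ0 e μ) {P : Tile} (hP : P ∈ T) (x : X) :
    ‖a P * ψ P x‖ ≤ e * G.C0 * G.wt P.s x (G.c P) ^ 6 := by
  have h1 := D.en.single G D.he hP (D.hv P hP)
  have h2 := D.hψ.bd P (D.hv P hP) x
  have hb : 0 < √(G.β P.s) := Real.sqrt_pos.2 (G.β_pos _)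
  rw [norm_mul]
  calc _ ≤ (e * √(G.β P.s)) * (G.C0 / √(G.β P.s) * G.wt P.s x (G.c P) ^ 6) :=
        mul_le_mul h1 h2 (norm_nonneg _) (mul_nonneg D.he hb.le)
    _ = _ := by field_simp

end

/-- good blocks -/
def good (T : Finset Tile) (s : ℕ) (x : X) : Prop :=
  ∃ P ∈ T, P.s ≤ s ∧ ∃ y, G.tb s y = G.tb s x ∧ G.d y (G.c P) ≤ 4 * G.β s

lemma good_mono {T : Finset Tile} {s s' : ℕ} (h : s ≤ s') {x : X} (hg : G.good T s x) :
    G.good T s' x := by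
  obtain ⟨P, hP, h1, y, h2, h3⟩ := hg
  exact ⟨P, hP, h1.trans h, y, G.tb_mono _ _ _ _ h h2, h3.trans (by linarith [G.β_mono h])⟩

lemma good_congr {T : Finset Tile} {s : ℕ} {x x' : X} (h : G.tb s x = G.tb s x')
    (hg : G.good T s x) : G.good T s x' := by
  obtain ⟨P, hP, h1, y, h2, h3⟩ := hg
  exact ⟨P, hP, h1, y, h2.trans h, h3⟩

noncomputable def κ (T : Finset Tile) (x : X) : ℕ := sInf {s | G.good T s x}

lemma κ_good {T : Finset Tile} {s : ℕ} {x : X} (h : G.good T s x) : G.good T (G.κ T x) x :=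
  Nat.sInf_mem (s := {s | G.good T s x}) ⟨s, h⟩

lemma κ_le {T : Finset Tile} {s : ℕ} {x : X} (h : G.good T s x) : G.κ T x ≤ s :=
  Nat.sInf_le (s := {s | G.good T s x}) h

noncomputable def near (T : Finset Tile) (s0 : ℕ) : Finset X := univ.filter (fun x => G.good T s0 x)

noncomputable def cell (T : Finset Tile) (s0 : ℕ) (x0 : X) : Finset X :=
  (G.near T s0).filter (fun x => G.κ T x = G.κ T x0 ∧ G.tb (G.κ T x0) x = G.tb (G.κ T x0) x0)

lemma cell_card {T : Finset Tile} {s0 : ℕ} (hs0 : s0 < G.S) {x0 : X} (hx : x0 ∈ G.near T s0) :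
    G.β (G.κ T x0) ≤ 64 * ((G.cell T s0 x0).card : ℝ) := by
  simp only [near, mem_filter, mem_univ, true_and] at hx
  have hk := G.κ_le hx
  rcases Nat.eq_zero_or_pos (G.κ T x0) with h0 | h0
  · have hsub : univ.filter (fun y => G.tb 0 y = G.tb 0 x0) ⊆ G.cell T s0 x0 := by
      intro y hy
      simp only [mem_filter, mem_univ, true_and] at hy
      have g0 := G.κ_good hx
      rw [h0] at g0
      have gy := G.good_congr hy.symm g0
      simp only [cell, near, mem_filter, mem_univ, true_and]
      refine ⟨G.good_mono (Nat.zero_le _) gy, ?_, ?_⟩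
      · rw [h0]; exact Nat.le_zero.1 (G.κ_le gy)
      · rw [h0]; exact hy
    have := card_le_card hsub
    have hc := G.tb_card 0 (Nat.zero_le _) x0
    have : ((univ.filter (fun y => G.tb 0 y = G.tb 0 x0)).card : ℝ) ≤ (G.cell T s0 x0).card := by
      exact_mod_cast this
    rw [h0]
    have := G.β_pos 0
    linarith
  · obtain ⟨k, hk'⟩ : ∃ k, G.κ T x0 = k + 1 := ⟨G.κ T x0 - 1, by omega⟩
    have hsub : univ.filter (fun y => G.tb k y = G.tb k x0) ⊆ G.cell T s0 x0 := by
      intro y hy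
      simp only [mem_filter, mem_univ, true_and] at hy
      have g0 := G.κ_good hx
      rw [hk'] at g0
      have hy1 := G.tb_mono k (k + 1) _ _ (Nat.le_succ _) hy
      have gy := G.good_congr hy1.symm g0
      simp only [cell, near, mem_filter, mem_univ, true_and]
      refine ⟨G.good_mono (by omega) gy, ?_, ?_⟩
      · rw [hk']
        apply le_antisymm (G.κ_le gy)
        by_contra hlt
        push Not at hlt
        have g1 := G.good_mono (s' := k) (by omega) (G.κ_good gy)
        have g2 := G.κ_le (G.good_congr hy g1)
        omega
      · rw [hk']; exact hy1
    have := card_le_card hsub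
    have hc := G.tb_card k (by omega) x0
    have : ((univ.filter (fun y => G.tb k y = G.tb k x0)).card : ℝ) ≤ (G.cell T s0 x0).card := by
      exact_mod_cast this
    rw [hk', G.β_succ]
    linarith

lemma cells {T : Finset Tile} {s0 : ℕ} (hs0 : s0 < G.S) (u v : X → ℝ) {c : ℝ}
    (hu0 : ∀ x, 0 ≤ u x)
    (hu : ∀ x0 ∈ G.near T s0, ∀ y ∈ G.cell T s0 x0,
      ∑ x ∈ G.cell T s0 x0, u x ≤ c * G.β (G.κ T x0) * v y) :
    ∑ x ∈ G.near T s0, u x ≤ 64 * c * ∑ x ∈ G.near T s0, v x := by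
  set key : X → ℕ × ℕ := fun x => (G.κ T x, G.tb (G.κ T x) x) with hkey
  rw [← sum_fiberwise_of_maps_to (s := G.near T s0) (t := (G.near T s0).image key) (g := key)
      (fun x hx => mem_image_of_mem _ hx) u,
    ← sum_fiberwise_of_maps_to (s := G.near T s0) (t := (G.near T s0).image key) (g := key)
      (fun x hx => mem_image_of_mem _ hx) v, mul_sum]
  apply sum_le_sum
  intro b hb
  obtain ⟨x0, hx0, rfl⟩ := mem_image.1 hb
  have hcell : (G.near T s0).filter (fun x => key x = key x0) = G.cell T s0 x0 := by
    ext x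
    simp only [cell, mem_filter, hkey, Prod.mk.injEq]
    constructor
    · rintro ⟨h1, h2, h3⟩; rw [h2] at h3; exact ⟨h1, h2, h3⟩
    · rintro ⟨h1, h2, h3⟩; refine ⟨h1, h2, ?_⟩; rw [h2]; exact h3
  rw [hcell]
  have hβ := G.β_pos (G.κ T x0)
  set Sb := ∑ x ∈ G.cell T s0 x0, u x with hSb
  have hS0 : 0 ≤ Sb := sum_nonneg fun x _ => hu0 x
  have h1 : ((G.cell T s0 x0).card : ℝ) * Sb ≤
      c * G.β (G.κ T x0) * ∑ y ∈ G.cell T s0 x0, v y := by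
    have := card_nsmul_le_sum (G.cell T s0 x0) (fun y => c * G.β (G.κ T x0) * v y) Sb (hu x0 hx0)
    rwa [nsmul_eq_mul, ← mul_sum] at this
  have h2 := mul_le_mul_of_nonneg_right (G.cell_card hs0 hx0) hS0
  have h3 : G.β (G.κ T x0) * Sb ≤ G.β (G.κ T x0) * (64 * c * ∑ y ∈ G.cell T s0 x0, v y) := by
    nlinarith
  exact le_of_mul_le_mul_left h3 hβ

end Geo
end
end CT

end

section
namespace CT
open Finset
open scoped Classical

section
variable {X : Type} [Fintype X]

namespace Geo
variable {G : Geo X} {E : Finset X} {N : X → ℕ} {a : Tile → ℂ} {ψ : Tile → X → ℂ} {T : Finset Tile}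
    {s0 i0 ξ0 : ℕ} {e μ : ℝ}

lemma TD.near_card (D : G.TD E N a ψ T s0 i0 ξ0 e μ) :
    ((G.near T s0).card : ℝ) ≤ 49 * G.C0 * G.β s0 := by
  have hb := G.β_pos s0
  rcases T.eq_empty_or_nonempty with rfl | ⟨P1, hP1⟩
  · have : G.near ∅ s0 = ∅ := by
      simp [near, good]
    have := G.C0_pos
    rw [‹G.near ∅ s0 = ∅›]; simp; positivity
  have key : ∀ x ∈ G.near T s0, (1:ℝ) ≤ 49 * G.wt s0 (G.c P1) x ^ 2 := by
    intro x hx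
    simp only [near, mem_filter, mem_univ, true_and] at hx
    obtain ⟨P, hP, h1, y, h2, h3⟩ := hx
    have d1 := G.d_tb _ _ _ h2
    have d2 := G.d_tb s0 (G.c P) (G.c P1) ((D.tr P hP).2.1.trans (D.tr P1 hP1).2.1.symm)
    have d3 : G.d x (G.c P1) ≤ 6 * G.β s0 := by
      have := G.d_tri x y (G.c P1); have := G.d_tri y (G.c P) (G.c P1)
      rw [G.d_symm x y] at *; linarith
    have : (1/7:ℝ) ≤ G.wt s0 (G.c P1) x := by
      unfold wt
      rw [G.d_symm, one_div]
      apply inv_anti₀ (by have := div_nonneg (G.d_nonneg x (G.c P1)) hb.le; linarith)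
      have : G.d x (G.c P1) / G.β s0 ≤ 6 := by rw [div_le_iff₀ hb]; exact d3
      linarith
    nlinarith
  calc ((G.near T s0).card : ℝ) = ∑ x ∈ G.near T s0, (1:ℝ) := by simp
    _ ≤ ∑ x ∈ G.near T s0, 49 * G.wt s0 (G.c P1) x ^ 2 := sum_le_sum key
    _ ≤ ∑ x, 49 * G.wt s0 (G.c P1) x ^ 2 :=
        sum_le_sum_of_subset_of_nonneg (subset_univ _) (fun x _ _ => by positivity)
    _ ≤ _ := by
        rw [← mul_sum, mul_assoc]
        exact mul_le_mul_of_nonneg_left (G.sum_wt _ _) (by norm_num)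

/-- the far part -/
lemma TD.far (D : G.TD E N a ψ T s0 i0 ξ0 e μ) :
    ∑ x ∈ E.filter (fun x => ¬ G.good T s0 x), ‖G.Tf N a ψ T x‖ ≤ 32 * G.C0 * e * μ * G.β s0 := by
  have hb := G.β_pos s0
  have hC := G.C0_pos
  have he := D.he
  have hμ := D.hμ
  have key : ∀ x ∈ E.filter (fun x => ¬ G.good T s0 x), ‖G.Tf N a ψ T x‖ ≤
      ∑ P ∈ T, if G.fb P.s (N x) = P.j then
        e * G.C0 * (G.β P.s / G.β s0) * G.wt P.s x (G.c P) ^ 3 else 0 := by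
    intro x hx
    refine (norm_sum_le _ _).trans (sum_le_sum fun P hP => ?_)
    have w0 := G.wt_pos P.s x (G.c P)
    have hbP := G.β_pos P.s
    by_cases h : G.act N P x
    · rw [if_pos h, if_pos h.1]
      refine (D.term hP x).trans ?_
      have hfar : 4 * G.β s0 < G.d x (G.c P) := by
        by_contra hcon
        push Not at hcon
        exact (mem_filter.1 hx).2 ⟨P, hP, (D.tr P hP).1, x, rfl, hcon⟩
      have w1 := G.wt_of_far (s := P.s) (r := G.β s0) hb x (G.c P) (by linarith)
      have w2 := G.wt_le_one P.s x (G.c P)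
      have w3 : G.wt P.s x (G.c P) ^ 6 ≤ (G.β P.s / G.β s0) * G.wt P.s x (G.c P) ^ 3 := by
        calc _ ≤ G.wt P.s x (G.c P) ^ 4 := G.wt_pow_le _ _ _ (by norm_num)
          _ = G.wt P.s x (G.c P) * G.wt P.s x (G.c P) ^ 3 := by ring
          _ ≤ _ := mul_le_mul_of_nonneg_right w1 (by positivity)
      have : 0 ≤ e * G.C0 := by positivity
      calc _ ≤ e * G.C0 * ((G.β P.s / G.β s0) * G.wt P.s x (G.c P) ^ 3) :=
            mul_le_mul_of_nonneg_left w3 this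
        _ = _ := by ring
    · rw [if_neg h, norm_zero]
      split_ifs <;> positivity
  calc _ ≤ ∑ x ∈ E.filter (fun x => ¬ G.good T s0 x), ∑ P ∈ T, (if G.fb P.s (N x) = P.j then
        e * G.C0 * (G.β P.s / G.β s0) * G.wt P.s x (G.c P) ^ 3 else 0) := sum_le_sum key
    _ ≤ ∑ x ∈ E, ∑ P ∈ T, (if G.fb P.s (N x) = P.j then
        e * G.C0 * (G.β P.s / G.β s0) * G.wt P.s x (G.c P) ^ 3 else 0) := by
        apply sum_le_sum_of_subset_of_nonneg (filter_subset _ _)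
        intro x _ _
        apply sum_nonneg
        intro P _
        have w0 := G.wt_pos P.s x (G.c P)
        have hbP := G.β_pos P.s
        split_ifs <;> positivity
    _ = ∑ P ∈ T, e * G.C0 * (G.β P.s / G.β s0) *
        ∑ x ∈ E.filter (fun x => G.fb P.s (N x) = P.j), G.wt P.s x (G.c P) ^ 3 := by
        rw [sum_comm]
        apply sum_congr rfl; intro P _
        rw [← sum_filter, mul_sum]
    _ ≤ ∑ P ∈ T, e * G.C0 * (G.β P.s / G.β s0) * (16 * μ * G.β P.s) := by
        apply sum_le_sum; intro P hP
        have hbP := G.β_pos P.s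
        exact mul_le_mul_of_nonneg_left (G.massw hμ D.ma hP (D.hv P hP)) (by positivity)
    _ = (16 * e * μ * G.C0 / G.β s0) * ∑ P ∈ T, G.β P.s ^ 2 := by
        rw [mul_sum]; apply sum_congr rfl; intro P _; field_simp
    _ ≤ (16 * e * μ * G.C0 / G.β s0) * (2 * G.β s0 ^ 2) :=
        mul_le_mul_of_nonneg_left D.sum2 (by positivity)
    _ = _ := by field_simp; ring

/-- tail function -/
noncomputable def tl (G : Geo X) (E : Finset X) (N : X → ℕ) (T : Finset Tile) (x : X) : ℝ :=
  if x ∈ E then ∑ P ∈ T.filter (fun P => P.s < G.κ T x ∧ G.fb P.s (N x) = P.j),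
    G.wt P.s x (G.c P) ^ 6 else 0

lemma tl_nonneg (x : X) : 0 ≤ G.tl E N T x := by
  unfold tl; split_ifs
  · apply sum_nonneg; intro P _; have := G.wt_pos P.s x (G.c P); positivity
  · exact le_rfl

lemma β_sq_sum (G : Geo X) (s : ℕ) : ∑ k ∈ range s, G.β k ^ 2 ≤ G.β s ^ 2 := by
  calc _ ≤ ∑ k ∈ range s, G.β k * G.β s := by
        apply sum_le_sum; intro k hk
        rw [sq]; exact mul_le_mul_of_nonneg_left (G.β_mono (mem_range.1 hk).le) (G.β_pos k).le
    _ = (∑ k ∈ range s, G.β k) * G.β s := by rw [sum_mul]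
    _ ≤ _ := by rw [sq]; exact mul_le_mul_of_nonneg_right (G.β_sum_lt s) (G.β_pos s).le

lemma TD.tail (D : G.TD E N a ψ T s0 i0 ξ0 e μ) :
    ∑ x ∈ G.near T s0, G.tl E N T x ≤ 64 * (G.C0 ^ 2 * μ) * ∑ x ∈ G.near T s0, 1 := by
  have hC := G.C0_pos
  have hμ := D.hμ
  apply G.cells D.hs0 _ _ (fun x => tl_nonneg x)
  intro x0 hx0 y _
  set k := G.κ T x0 with hk
  have hbk := G.β_pos k
  set T' := T.filter (fun P => P.s < k) with hT'
  have step : ∀ P ∈ T', ∀ x ∈ G.cell T s0 x0, G.wt P.s x (G.c P) ^ 3 ≤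
      (16 * 289) * (G.β P.s / G.β k) * G.wt P.s x0 (G.c P) ^ 2 := by
    intro P hP x hx
    rw [hT', mem_filter] at hP
    simp only [cell, mem_filter, ← hk] at hx
    obtain ⟨m, hm⟩ : ∃ m, k = m + 1 := ⟨k - 1, by omega⟩
    have hfar : 4 * G.β m < G.d x (G.c P) := by
      by_contra hcon
      push Not at hcon
      have : G.good T m x := ⟨P, hP.1, by omega, x, rfl, hcon⟩
      have := G.κ_le this
      omega
    have hbm := G.β_pos m
    have e1 : G.β k = 64 * G.β m := by rw [hm, G.β_succ]
    have w0 := G.wt_pos P.s x (G.c P)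
    have w0' := G.wt_pos P.s x0 (G.c P)
    have w1 := G.wt_of_far (s := P.s) (r := 4 * G.β m) (by positivity) x (G.c P) hfar.le
    have e2 : G.β P.s / (4 * G.β m) = 16 * (G.β P.s / G.β k) := by rw [e1]; field_simp; ring
    rw [e2] at w1
    have d1 := G.d_tb k x x0 hx.2.2
    have w2 : G.wt P.s x (G.c P) ≤ 17 * G.wt P.s x0 (G.c P) := by
      apply G.wt_ratio (by norm_num)
      have := G.d_tri x0 x (G.c P)
      rw [G.d_symm x0 x] at this
      linarith
    calc _ = G.wt P.s x (G.c P) * G.wt P.s x (G.c P) ^ 2 := by ring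
      _ ≤ (16 * (G.β P.s / G.β k)) * (17 * G.wt P.s x0 (G.c P)) ^ 2 := by
          apply mul_le_mul w1 (pow_le_pow_left₀ w0.le w2 2) (by positivity)
          have := G.β_pos P.s
          positivity
      _ = _ := by ring
  calc ∑ x ∈ G.cell T s0 x0, G.tl E N T x
      ≤ ∑ x ∈ G.cell T s0 x0, ∑ P ∈ T', (if x ∈ E ∧ G.fb P.s (N x) = P.j then
          (16 * 289) * (G.β P.s / G.β k) * G.wt P.s x0 (G.c P) ^ 2 * G.wt P.s x (G.c P) ^ 3
          else 0) := by
        apply sum_le_sum; intro x hx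
        have hx' := hx
        simp only [cell, mem_filter, ← hk] at hx'
        unfold tl
        by_cases hE : x ∈ E
        · rw [if_pos hE, hx'.2.1, ← filter_filter, sum_filter]
          apply sum_le_sum; intro P hP
          by_cases hj : G.fb P.s (N x) = P.j
          · rw [if_pos hj, if_pos ⟨hE, hj⟩]
            have := step P hP x hx
            have w0 := G.wt_pos P.s x (G.c P)
            calc _ = G.wt P.s x (G.c P) ^ 3 * G.wt P.s x (G.c P) ^ 3 := by ring
              _ ≤ _ := mul_le_mul_of_nonneg_right this (by positivity)
          · rw [if_neg hj, if_neg (fun h => hj h.2)]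
        · rw [if_neg hE]
          apply sum_nonneg; intro P _
          rw [if_neg (fun h => hE h.1)]
    _ = ∑ P ∈ T', (16 * 289) * (G.β P.s / G.β k) * G.wt P.s x0 (G.c P) ^ 2 *
          ∑ x ∈ (G.cell T s0 x0).filter (fun x => x ∈ E ∧ G.fb P.s (N x) = P.j),
            G.wt P.s x (G.c P) ^ 3 := by
        rw [sum_comm]
        apply sum_congr rfl; intro P _
        rw [← sum_filter, mul_sum]
    _ ≤ ∑ P ∈ T', (16 * 289) * (G.β P.s / G.β k) * G.wt P.s x0 (G.c P) ^ 2 *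
          (16 * μ * G.β P.s) := by
        apply sum_le_sum; intro P hP
        have hP := (mem_filter.1 hP).1
        have hbP := G.β_pos P.s
        have w0' := G.wt_pos P.s x0 (G.c P)
        apply mul_le_mul_of_nonneg_left _ (by positivity)
        refine le_trans ?_ (G.massw hμ D.ma hP (D.hv P hP))
        apply sum_le_sum_of_subset_of_nonneg
        · intro x hx
          simp only [mem_filter] at hx ⊢
          exact hx.2
        · intro x _ _
          have := G.wt_pos P.s x (G.c P)
          positivity
    _ = (16 * 289 * 16 * μ / G.β k) * ∑ P ∈ T', G.β P.s ^ 2 * G.wt P.s x0 (G.c P) ^ 2 := by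
        rw [mul_sum]; apply sum_congr rfl; intro P _; field_simp
    _ = (16 * 289 * 16 * μ / G.β k) * ∑ s ∈ range k, ∑ P ∈ T'.filter (fun P => P.s = s),
          G.β P.s ^ 2 * G.wt P.s x0 (G.c P) ^ 2 := by
        rw [sum_scales T' k (fun P hP => (mem_filter.1 hP).2)]
    _ ≤ (16 * 289 * 16 * μ / G.β k) * ∑ s ∈ range k, G.β s ^ 2 * (4 * G.C0) := by
        apply mul_le_mul_of_nonneg_left _ (by positivity)
        apply sum_le_sum; intro s _
        have : ∑ P ∈ T'.filter (fun P => P.s = s), G.β P.s ^ 2 * G.wt P.s x0 (G.c P) ^ 2 =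
            G.β s ^ 2 * ∑ P ∈ T'.filter (fun P => P.s = s), G.wt s x0 (G.c P) ^ 2 := by
          rw [mul_sum]; apply sum_congr rfl; intro P hP
          rw [(mem_filter.1 hP).2]
        rw [this]
        apply mul_le_mul_of_nonneg_left _ (by positivity)
        apply G.sum_wt_tiles _ _ (fun P hP => (mem_filter.1 hP).2) _ le_rfl
        · intro P hP P' hP' hne
          simp only [hT', mem_filter] at hP hP'
          exact D.disj s P (mem_filter.2 ⟨hP.1.1, hP.2⟩) P' (mem_filter.2 ⟨hP'.1.1, hP'.2⟩) hne
        · intro P hP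
          simp only [hT', mem_filter] at hP
          exact D.hv P hP.1.1
    _ = (16 * 289 * 16 * μ / G.β k) * (4 * G.C0) * ∑ s ∈ range k, G.β s ^ 2 := by
        rw [← sum_mul]; ring
    _ ≤ (16 * 289 * 16 * μ / G.β k) * (4 * G.C0) * G.β k ^ 2 :=
        mul_le_mul_of_nonneg_left (G.β_sq_sum k) (by positivity)
    _ = (16 * 289 * 16 * 4) * G.C0 * μ * G.β k := by field_simp
    _ ≤ G.C0 * G.C0 * μ * G.β k := by
        have h1 := G.C0_ge
        have : (16 * 289 * 16 * 4 : ℝ) ≤ G.C0 := le_trans (by norm_num) h1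
        gcongr
    _ = _ := by ring

end Geo
end
end CT

end

section
namespace CT
open Finset
open scoped Classical

section
variable {X : Type} [Fintype X]

namespace Geo
variable {G : Geo X} {E : Finset X} {N : X → ℕ} {a : Tile → ℂ} {ψ : Tile → X → ℂ} {T : Finset Tile}
    {s0 i0 ξ0 : ℕ} {e μ : ℝ}

/-- main part of the tree at a point -/
noncomputable def mp (G : Geo X) (N : X → ℕ) (a : Tile → ℂ) (ψ : Tile → X → ℂ) (T : Finset Tile)
    (x : X) : ℂ :=
  ∑ P ∈ T.filter (fun P => G.κ T x ≤ P.s), if G.act N P x then a P * ψ P x else 0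

noncomputable def mn (G : Geo X) (E : Finset X) (N : X → ℕ) (a : Tile → ℂ) (ψ : Tile → X → ℂ)
    (T : Finset Tile) (ξ0 : ℕ) (x : X) : ℝ :=
  if x ∈ E ∧ G.fb (G.κ T x) (N x) = G.fb (G.κ T x) ξ0 then ‖G.mp N a ψ T x‖ else 0

noncomputable def T2 (G : Geo X) (T : Finset Tile) (ξ0 : ℕ) : Finset Tile :=
  T.filter (fun P => G.up P.s ξ0)

noncomputable def F2 (G : Geo X) (a : Tile → ℂ) (ψ : Tile → X → ℂ) (T : Finset Tile) (ξ0 : ℕ)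
    (x : X) : ℝ := ‖∑ P ∈ G.T2 T ξ0, a P * ψ P x‖

lemma TD.F2_bd (D : G.TD E N a ψ T s0 i0 ξ0 e μ) :
    ∑ x, G.F2 a ψ T ξ0 x ^ 2 ≤ 4 * G.C0 ^ 4 * (e ^ 2 * G.β s0) := by
  have hC := G.C0_pos
  have hv : ∀ P ∈ G.T2 T ξ0, G.Valid P := fun P hP => D.hv P (mem_filter.1 hP).1
  have h1 : ∀ P ∈ G.T2 T ξ0, ∀ P' ∈ G.T2 T ξ0, ‖ip ψ P P'‖ ≤ G.dk P P' := by
    have aux : ∀ P ∈ G.T2 T ξ0, ∀ P' ∈ G.T2 T ξ0, P.s < P'.s → ip ψ P P' = 0 := by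
      intro P hP P' hP' hlt
      by_contra h0
      obtain ⟨ξ, h1, h2, h3⟩ := D.hψ.orth P P' (hv P hP) (hv P' hP') hlt.le h0
      have u := (mem_filter.1 hP).2
      have t' := (D.tr P' (mem_filter.1 hP').1).2.2
      exact h3 ((G.up_congr P.s P'.s ξ ξ0 hlt (h2.trans t'.symm)).2 u)
    intro P hP P' hP'
    rcases lt_trichotomy P.s P'.s with h | h | h
    · rw [aux P hP P' hP' h, norm_zero]; exact G.dk_nonneg _ _
    · exact G.ip_dk D.hψ (hv P hP) (hv P' hP') h
    · rw [ip_symm, aux P' hP' P hP h, norm_zero]; exact G.dk_nonneg _ _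
  calc _ ≤ ∑ P ∈ G.T2 T ξ0, ∑ P' ∈ G.T2 T ξ0, ‖a P‖ * ‖a P'‖ * ‖ip ψ P P'‖ := sq_expand ψ a _
    _ ≤ ∑ P ∈ G.T2 T ξ0, ∑ P' ∈ G.T2 T ξ0, ‖a P‖ * ‖a P'‖ * G.dk P P' := by
        apply sum_le_sum; intro P hP; apply sum_le_sum; intro P' hP'
        exact mul_le_mul_of_nonneg_left (h1 P hP P' hP') (by positivity)
    _ ≤ 4 * G.C0 ^ 4 * ∑ P ∈ G.T2 T ξ0, ‖a P‖ ^ 2 :=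
        schur _ _ _ _ G.dk_nonneg G.dk_symm (fun P _ => G.dk_sum hv P)
    _ ≤ _ := by
        apply mul_le_mul_of_nonneg_left _ (by positivity)
        exact D.en s0 i0 ξ0 D.hs0 _ (filter_subset _ _)
          (fun P hP => ⟨D.tr P (mem_filter.1 hP).1, (mem_filter.1 hP).2⟩)

/-- the part of the tree with the frequency in the lower piece -/
lemma TD.one (D : G.TD E N a ψ T s0 i0 ξ0 e μ) (x : X) (R : Finset Tile) (hR : R ⊆ T)
    (hup : ∀ P ∈ R, ¬ G.up P.s ξ0) :
    ‖∑ P ∈ R, if G.act N P x then a P * ψ P x else 0‖ ≤ 4 * G.C0 ^ 2 * e := by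
  have hC := G.C0_pos
  have he := D.he
  rw [← sum_filter]
  set R' := R.filter (fun P => G.act N P x) with hR'
  rcases R'.eq_empty_or_nonempty with h0 | ⟨P1, hP1⟩
  · rw [h0]; simp; positivity
  have aux : ∀ P ∈ R', ∀ P' ∈ R', ¬ P.s < P'.s := by
    intro P hP P' hP' hlt
    rw [hR', mem_filter] at hP hP'
    have t' := (D.tr P' (hR hP'.1)).2.2
    exact hup P hP.1 ((G.up_congr P.s P'.s (N x) ξ0 hlt (hP'.2.1.trans t'.symm)).1 hP.2.2)
  have hs : ∀ P ∈ R', P.s = P1.s := fun P hP =>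
    le_antisymm (not_lt.1 (aux P1 hP1 P hP)) (not_lt.1 (aux P hP P1 hP1))
  have hsub : ∀ P ∈ R', P ∈ T := fun P hP => hR (mem_filter.1 hP).1
  calc _ ≤ ∑ P ∈ R', e * G.C0 * G.wt P1.s x (G.c P) ^ 6 := by
        refine (norm_sum_le _ _).trans (sum_le_sum fun P hP => ?_)
        rw [← hs P hP]
        exact D.term (hsub P hP) x
    _ = e * G.C0 * ∑ P ∈ R', G.wt P1.s x (G.c P) ^ 6 := by rw [mul_sum]
    _ ≤ e * G.C0 * (4 * G.C0) := by
        apply mul_le_mul_of_nonneg_left _ (by positivity)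
        apply G.sum_wt_tiles _ (fun P hP => D.hv P (hsub P hP)) hs x (by norm_num)
        intro P hP P' hP' hne
        exact D.disj P1.s P (mem_filter.2 ⟨hsub P hP, hs P hP⟩) P'
          (mem_filter.2 ⟨hsub P' hP', hs P' hP'⟩) hne
    _ = _ := by ring

lemma TD.lowpass (D : G.TD E N a ψ T s0 i0 ξ0 e μ) {s k : ℕ} (hs : s ≤ G.S) (hk : k ≤ s)
    {x y : X} (hxy : G.tb k x = G.tb k y) :
    ‖∑ P ∈ (G.T2 T ξ0).filter (fun P => s ≤ P.s), a P * ψ P x‖ ≤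
      4 * G.C0 * G.mx (G.F2 a ψ T ξ0) y := by
  have hC := G.C0_pos
  have hb := G.β_pos s
  obtain ⟨K, hK1, hK2⟩ := D.hL s hs ξ0
  have e1 : ∑ P ∈ (G.T2 T ξ0).filter (fun P => s ≤ P.s), a P * ψ P x =
      ∑ z, K x z * ∑ P ∈ G.T2 T ξ0, a P * ψ P z := by
    have : ∑ z, K x z * ∑ P ∈ G.T2 T ξ0, a P * ψ P z =
        ∑ P ∈ G.T2 T ξ0, a P * ∑ z, K x z * ψ P z := by
      simp only [mul_sum]
      rw [sum_comm]
      apply sum_congr rfl; intro P _; apply sum_congr rfl; intro z _; ring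
    rw [this, sum_filter]
    apply sum_congr rfl; intro P hP
    have hP1 := mem_filter.1 hP
    have := hK2 P (D.hv P hP1.1) (D.tr P hP1.1).2.2
    by_cases h : s ≤ P.s
    · rw [if_pos h, this.1 h x]
    · rw [if_neg h, this.2 (not_le.1 h) hP1.2 x, mul_zero]
  rw [e1]
  have e2 : ‖∑ z, K x z * ∑ P ∈ G.T2 T ξ0, a P * ψ P z‖ ≤
      4 * G.C0 * G.av s (G.F2 a ψ T ξ0) y := by
    refine (norm_sum_le _ _).trans ?_
    rw [av, mul_sum]
    apply sum_le_sum; intro z _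
    rw [norm_mul]
    have w1 : G.wt s x z ≤ 2 * G.wt s y z := by
      rw [G.wt_symm s x z, G.wt_symm s y z]
      have := G.wt_near (s := s) (k := 1) zero_le_one z x y (by
        rw [one_mul]; exact (G.d_tb k x y hxy).trans (G.β_mono hk))
      linarith
    have w0 := G.wt_pos s x z
    have w2 : G.wt s x z ^ 2 ≤ 4 * G.wt s y z ^ 2 := by nlinarith
    calc _ ≤ (G.C0 / G.β s * G.wt s x z ^ 2) * G.F2 a ψ T ξ0 z :=
          mul_le_mul_of_nonneg_right (hK1 x z) (norm_nonneg _)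
      _ ≤ (G.C0 / G.β s * (4 * G.wt s y z ^ 2)) * G.F2 a ψ T ξ0 z := by
          have : 0 ≤ G.F2 a ψ T ξ0 z := norm_nonneg _
          gcongr
      _ = _ := by rw [div_eq_mul_inv]; ring
  refine e2.trans ?_
  exact mul_le_mul_of_nonneg_left (G.av_le_mx hs _ _) (by positivity)

lemma TD.two (D : G.TD E N a ψ T s0 i0 ξ0 e μ) {k : ℕ} {x y : X}
    (hxy : G.tb k x = G.tb k y) :
    ‖∑ P ∈ (G.T2 T ξ0).filter (fun P => k ≤ P.s), if G.act N P x then a P * ψ P x else 0‖ ≤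
      8 * G.C0 * G.mx (G.F2 a ψ T ξ0) y := by
  have hC := G.C0_pos
  have hM : 0 ≤ G.mx (G.F2 a ψ T ξ0) y := G.mx_nonneg (fun x => norm_nonneg _) y
  rw [← sum_filter]
  set R := ((G.T2 T ξ0).filter (fun P => k ≤ P.s)).filter (fun P => G.act N P x) with hR
  rcases R.eq_empty_or_nonempty with h0 | hne
  · rw [h0]; simp; positivity
  obtain ⟨P1, hP1, hmax⟩ := exists_max_image R (fun P => P.s) hne
  have hP1' := hP1
  simp only [hR, T2, mem_filter] at hP1'
  have t1 := (D.tr P1 hP1'.1.1.1).2.2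
  have hsplit : ∑ P ∈ R, a P * ψ P x =
      ∑ P ∈ (G.T2 T ξ0).filter (fun P => k ≤ P.s), a P * ψ P x -
      ∑ P ∈ (G.T2 T ξ0).filter (fun P => P1.s + 1 ≤ P.s), a P * ψ P x := by
    rw [eq_sub_iff_add_eq, ← sum_union]
    · apply sum_congr _ (fun _ _ => rfl)
      ext P
      constructor
      · intro h
        rcases mem_union.1 h with h | h
        · exact (mem_filter.1 h).1
        · rw [mem_filter] at h ⊢
          exact ⟨h.1, by omega⟩
      · intro h
        by_cases hlt : P1.s + 1 ≤ P.s
        · exact mem_union_right _ (mem_filter.2 ⟨(mem_filter.1 h).1, hlt⟩)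
        · apply mem_union_left
          rw [hR, mem_filter]
          refine ⟨h, ?_⟩
          simp only [T2, mem_filter] at h
          have t := (D.tr P h.1.1).2.2
          have hfb : G.fb P1.s (N x) = G.fb P1.s ξ0 := hP1'.2.1.trans t1.symm
          rcases (show P.s ≤ P1.s by omega).eq_or_lt with he | hl
          · refine ⟨?_, ?_⟩
            · rw [he, hfb, ← he]; exact t
            · rw [he]; exact hP1'.2.2
          · exact ⟨(G.fb_mono _ _ _ _ hl.le hfb).trans t, (G.up_congr _ _ _ _ hl hfb).2 h.1.2⟩
    · rw [Finset.disjoint_left]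
      intro P hP hP'
      have := hmax P hP
      have := (mem_filter.1 hP').2
      omega
  rw [hsplit]
  have b1 := D.lowpass (s := k) (by have := (D.hv P1 hP1'.1.1.1).1; omega) le_rfl hxy
  have b2 := D.lowpass (s := P1.s + 1) (by have := (D.hv P1 hP1'.1.1.1).1; omega)
    (show k ≤ P1.s + 1 by omega) hxy
  refine (norm_sub_le _ _).trans ?_
  linarith

lemma TD.mp_bd (D : G.TD E N a ψ T s0 i0 ξ0 e μ) {x y : X}
    (hxy : G.tb (G.κ T x) x = G.tb (G.κ T x) y) :
    ‖G.mp N a ψ T x‖ ≤ 4 * G.C0 ^ 2 * e + 8 * G.C0 * G.mx (G.F2 a ψ T ξ0) y := by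
  unfold mp
  rw [← sum_filter_add_sum_filter_not _ (fun P => G.up P.s ξ0)]
  have h2 := D.two hxy (N := N)
  have e1 : (T.filter (fun P => G.κ T x ≤ P.s)).filter (fun P => G.up P.s ξ0) =
      (G.T2 T ξ0).filter (fun P => G.κ T x ≤ P.s) := by
    ext P; simp only [T2, mem_filter]; tauto
  rw [e1]
  have h1 := D.one x ((T.filter (fun P => G.κ T x ≤ P.s)).filter (fun P => ¬ G.up P.s ξ0))
    ((filter_subset _ _).trans (filter_subset _ _)) (fun P hP => (mem_filter.1 hP).2)
  refine (norm_add_le _ _).trans ?_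
  linarith

lemma TD.main (D : G.TD E N a ψ T s0 i0 ξ0 e μ) :
    ∑ x ∈ G.near T s0, G.mn E N a ψ T ξ0 x ≤ 64 * (64 * μ) *
      ∑ y ∈ G.near T s0, (4 * G.C0 ^ 2 * e + 8 * G.C0 * G.mx (G.F2 a ψ T ξ0) y) := by
  have hC := G.C0_pos
  have he := D.he
  have hμ := D.hμ
  apply G.cells D.hs0
  · intro x; unfold mn; split_ifs
    · exact norm_nonneg _
    · exact le_rfl
  intro x0 hx0 y hy
  set k := G.κ T x0 with hk
  set V := 4 * G.C0 ^ 2 * e + 8 * G.C0 * G.mx (G.F2 a ψ T ξ0) y with hV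
  have hV0 : 0 ≤ V := by
    have : 0 ≤ G.mx (G.F2 a ψ T ξ0) y := G.mx_nonneg (fun x => norm_nonneg _) y
    positivity
  have hb := G.β_pos k
  simp only [near, mem_filter, mem_univ, true_and] at hx0
  obtain ⟨P0, hP0, h1, y0, h2, h3⟩ := G.κ_good hx0
  rw [← hk] at h1 h2 h3
  have hks : k ≤ s0 := G.κ_le hx0
  have hkS : k < G.S := lt_of_le_of_lt hks D.hs0
  set P' : Tile := ⟨k, G.tb k (G.c P0), G.fb k ξ0⟩ with hP'
  have hvP' : G.Valid P' := ⟨hkS, G.tb_ctr k hkS.le _, ⟨ξ0, rfl⟩⟩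
  have hle : G.Le P0 P' := by
    refine ⟨h1, rfl, fun ξ hξ => ?_⟩
    rw [← (D.tr P0 hP0).2.2]
    exact G.fb_mono _ _ _ _ h1 hξ
  have hm := D.ma P0 hP0 P' hvP' hle 3
  have hy' := hy
  simp only [cell, mem_filter, ← hk] at hy'
  have hsub : (G.cell T s0 x0).filter (fun x => x ∈ E ∧ G.fb k (N x) = G.fb k ξ0) ⊆
      G.ms E N P' 3 := by
    intro x hx
    simp only [cell, mem_filter, ← hk] at hx
    rw [ms, mem_filter]
    refine ⟨hx.2.1, hx.2.2, ?_⟩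
    have d1 := G.d_tb k x y0 (hx.1.2.2.trans h2.symm)
    have d2 := G.d_tb k (G.c P0) (G.c P') (hvP'.2.1).symm
    have := G.d_tri x y0 (G.c P')
    have := G.d_tri y0 (G.c P0) (G.c P')
    have e1 : G.β P'.s = G.β k := rfl
    rw [e1]; linarith
  calc ∑ x ∈ G.cell T s0 x0, G.mn E N a ψ T ξ0 x
      ≤ ∑ x ∈ G.cell T s0 x0, (if x ∈ E ∧ G.fb k (N x) = G.fb k ξ0 then V else 0) := by
        apply sum_le_sum; intro x hx
        simp only [cell, mem_filter, ← hk] at hx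
        unfold mn
        rw [hx.2.1]
        split_ifs
        · apply D.mp_bd
          rw [hx.2.1, hx.2.2, hy'.2.2]
        · exact le_rfl
    _ = (((G.cell T s0 x0).filter (fun x => x ∈ E ∧ G.fb k (N x) = G.fb k ξ0)).card : ℝ) * V := by
        rw [← sum_filter, sum_const, nsmul_eq_mul]
    _ ≤ ((G.ms E N P' 3).card : ℝ) * V := by
        apply mul_le_mul_of_nonneg_right _ hV0
        exact_mod_cast card_le_card hsub
    _ ≤ (μ * 4 ^ 3 * G.β k) * V := mul_le_mul_of_nonneg_right hm hV0
    _ = _ := by ring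

/-- **Tree lemma.** -/
lemma TD.tree (D : G.TD E N a ψ T s0 i0 ξ0 e μ) :
    ∑ x ∈ E, ‖G.Tf N a ψ T x‖ ≤ G.C0 ^ 7 * e * μ * G.β s0 := by
  have hC := G.C0_pos
  have hC2 := G.C0_ge
  have he := D.he
  have hμ := D.hμ
  have hb := G.β_pos s0
  rw [← sum_filter_add_sum_filter_not E (fun x => G.good T s0 x)]
  have hfar := D.far
  have point : ∀ x ∈ E.filter (fun x => G.good T s0 x),
      ‖G.Tf N a ψ T x‖ ≤ e * G.C0 * G.tl E N T x + G.mn E N a ψ T ξ0 x := by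
    intro x hx
    rw [mem_filter] at hx
    unfold Tf
    rw [← sum_filter_add_sum_filter_not T (fun P => P.s < G.κ T x)]
    refine (norm_add_le _ _).trans (add_le_add ?_ ?_)
    · refine (norm_sum_le _ _).trans ?_
      rw [tl, if_pos hx.1, mul_sum, ← filter_filter, sum_filter (fun P : Tile => G.fb P.s (N x) = P.j)]
      apply sum_le_sum; intro P hP
      have hP := (mem_filter.1 hP).1
      have w0 := G.wt_pos P.s x (G.c P)
      by_cases h : G.act N P x
      · rw [if_pos h, if_pos h.1]; exact D.term hP x
      · rw [if_neg h, norm_zero]; split_ifs <;> positivity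
    · have e1 : T.filter (fun P => ¬ P.s < G.κ T x) = T.filter (fun P => G.κ T x ≤ P.s) := by
        ext P; simp only [mem_filter, not_lt]
      rw [e1]
      unfold mn
      by_cases h : G.fb (G.κ T x) (N x) = G.fb (G.κ T x) ξ0
      · rw [if_pos ⟨hx.1, h⟩]; exact le_rfl
      · rw [if_neg (fun h' => h h'.2)]
        apply le_of_eq
        rw [norm_eq_zero]
        apply sum_eq_zero
        intro P hP
        rw [mem_filter] at hP
        rw [if_neg]
        intro hact
        exact h (G.fb_mono _ _ _ _ hP.2 (hact.1.trans (D.tr P hP.1).2.2.symm))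
  have hsubn : E.filter (fun x => G.good T s0 x) ⊆ G.near T s0 := by
    intro x hx; simp only [near, mem_filter, mem_univ, true_and] at hx ⊢; exact hx.2
  have mn0 : ∀ x, 0 ≤ G.mn E N a ψ T ξ0 x := by
    intro x; unfold mn; split_ifs
    · exact norm_nonneg _
    · exact le_rfl
  have hnear : ∑ x ∈ E.filter (fun x => G.good T s0 x), ‖G.Tf N a ψ T x‖ ≤
      e * G.C0 * ∑ x ∈ G.near T s0, G.tl E N T x + ∑ x ∈ G.near T s0, G.mn E N a ψ T ξ0 x := by
    rw [mul_sum, ← sum_add_distrib]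
    refine (sum_le_sum point).trans ?_
    apply sum_le_sum_of_subset_of_nonneg hsubn
    intro x _ _
    have := tl_nonneg (G := G) (E := E) (N := N) (T := T) x
    have := mn0 x
    positivity
  have hcard := D.near_card
  have htail := D.tail
  have hmain := D.main
  rw [sum_const, nsmul_eq_mul, mul_one] at htail
  set M := ∑ y ∈ G.near T s0, G.mx (G.F2 a ψ T ξ0) y with hM
  have hmain2 : ∑ y ∈ G.near T s0, (4 * G.C0 ^ 2 * e + 8 * G.C0 * G.mx (G.F2 a ψ T ξ0) y) =
      4 * G.C0 ^ 2 * e * ((G.near T s0).card : ℝ) + 8 * G.C0 * M := by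
    rw [sum_add_distrib, sum_const, nsmul_eq_mul, hM, mul_sum]; ring
  rw [hmain2] at hmain
  have hM2 : M ≤ G.C0 ^ 4 * e * G.β s0 := by
    apply le_of_sq_le_sq _ (by positivity)
    have c1 : M ^ 2 ≤ ((G.near T s0).card : ℝ) * ∑ y ∈ G.near T s0, G.mx (G.F2 a ψ T ξ0) y ^ 2 :=
      sq_sum_le_card_mul_sum_sq
    have c2 : ∑ y ∈ G.near T s0, G.mx (G.F2 a ψ T ξ0) y ^ 2 ≤
        ∑ y, G.mx (G.F2 a ψ T ξ0) y ^ 2 :=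
      sum_le_sum_of_subset_of_nonneg (subset_univ _) (fun x _ _ => by positivity)
    have c3 := G.mx_bd (G.F2 a ψ T ξ0)
    have c4 := D.F2_bd
    calc M ^ 2 ≤ (49 * G.C0 * G.β s0) * ((8 * G.C0) ^ 2 * (4 * G.C0 ^ 4 * (e ^ 2 * G.β s0))) := by
          refine c1.trans (mul_le_mul hcard ?_ (by positivity) (by positivity))
          exact c2.trans (c3.trans (mul_le_mul_of_nonneg_left c4 (by positivity)))
      _ = (49 * 256) * (G.C0 ^ 7 * e ^ 2 * G.β s0 ^ 2) := by ring
      _ ≤ G.C0 * (G.C0 ^ 7 * e ^ 2 * G.β s0 ^ 2) := by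
          apply mul_le_mul_of_nonneg_right _ (by positivity)
          linarith
      _ = _ := by ring
  have p1 : e * G.C0 * ∑ x ∈ G.near T s0, G.tl E N T x ≤
      64 * 49 * G.C0 ^ 4 * (e * μ * G.β s0) := by
    calc _ ≤ e * G.C0 * (64 * (G.C0 ^ 2 * μ) * (49 * G.C0 * G.β s0)) := by
          apply mul_le_mul_of_nonneg_left _ (by positivity)
          exact htail.trans (mul_le_mul_of_nonneg_left hcard (by positivity))
      _ = _ := by ring
  have p2 : ∑ x ∈ G.near T s0, G.mn E N a ψ T ξ0 x ≤
      (4096 * 196 * G.C0 ^ 3 + 4096 * 8 * G.C0 ^ 5) * (e * μ * G.β s0) := by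
    calc _ ≤ 64 * (64 * μ) * (4 * G.C0 ^ 2 * e * (49 * G.C0 * G.β s0) +
          8 * G.C0 * (G.C0 ^ 4 * e * G.β s0)) := by
          refine hmain.trans ?_
          apply mul_le_mul_of_nonneg_left _ (by positivity)
          gcongr
      _ = _ := by ring
  have p0 : 0 ≤ e * μ * G.β s0 := by positivity
  have q : 32 * G.C0 + 64 * 49 * G.C0 ^ 4 + (4096 * 196 * G.C0 ^ 3 + 4096 * 8 * G.C0 ^ 5) ≤
      G.C0 ^ 7 := by
    have h1 : 1 ≤ G.C0 := G.C0_one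
    have a1 : G.C0 ≤ G.C0 ^ 5 := by
      calc G.C0 = G.C0 ^ 1 := (pow_one _).symm
        _ ≤ _ := pow_le_pow_right₀ h1 (by norm_num)
    have a3 : G.C0 ^ 3 ≤ G.C0 ^ 5 := pow_le_pow_right₀ h1 (by norm_num)
    have a4 : G.C0 ^ 4 ≤ G.C0 ^ 5 := pow_le_pow_right₀ h1 (by norm_num)
    have a5 : (2 ^ 20 * 2 ^ 20) * G.C0 ^ 5 ≤ G.C0 ^ 7 := by
      calc _ ≤ (G.C0 * G.C0) * G.C0 ^ 5 := by gcongr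
        _ = _ := by ring
    have : 0 < G.C0 ^ 5 := by positivity
    nlinarith
  calc _ ≤ (64 * 49 * G.C0 ^ 4 * (e * μ * G.β s0) +
      (4096 * 196 * G.C0 ^ 3 + 4096 * 8 * G.C0 ^ 5) * (e * μ * G.β s0)) +
      32 * G.C0 * e * μ * G.β s0 := by linarith
    _ = (32 * G.C0 + 64 * 49 * G.C0 ^ 4 + (4096 * 196 * G.C0 ^ 3 + 4096 * 8 * G.C0 ^ 5)) *
      (e * μ * G.β s0) := by ring
    _ ≤ G.C0 ^ 7 * (e * μ * G.β s0) := mul_le_mul_of_nonneg_right q p0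
    _ = _ := by ring

end Geo
end
end CT

end

section
namespace CT
open Finset
open scoped Classical

section
variable {X : Type} [Fintype X]

namespace Geo
variable (G : Geo X) 

/-- covered by trees of total size at most `B` -/
def Cov (𝒬 : Finset Tile) (B : ℝ) : Prop :=
  ∃ l : List (ℕ × ℕ × ℕ), (∀ t ∈ l, t.1 < G.S) ∧
    (∀ P ∈ 𝒬, ∃ t ∈ l, G.InTree t.1 t.2.1 t.2.2 P) ∧ (l.map (fun t => G.β t.1)).sum ≤ B

variable {G}

lemma Cov.mono {𝒬 𝒬' : Finset Tile} {B B' : ℝ} (h : G.Cov 𝒬 B) (hs : 𝒬' ⊆ 𝒬) (hB : B ≤ B') :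
    G.Cov 𝒬' B' := by
  obtain ⟨l, h1, h2, h3⟩ := h
  exact ⟨l, h1, fun P hP => h2 P (hs hP), h3.trans hB⟩

lemma Cov.union {𝒬 𝒬' : Finset Tile} {B B' : ℝ} (h : G.Cov 𝒬 B) (h' : G.Cov 𝒬' B') :
    G.Cov (𝒬 ∪ 𝒬') (B + B') := by
  obtain ⟨l, h1, h2, h3⟩ := h
  obtain ⟨l', h1', h2', h3'⟩ := h'
  refine ⟨l ++ l', ?_, ?_, ?_⟩
  · intro t ht
    rcases List.mem_append.1 ht with h | h
    · exact h1 t h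
    · exact h1' t h
  · intro P hP
    rcases mem_union.1 hP with h | h
    · obtain ⟨t, ht, h⟩ := h2 P h; exact ⟨t, List.mem_append_left _ ht, h⟩
    · obtain ⟨t, ht, h⟩ := h2' P h; exact ⟨t, List.mem_append_right _ ht, h⟩
  · rw [List.map_append, List.sum_append]; linarith

lemma Cov.empty : G.Cov ∅ 0 := ⟨[], by simp, by simp, by simp⟩

lemma Cov.biUnion {ι : Type} (s : Finset ι) (f : ι → Finset Tile) (B : ι → ℝ)
    (h : ∀ i ∈ s, G.Cov (f i) (B i)) : G.Cov (s.biUnion f) (∑ i ∈ s, B i) := by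
  induction s using Finset.induction_on with
  | empty => simpa using Cov.empty
  | insert i s hi ih =>
    rw [biUnion_insert, sum_insert hi]
    exact (h i (mem_insert_self _ _)).union (ih fun j hj => h j (mem_insert_of_mem hj))

lemma Cov.tree {𝒬 : Finset Tile} {s i ξ : ℕ} (hs : s < G.S) (h : ∀ P ∈ 𝒬, G.InTree s i ξ P) :
    G.Cov 𝒬 (G.β s) :=
  ⟨[(s, i, ξ)], by simpa using hs, fun P hP => ⟨(s, i, ξ), by simp, h P hP⟩, by simp⟩

lemma Energy.mono {a : Tile → ℂ} {𝒬 𝒬' : Finset Tile} {e : ℝ} (h : G.Energy a 𝒬 e) (hs : 𝒬' ⊆ 𝒬) :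
    G.Energy a 𝒬' e := fun s i ξ hS T hT => h s i ξ hS T (hT.trans hs)

lemma Mass.mono {E : Finset X} {N : X → ℕ} {𝒬 𝒬' : Finset Tile} {μ : ℝ} (h : G.Mass E N 𝒬 μ)
    (hs : 𝒬' ⊆ 𝒬) : G.Mass E N 𝒬' μ := fun P hP => h P (hs hP)

lemma Tf_union {N : X → ℕ} {a : Tile → ℂ} {ψ : Tile → X → ℂ} (E : Finset X)
    (𝒬 : Finset Tile) (p : Tile → Prop) :
    ∑ x ∈ E, ‖G.Tf N a ψ 𝒬 x‖ ≤ ∑ x ∈ E, ‖G.Tf N a ψ (𝒬.filter p) x‖ +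
      ∑ x ∈ E, ‖G.Tf N a ψ (𝒬.filter (fun P => ¬ p P)) x‖ := by
  rw [← sum_add_distrib]
  apply sum_le_sum; intro x _
  unfold Tf
  rw [← sum_filter_add_sum_filter_not 𝒬 p]
  exact norm_add_le _ _

lemma Cov.bd {E : Finset X} {N : X → ℕ} {a : Tile → ℂ} {ψ : Tile → X → ℂ} {e μ : ℝ}
    (hψ : G.Packet ψ) (hL : G.LowPass ψ) (he : 0 ≤ e) (hμ : 0 ≤ μ) {𝒬 : Finset Tile} {B : ℝ}
    (hv : ∀ P ∈ 𝒬, G.Valid P) (hE : G.Energy a 𝒬 e) (hM : G.Mass E N 𝒬 μ) (h : G.Cov 𝒬 B) :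
    ∑ x ∈ E, ‖G.Tf N a ψ 𝒬 x‖ ≤ G.C0 ^ 7 * e * μ * B := by
  obtain ⟨l, h1, h2, h3⟩ := h
  have hC := G.C0_pos
  suffices H : ∑ x ∈ E, ‖G.Tf N a ψ 𝒬 x‖ ≤ G.C0 ^ 7 * e * μ * (l.map (fun t => G.β t.1)).sum from
    H.trans (mul_le_mul_of_nonneg_left h3 (by positivity))
  clear h3
  induction l generalizing 𝒬 with
  | nil =>
    have : 𝒬 = ∅ := by
      rw [eq_empty_iff_forall_notMem]; intro P hP
      obtain ⟨t, ht, _⟩ := h2 P hP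
      simp at ht
    subst this
    simp [Tf]
  | cons t l ih =>
    refine (Tf_union E 𝒬 (fun P => G.InTree t.1 t.2.1 t.2.2 P)).trans ?_
    have D : G.TD E N a ψ (𝒬.filter (fun P => G.InTree t.1 t.2.1 t.2.2 P)) t.1 t.2.1 t.2.2 e μ :=
      ⟨hψ, hL, fun P hP => hv P (mem_filter.1 hP).1, h1 t (by simp),
        fun P hP => (mem_filter.1 hP).2, he, hμ, hE.mono (filter_subset _ _),
        hM.mono (filter_subset _ _)⟩
    have b1 := D.tree
    have b2 := ih (𝒬 := 𝒬.filter (fun P => ¬ G.InTree t.1 t.2.1 t.2.2 P))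
      (fun P hP => hv P (mem_filter.1 hP).1) (hE.mono (filter_subset _ _))
      (hM.mono (filter_subset _ _)) (fun t ht => h1 t (List.mem_cons_of_mem _ ht)) (by
        intro P hP
        rw [mem_filter] at hP
        obtain ⟨t', ht', h⟩ := h2 P hP.1
        rcases List.mem_cons.1 ht' with h' | h'
        · subst h'; exact absurd h hP.2
        · exact ⟨t', h', h⟩)
    rw [List.map_cons, List.sum_cons, mul_add]
    exact add_le_add b1 b2

lemma ball_card (G : Geo X) (x : X) {t : ℝ} (ht : 1 ≤ t) :
    ((univ.filter (fun y => G.d x y ≤ 3 * t)).card : ℝ) ≤ 16 * G.C0 * t := by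
  have h := G.growth t ht x
  have h1 : ∑ y ∈ univ.filter (fun y => G.d x y ≤ 3 * t), (1:ℝ) ≤
      ∑ y, 16 * (1 + G.d x y / t)⁻¹ ^ 2 := by
    have h0 : ∀ y, 0 ≤ G.d x y / t := fun y => div_nonneg (G.d_nonneg _ _) (by linarith)
    calc _ ≤ ∑ y ∈ univ.filter (fun y => G.d x y ≤ 3 * t), 16 * (1 + G.d x y / t)⁻¹ ^ 2 := by
          apply sum_le_sum; intro y hy
          have hy := (mem_filter.1 hy).2
          have : (1/4:ℝ) ≤ (1 + G.d x y / t)⁻¹ := by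
            rw [one_div]
            apply inv_anti₀ (by have := h0 y; linarith)
            have : G.d x y / t ≤ 3 := by rw [div_le_iff₀ (by linarith)]; exact hy
            linarith
          nlinarith
      _ ≤ _ := sum_le_sum_of_subset_of_nonneg (subset_univ _) (fun y _ _ => by positivity)
  rw [← mul_sum, sum_const, nsmul_eq_mul, mul_one] at h1
  linarith

/-- greedy selection -/
lemma mass_select {E : Finset X} {N : X → ℕ} (l : ℕ) (n : ℕ) :
    ∀ H : Finset Tile, H.card ≤ n → (∀ Q ∈ H, (G.ms E N Q l).Nonempty) →
    ∃ Sg ⊆ H, (∀ Q ∈ Sg, ∀ Q' ∈ Sg, Q ≠ Q' → Disjoint (G.ms E N Q l) (G.ms E N Q' l)) ∧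
      ∀ P ∈ H, ∃ Q ∈ Sg, P.s ≤ Q.s ∧ (∀ ξ, G.fb Q.s ξ = Q.j → G.fb P.s ξ = P.j) ∧
        G.d (G.c P) (G.c Q) ≤ 2 * (2 ^ l * G.β Q.s) := by
  induction n with
  | zero =>
    intro H hH _
    have : H = ∅ := by simpa using hH
    subst this
    exact ⟨∅, by simp, by simp, by simp⟩
  | succ n ih =>
    intro H hH hne
    rcases H.eq_empty_or_nonempty with rfl | hHn
    · exact ⟨∅, by simp, by simp, by simp⟩
    obtain ⟨Q, hQ, hmax⟩ := exists_max_image H (fun P => P.s) hHn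
    have hQn : Q ∉ H.filter (fun P => Disjoint (G.ms E N P l) (G.ms E N Q l)) := by
      intro h
      have := (mem_filter.1 h).2
      rw [disjoint_self_iff_empty] at this
      exact (hne Q hQ).ne_empty this
    have hlt : (H.filter (fun P => Disjoint (G.ms E N P l) (G.ms E N Q l))).card < H.card :=
      card_lt_card ⟨filter_subset _ _, fun h => hQn (h hQ)⟩
    obtain ⟨Sg, h1, h2, h3⟩ := ih (H.filter (fun P => Disjoint (G.ms E N P l) (G.ms E N Q l)))
      (by omega) (fun P hP => hne P (mem_filter.1 hP).1)
    refine ⟨insert Q Sg, ?_, ?_, ?_⟩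
    · intro P hP
      rcases mem_insert.1 hP with rfl | h
      · exact hQ
      · exact (mem_filter.1 (h1 h)).1
    · intro P hP P' hP' hn
      rcases mem_insert.1 hP with rfl | h <;> rcases mem_insert.1 hP' with rfl | h'
      · exact absurd rfl hn
      · exact (mem_filter.1 (h1 h')).2.symm
      · exact (mem_filter.1 (h1 h)).2
      · exact h2 P h P' h' hn
    · intro P hP
      by_cases hd : Disjoint (G.ms E N P l) (G.ms E N Q l)
      · obtain ⟨Q', hQ', h⟩ := h3 P (mem_filter.2 ⟨hP, hd⟩)
        exact ⟨Q', mem_insert_of_mem hQ', h⟩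
      · rw [Finset.not_disjoint_iff] at hd
        obtain ⟨x, hx, hx'⟩ := hd
        simp only [ms, mem_filter] at hx hx'
        have hs := hmax P hP
        refine ⟨Q, mem_insert_self _ _, hs, ?_, ?_⟩
        · intro ξ hξ
          rw [← hx.2.1]
          exact G.fb_mono _ _ _ _ hs (hξ.trans hx'.2.1.symm)
        · have := G.d_tri (G.c P) x (G.c Q)
          rw [G.d_symm (G.c P) x] at this
          have hb : (2:ℝ) ^ l * G.β P.s ≤ 2 ^ l * G.β Q.s :=
            mul_le_mul_of_nonneg_left (G.β_mono hs) (by positivity)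
          linarith

/-- the tiles below a given one, thickened, are covered by few trees -/
lemma cov_fat {𝒬 : Finset Tile} {Q : Tile} (hQ : G.Valid Q) (l : ℕ)
    (h : ∀ P ∈ 𝒬, P.s ≤ Q.s ∧ (∀ ξ, G.fb Q.s ξ = Q.j → G.fb P.s ξ = P.j) ∧
      ∃ y, G.tb Q.s (G.c P) = G.tb Q.s y ∧ G.d y (G.c Q) ≤ 2 * (2 ^ l * G.β Q.s)) :
    G.Cov 𝒬 (16 * G.C0 * 2 ^ l * G.β Q.s) := by
  have hb := G.β_pos Q.s
  obtain ⟨ξ, hξ⟩ := hQ.2.2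
  set Z := univ.filter (fun y => G.d y (G.c Q) ≤ 2 * (2 ^ l * G.β Q.s)) with hZ
  set J := Z.image (G.tb Q.s) with hJ
  have hcov : G.Cov (J.biUnion (fun i => 𝒬.filter (fun P => G.tb Q.s (G.c P) = i)))
      (∑ i ∈ J, G.β Q.s) := by
    apply Cov.biUnion
    intro i _
    apply Cov.tree (i := i) (ξ := ξ) hQ.1
    intro P hP
    rw [mem_filter] at hP
    exact ⟨(h P hP.1).1, hP.2, (h P hP.1).2.1 ξ hξ⟩
  have hone : (1:ℝ) ≤ 2 ^ l := one_le_pow₀ (by norm_num)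
  have hcard : (J.card : ℝ) * G.β Q.s ≤ 16 * G.C0 * (2 ^ l * G.β Q.s) := by
    have h1 : (1:ℝ) ≤ 2 ^ l * G.β Q.s := by nlinarith [G.β_ge Q.s]
    refine le_trans ?_ (G.ball_card (G.c Q) h1)
    have h2 : ∑ i ∈ J, ((univ.filter (fun y => G.d (G.c Q) y ≤ 3 * (2 ^ l * G.β Q.s))).filter
        (fun y => G.tb Q.s y = i)).card ≤
        (univ.filter (fun y => G.d (G.c Q) y ≤ 3 * (2 ^ l * G.β Q.s))).card := by
      rw [← card_biUnion]
      · exact card_le_card (biUnion_subset.2 fun i _ => filter_subset _ _)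
      · intro i _ i' _ hne
        rw [Function.onFun, Finset.disjoint_left]
        intro y hy hy'
        exact hne ((mem_filter.1 hy).2.symm.trans (mem_filter.1 hy').2)
    have h3 : (J.card : ℝ) * G.β Q.s ≤ ∑ i ∈ J,
        (((univ.filter (fun y => G.d (G.c Q) y ≤ 3 * (2 ^ l * G.β Q.s))).filter
        (fun y => G.tb Q.s y = i)).card : ℝ) := by
      rw [← nsmul_eq_mul]
      apply card_nsmul_le_sum
      intro i hi
      obtain ⟨z, hz, rfl⟩ := mem_image.1 hi
      rw [show G.β Q.s = _ from (G.tb_card Q.s hQ.1.le z).symm]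
      refine Nat.cast_le.2 (card_le_card ?_)
      intro y hy
      rw [G.tb_card Q.s hQ.1.le z]
      simp only [mem_filter, mem_univ, true_and, hZ] at hy hz ⊢
      refine ⟨?_, hy⟩
      have := G.d_tri (G.c Q) z y
      have d1 := G.d_tb _ _ _ hy
      rw [G.d_symm (G.c Q) z, G.d_symm z y] at this
      nlinarith
    refine h3.trans ?_
    exact_mod_cast h2
  refine hcov.mono ?_ ?_
  · intro P hP
    obtain ⟨y, hy, hd⟩ := (h P hP).2.2
    rw [mem_biUnion]
    refine ⟨G.tb Q.s y, mem_image_of_mem _ ?_, mem_filter.2 ⟨hP, hy⟩⟩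
    rw [hZ, mem_filter]; exact ⟨mem_univ _, hd⟩
  · rw [sum_const, nsmul_eq_mul]; linarith

/-- **Mass lemma.** -/
lemma mass_lemma {E : Finset X} {N : X → ℕ} {μ : ℝ} (hμ : 0 < μ) (𝒬 : Finset Tile)
    (hv : ∀ P ∈ 𝒬, G.Valid P) :
    ∃ p : Tile → Prop, G.Mass E N (𝒬.filter (fun P => ¬ p P)) μ ∧
      G.Cov (𝒬.filter p) (G.C0 ^ 2 * E.card / μ) := by
  have hC := G.C0_pos
  set W : ℕ → Tile → Tile → Prop := fun l P P' => G.Valid P' ∧ G.Le P P' ∧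
    μ * 4 ^ l * G.β P'.s < ((G.ms E N P' l).card : ℝ) with hW
  refine ⟨fun P => ∃ l P', W l P P', ?_, ?_⟩
  · intro P hP P' hv' hle l
    by_contra hcon
    push Not at hcon
    exact (mem_filter.1 hP).2 ⟨l, P', hv', hle, hcon⟩
  · -- level l
    have lev : ∀ l, G.Cov (𝒬.filter (fun P => ∃ P', W l P P'))
        (16 * G.C0 * E.card / μ * (1 / 2) ^ l) := by
      intro l
      set H0 := 𝒬.filter (fun P => ∃ P', W l P P') with hH0
      have : ∀ P : Tile, ∃ P', P ∈ H0 → W l P P' := by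
        intro P
        by_cases h : P ∈ H0
        · obtain ⟨P', h'⟩ := (mem_filter.1 h).2; exact ⟨P', fun _ => h'⟩
        · exact ⟨P, fun h' => absurd h' h⟩
      choose r hr using this
      set H := H0.image r with hH
      have hHW : ∀ Q ∈ H, G.Valid Q ∧ μ * 4 ^ l * G.β Q.s < ((G.ms E N Q l).card : ℝ) := by
        intro Q hQ
        obtain ⟨P, hP, rfl⟩ := mem_image.1 hQ
        exact ⟨(hr P hP).1, (hr P hP).2.2⟩
      obtain ⟨Sg, s1, s2, s3⟩ := mass_select (G := G) (E := E) (N := N) l H.card H le_rfl (by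
        intro Q hQ
        have := (hHW Q hQ).2
        have hb := G.β_pos Q.s
        rw [← card_pos]
        have h0 : (0:ℝ) < (G.ms E N Q l).card := lt_trans (by positivity) this
        exact_mod_cast h0)
      have tot : ∑ Q ∈ Sg, G.β Q.s ≤ E.card / (μ * 4 ^ l) := by
        rw [le_div_iff₀ (by positivity), sum_mul]
        calc _ ≤ ∑ Q ∈ Sg, ((G.ms E N Q l).card : ℝ) := by
              apply sum_le_sum; intro Q hQ
              have := (hHW Q (s1 hQ)).2
              linarith
          _ = ((Sg.biUnion (fun Q => G.ms E N Q l)).card : ℝ) := by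
              rw [card_biUnion s2]; push_cast; rfl
          _ ≤ _ := by
              norm_cast
              apply card_le_card
              exact biUnion_subset.2 fun Q _ => filter_subset _ _
      have hcov := Cov.biUnion (G := G) Sg (fun Q => H0.filter (fun P => P.s ≤ Q.s ∧
        (∀ ξ, G.fb Q.s ξ = Q.j → G.fb P.s ξ = P.j) ∧
        ∃ y, G.tb Q.s (G.c P) = G.tb Q.s y ∧ G.d y (G.c Q) ≤ 2 * (2 ^ l * G.β Q.s)))
        (fun Q => 16 * G.C0 * 2 ^ l * G.β Q.s)
        (fun Q hQ => cov_fat (hHW Q (s1 hQ)).1 l (fun P hP => (mem_filter.1 hP).2))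
      refine hcov.mono ?_ ?_
      · intro P hP
        obtain ⟨Q, hQ, a1, a2, a3⟩ := s3 (r P) (mem_image_of_mem _ hP)
        rw [mem_biUnion]
        have hrP := hr P hP
        refine ⟨Q, hQ, mem_filter.2 ⟨hP, hrP.2.1.1.trans a1, fun ξ hξ => ?_, G.c (r P), ?_, a3⟩⟩
        · exact hrP.2.1.2.2 ξ (a2 ξ hξ)
        · exact G.tb_mono _ _ _ _ a1 (hrP.2.1.2.1.trans hrP.1.2.1.symm)
      · rw [← mul_sum]
        calc _ ≤ 16 * G.C0 * 2 ^ l * (E.card / (μ * 4 ^ l)) :=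
              mul_le_mul_of_nonneg_left tot (by positivity)
          _ = _ := by
              have : (4:ℝ) ^ l = 2 ^ l * 2 ^ l := by rw [← mul_pow]; norm_num
              rw [this, one_div, inv_pow]; field_simp
    have : ∀ P : Tile, ∃ l, (∃ l P', W l P P') → ∃ P', W l P P' := by
      intro P
      by_cases h : ∃ l P', W l P P'
      · obtain ⟨l, h'⟩ := h; exact ⟨l, fun _ => h'⟩
      · exact ⟨0, fun h' => absurd h' h⟩
    choose lv hlv using this
    set m := 𝒬.sup lv + 1 with hm
    have hcov := Cov.biUnion (G := G) (range m) (fun l => 𝒬.filter (fun P => ∃ P', W l P P'))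
      _ (fun l _ => lev l)
    refine hcov.mono ?_ ?_
    · intro P hP
      rw [mem_filter] at hP
      rw [mem_biUnion]
      refine ⟨lv P, ?_, mem_filter.2 ⟨hP.1, hlv P hP.2⟩⟩
      rw [mem_range, hm]
      exact Nat.lt_succ_of_le (le_sup (f := lv) hP.1)
    · rw [← mul_sum]
      have h2 : ∑ l ∈ range m, (1 / 2 : ℝ) ^ l ≤ 2 := by simpa using sum_geometric_two_le m
      calc _ ≤ 16 * G.C0 * E.card / μ * 2 := mul_le_mul_of_nonneg_left h2 (by positivity)
        _ = 32 * (G.C0 * E.card / μ) := by ring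
        _ ≤ G.C0 * (G.C0 * E.card / μ) := by
            apply mul_le_mul_of_nonneg_right _ (by positivity)
            have := G.C0_ge; linarith
        _ = _ := by ring

end Geo
end
end CT

end

section
namespace CT
open Finset
open scoped Classical

/-- a tree with its top -/
structure Top where
  s : ℕ
  i : ℕ
  ξ : ℕ
  T : Finset Tile

section
variable {X : Type} [Fintype X]

namespace Geo
variable (G : Geo X)

/-- a 2-tree with large energy -/
structure Bad (a : Tile → ℂ) (e : ℝ) (𝒬 : Finset Tile) (t : Top) : Prop where
  hs : t.s < G.S
  sub : t.T ⊆ 𝒬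
  tr : ∀ P ∈ t.T, G.InTree t.s t.i t.ξ P
  up : ∀ P ∈ t.T, G.up P.s t.ξ
  big : e ^ 2 * G.β t.s < ∑ P ∈ t.T, ‖a P‖ ^ 2

def Rel (P P' : Tile) : Prop :=
  P'.s < P.s ∧ ∃ ξ, G.fb P.s ξ = P.j ∧ G.fb P'.s ξ = P'.j ∧ ¬ G.up P'.s ξ

/-- strong disjointness -/
structure Sep (F : Finset Top) : Prop where
  dis : ∀ t ∈ F, ∀ t' ∈ F, t ≠ t' → Disjoint t.T t'.T
  sep : ∀ t ∈ F, ∀ t' ∈ F, ∀ P ∈ t.T, ∀ P' ∈ t'.T, G.Rel P P' → G.tb t.s (G.c P') ≠ t.i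

variable {G}

lemma rel_lt {P P' : Tile} {ξ ξ' : ℕ} (h : G.Rel P P') (h1 : G.fb P.s ξ = P.j)
    (h2 : G.fb P'.s ξ' = P'.j) (h3 : G.up P'.s ξ') : ξ < ξ' ∧ G.fb P'.s ξ = P'.j := by
  obtain ⟨hs, η, e1, e2, e3⟩ := h
  have f1 : G.fb P.s ξ = G.fb P.s η := h1.trans e1.symm
  have f2 : G.fb P'.s ξ = P'.j := (G.fb_mono _ _ _ _ hs.le f1).trans e2
  refine ⟨G.up_lt P'.s ξ ξ' (f2.trans h2.symm) ?_ h3, f2⟩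
  rwa [G.up_congr _ _ _ _ hs f1]

lemma select {a : Tile → ℂ} {e : ℝ} (n : ℕ) : ∀ 𝒬 : Finset Tile, 𝒬.card ≤ n →
    ∃ F : Finset Top, (∀ t ∈ F, G.Bad a e 𝒬 t) ∧ G.Sep F ∧
      G.Energy a (𝒬.filter (fun P => ¬ ∃ t ∈ F, G.InTree t.s t.i t.ξ P)) e := by
  induction n with
  | zero =>
    intro 𝒬 h
    have : 𝒬 = ∅ := by simpa using h
    subst this
    refine ⟨∅, by simp, ⟨by simp, by simp⟩, ?_⟩
    intro s i ξ hs T hT _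
    have : T = ∅ := by simpa using hT
    subst this
    have := G.β_pos s
    simp; positivity
  | succ n ih =>
    intro 𝒬 h
    by_cases hex : ∃ ξ, ∃ t, G.Bad a e 𝒬 t ∧ t.ξ = ξ
    · obtain ⟨t, ht, htξ⟩ := Nat.find_spec hex
      have hmin : ∀ t', G.Bad a e 𝒬 t' → t.ξ ≤ t'.ξ := fun t' h' => by
        rw [htξ]; exact Nat.find_min' hex ⟨t', h', rfl⟩
      set 𝒬' := 𝒬.filter (fun P => ¬ G.InTree t.s t.i t.ξ P) with hQ'
      have hne : t.T.Nonempty := by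
        by_contra h0
        rw [not_nonempty_iff_eq_empty] at h0
        have := ht.big
        rw [h0, sum_empty] at this
        have := G.β_pos t.s
        have : 0 ≤ e ^ 2 * G.β t.s := by positivity
        linarith
      have hcard : 𝒬'.card < 𝒬.card := by
        apply card_lt_card
        refine ⟨filter_subset _ _, fun h => ?_⟩
        obtain ⟨P, hP⟩ := hne
        exact (mem_filter.1 (h (ht.sub hP))).2 (ht.tr P hP)
      obtain ⟨F, f1, f2, f3⟩ := ih 𝒬' (by omega)
      have f1' : ∀ t' ∈ F, G.Bad a e 𝒬 t' := fun t' h' =>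
        let b := f1 t' h'
        ⟨b.hs, b.sub.trans (filter_subset _ _), b.tr, b.up, b.big⟩
      have nin : ∀ t' ∈ F, ∀ P ∈ t'.T, ¬ G.InTree t.s t.i t.ξ P := fun t' h' P hP =>
        (mem_filter.1 ((f1 t' h').sub hP)).2
      refine ⟨insert t F, ?_, ⟨?_, ?_⟩, ?_⟩
      · intro t' h'
        rcases mem_insert.1 h' with rfl | h'
        · exact ht
        · exact f1' t' h'
      · intro u hu v hv huv
        rcases mem_insert.1 hu with rfl | hu' <;> rcases mem_insert.1 hv with rfl | hv'
        · exact absurd rfl huv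
        · rw [Finset.disjoint_left]
          intro P hP hP'
          exact nin v hv' P hP' (ht.tr P hP)
        · rw [Finset.disjoint_left]
          intro P hP hP'
          exact nin u hu' P hP (ht.tr P hP')
        · exact f2.dis u hu' v hv' huv
      · intro u hu v hv P hP P' hP' hR
        have key : ∀ w w' : Top, G.Bad a e 𝒬 w → G.Bad a e 𝒬 w' → P ∈ w.T → P' ∈ w'.T →
            w.ξ < w'.ξ ∧ G.fb P'.s w.ξ = P'.j := fun w w' hw hw' h1 h2 =>
          rel_lt hR (hw.tr P h1).2.2 (hw'.tr P' h2).2.2 (hw'.up P' h2)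
        rcases mem_insert.1 hu with rfl | hu' <;> rcases mem_insert.1 hv with rfl | hv'
        · exact absurd (key _ _ ht ht hP hP').1 (lt_irrefl _)
        · intro hc
          exact nin v hv' P' hP' ⟨(hR.1.le).trans (ht.tr P hP).1, hc, (key _ _ ht (f1' v hv') hP hP').2⟩
        · have h1 := (key _ _ (f1' u hu') ht hP hP').1
          have h2 := hmin u (f1' u hu')
          omega
        · exact f2.sep u hu' v hv' P hP P' hP' hR
      · refine f3.mono ?_
        intro P hP
        rw [mem_filter] at hP
        rw [mem_filter, hQ', mem_filter]
        refine ⟨⟨hP.1, fun h => hP.2 ⟨t, mem_insert_self _ _, h⟩⟩, ?_⟩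
        rintro ⟨t', h', h''⟩
        exact hP.2 ⟨t', mem_insert_of_mem h', h''⟩
    · refine ⟨∅, by simp, ⟨by simp, by simp⟩, ?_⟩
      intro s i ξ hs T hT hT2
      by_contra hcon
      push Not at hcon
      exact hex ⟨ξ, ⟨s, i, ξ, T⟩, ⟨hs, hT.trans (filter_subset _ _), fun P hP => (hT2 P hP).1,
        fun P hP => (hT2 P hP).2, hcon⟩, rfl⟩

/-- tiles related to a given one have disjoint intervals -/
lemma rel_disj {a : Tile → ℂ} {e : ℝ} {𝒬 : Finset Tile} {F : Finset Top}
    (hv : ∀ P ∈ 𝒬, G.Valid P)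
    (hF : ∀ t ∈ F, G.Bad a e 𝒬 t) (hS : G.Sep F) (P : Tile) :
    G.Disj ((F.biUnion Top.T).filter (fun P' => G.Rel P P')) := by
  have key : ∀ Q ∈ (F.biUnion Top.T).filter (fun P' => G.Rel P P'),
      ∀ Q' ∈ (F.biUnion Top.T).filter (fun P' => G.Rel P P'), Q'.s < Q.s →
      Disjoint (G.I Q) (G.I Q') := by
    intro Q hQ Q' hQ' hlt
    rw [mem_filter, mem_biUnion] at hQ hQ'
    obtain ⟨⟨t, ht, hQt⟩, hR1, ξ, r1, r2, r3⟩ := hQ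
    obtain ⟨⟨t', ht', hQt'⟩, hR1', ξ', r1', r2', r3'⟩ := hQ'
    have hf : G.fb Q.s ξ' = Q.j :=
      (G.fb_mono _ _ _ _ hR1.le (r1'.trans r1.symm)).trans r2
    have := hS.sep t ht t' ht' Q hQt Q' hQt' ⟨hlt, ξ', hf, r2', r3'⟩
    rw [Finset.disjoint_left]
    intro x hx hx'
    have vQ := hv Q ((hF t ht).sub hQt)
    have vQ' := hv Q' ((hF t' ht').sub hQt')
    have hle := ((hF t ht).tr Q hQt).1
    have e1 := G.I_subset vQ hle hx
    have e2 := G.I_subset vQ' (hlt.le.trans hle) hx'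
    apply this
    rw [← e2, e1]
    exact ((hF t ht).tr Q hQt).2.1
  intro Q hQ Q' hQ' hne
  rcases lt_trichotomy Q.s Q'.s with h | h | h
  · exact (key Q' hQ' Q hQ h).symm
  · rw [mem_filter] at hQ hQ'
    obtain ⟨_, hR1, ξ, r1, r2, r3⟩ := hQ
    obtain ⟨_, hR1', ξ', r1', r2', r3'⟩ := hQ'
    apply G.disj_of_ne h
    intro hi
    apply hne
    refine Tile_ext h hi ?_
    rw [← r2, ← r2', ← h]
    exact G.fb_mono _ _ _ _ hR1.le (r1.trans r1'.symm)
  · exact key Q hQ Q' hQ' h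

/-- inner sum -/
lemma off_inner {a : Tile → ℂ} {e : ℝ} {𝒬 : Finset Tile} {F : Finset Top}
    (hv : ∀ P ∈ 𝒬, G.Valid P)
    (hF : ∀ t ∈ F, G.Bad a e 𝒬 t) (hS : G.Sep F) {t : Top} (ht : t ∈ F) {P : Tile} (hP : P ∈ t.T) :
    ∑ P' ∈ (F.biUnion Top.T).filter (fun P' => G.Rel P P'),
      G.β P'.s * G.wt P.s (G.c P) (G.c P') ^ 4 ≤
    16 * ∑ y ∈ univ.filter (fun y => G.tb t.s y ≠ t.i), G.wt P.s (G.c P) y ^ 4 := by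
  calc _ ≤ ∑ P' ∈ (F.biUnion Top.T).filter (fun P' => G.Rel P P'),
        2 ^ 4 * ∑ y ∈ G.I P', G.wt P.s (G.c P) y ^ 4 := by
        apply sum_le_sum
        intro P' hP'
        rw [mem_filter, mem_biUnion] at hP'
        obtain ⟨⟨t', ht', hQt'⟩, hR⟩ := hP'
        exact G.wt_avg (hv P' ((hF t' ht').sub hQt')) hR.1.le _ _
    _ ≤ _ := by
        rw [← mul_sum]
        norm_num
        apply G.sum_disj (rel_disj hv hF hS P)
        · intro P' hP' y hy
          rw [mem_filter, mem_biUnion] at hP'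
          obtain ⟨⟨t', ht', hQt'⟩, hR⟩ := hP'
          have := hS.sep t ht t' ht' P hP P' hQt' hR
          rw [mem_filter]
          refine ⟨mem_univ _, ?_⟩
          rw [G.I_subset (hv P' ((hF t' ht').sub hQt')) (hR.1.le.trans ((hF t ht).tr P hP).1) hy]
          exact this
        · intro y; have := G.wt_pos P.s (G.c P) y; positivity

/-- sum over one tree -/
lemma off_tree {a : Tile → ℂ} {e : ℝ} {𝒬 : Finset Tile} (hv : ∀ P ∈ 𝒬, G.Valid P) {t : Top}
    (hB : G.Bad a e 𝒬 t) :
    ∑ P ∈ t.T, ∑ y ∈ univ.filter (fun y => G.tb t.s y ≠ t.i), G.wt P.s (G.c P) y ^ 4 ≤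
      32 * G.C0 * G.β t.s := by
  have hC := G.C0_pos
  rcases t.T.eq_empty_or_nonempty with h0 | ⟨P0, hP0⟩
  · rw [h0, sum_empty]; have := G.β_pos t.s; positivity
  have hi : G.tb t.s (G.c P0) = t.i := (hB.tr P0 hP0).2.1
  have scale : ∀ s ∈ range (t.s + 1), ∑ P ∈ t.T.filter (fun P => P.s = s),
      ∑ y ∈ univ.filter (fun y => G.tb t.s y ≠ t.i), G.wt P.s (G.c P) y ^ 4 ≤
      16 * G.C0 * G.β s := by
    intro s hs
    have hb := G.β_pos s
    have hd : G.Disj (t.T.filter (fun P => P.s = s)) := by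
      intro Q hQ Q' hQ' hne
      rw [mem_filter] at hQ hQ'
      apply G.disj_of_ne (hQ.2.trans hQ'.2.symm)
      intro hi
      refine hne (Tile_ext (hQ.2.trans hQ'.2.symm) hi ?_)
      rw [← (hB.tr Q hQ.1).2.2, ← (hB.tr Q' hQ'.1).2.2, hQ.2, hQ'.2]
    have h1 : ∑ P ∈ t.T.filter (fun P => P.s = s), G.β s *
        ∑ y ∈ univ.filter (fun y => G.tb t.s y ≠ t.i), G.wt P.s (G.c P) y ^ 4 ≤
        16 * ∑ x ∈ univ.filter (fun x => G.tb t.s x = t.i),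
          ∑ y ∈ univ.filter (fun y => G.tb t.s y ≠ t.i), G.wt s y x ^ 4 := by
      calc _ ≤ ∑ P ∈ t.T.filter (fun P => P.s = s), 16 * ∑ x ∈ G.I P,
            ∑ y ∈ univ.filter (fun y => G.tb t.s y ≠ t.i), G.wt s y x ^ 4 := by
            apply sum_le_sum
            intro P hP
            rw [mem_filter] at hP
            have vP := hv P (hB.sub hP.1)
            rw [sum_comm, mul_sum, mul_sum]
            apply sum_le_sum
            intro y _
            have := G.wt_avg vP hP.2.le y 4
            rw [hP.2] at this
            rw [hP.2, G.wt_symm s (G.c P) y]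
            norm_num at this ⊢
            exact this
        _ ≤ _ := by
            rw [← mul_sum]
            apply mul_le_mul_of_nonneg_left _ (by norm_num)
            apply G.sum_disj hd
            · intro P hP x hx
              rw [mem_filter] at hP
              rw [mem_filter]
              refine ⟨mem_univ _, ?_⟩
              rw [G.I_subset (hv P (hB.sub hP.1)) (hB.tr P hP.1).1 hx]
              exact (hB.tr P hP.1).2.1
            · intro x; positivity
    have h2 := G.bdry t.s hB.hs.le (G.β s) (G.β_ge s) (G.c P0)
    rw [hi] at h2
    change ∑ x ∈ univ.filter (fun x => G.tb t.s x = t.i),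
          ∑ y ∈ univ.filter (fun y => G.tb t.s y ≠ t.i), G.wt s y x ^ 4 ≤ _ at h2
    rw [← mul_sum] at h1
    have h3 : G.β s * ∑ P ∈ t.T.filter (fun P => P.s = s),
        ∑ y ∈ univ.filter (fun y => G.tb t.s y ≠ t.i), G.wt P.s (G.c P) y ^ 4 ≤
        G.β s * (16 * G.C0 * G.β s) := by nlinarith
    exact le_of_mul_le_mul_left h3 hb
  have hsplit := sum_fiberwise_of_maps_to (s := t.T) (t := range (t.s + 1)) (g := Tile.s)
    (fun P hP => mem_range.2 (Nat.lt_succ_of_le (hB.tr P hP).1))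
    (fun P => ∑ y ∈ univ.filter (fun y => G.tb t.s y ≠ t.i), G.wt P.s (G.c P) y ^ 4)
  rw [← hsplit]
  refine (sum_le_sum scale).trans ?_
  rw [← mul_sum, sum_range_succ]
  have := G.β_sum_lt t.s
  nlinarith

/-- **Energy lemma** (Bessel part). -/
lemma bessel {φ : Tile → X → ℂ} (hφ : G.Packet φ) (f : X → ℂ) {a : Tile → ℂ}
    (ha : ∀ P, a P = ∑ y, f y * (starRingEnd ℂ) (φ P y)) {e e' : ℝ} (he : 0 ≤ e) (hee : e = 2 * e')
    {𝒬 : Finset Tile} {F : Finset Top} (hv : ∀ P ∈ 𝒬, G.Valid P) (hE : G.Energy a 𝒬 e)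
    (hF : ∀ t ∈ F, G.Bad a e' 𝒬 t) (hS : G.Sep F) :
    e' ^ 2 * ∑ t ∈ F, G.β t.s ≤ G.C0 ^ 5 * ∑ x, ‖f x‖ ^ 2 := by
  have hC := G.C0_pos
  set 𝒯 := F.biUnion Top.T with h𝒯
  have hsub : 𝒯 ⊆ 𝒬 := biUnion_subset.2 fun t ht => (hF t ht).sub
  set A := ∑ P ∈ 𝒯, ‖a P‖ ^ 2 with hA
  have hA0 : 0 ≤ A := by positivity
  have hsum : ∀ g : Tile → ℝ, ∑ P ∈ 𝒯, g P = ∑ t ∈ F, ∑ P ∈ t.T, g P := fun g =>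
    sum_biUnion (fun t ht t' ht' hne => hS.dis t ht t' ht' hne)
  have hBA : e' ^ 2 * ∑ t ∈ F, G.β t.s ≤ A := by
    rw [hA, hsum, mul_sum]
    exact sum_le_sum fun t ht => (hF t ht).big.le
  refine hBA.trans ?_
  -- Cauchy–Schwarz
  set Q := ∑ x, ‖∑ P ∈ 𝒯, a P * φ P x‖ ^ 2 with hQ
  have hCS : A ^ 2 ≤ (∑ x, ‖f x‖ ^ 2) * Q := by
    have h1 : (A : ℂ) = ∑ x, f x * (starRingEnd ℂ) (∑ P ∈ 𝒯, a P * φ P x) := by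
      rw [hA]; push_cast
      have : ∀ P ∈ 𝒯, ((‖a P‖ : ℂ)) ^ 2 =
          ∑ x, f x * ((starRingEnd ℂ) (a P) * (starRingEnd ℂ) (φ P x)) := by
        intro P _
        rw [← Complex.conj_mul']
        nth_rw 2 [ha P]
        rw [mul_sum]
        apply sum_congr rfl; intro x _; ring
      rw [sum_congr rfl this, sum_comm]
      apply sum_congr rfl; intro x _
      rw [map_sum, mul_sum]
      apply sum_congr rfl; intro P _
      rw [map_mul]
    have h2 : A ≤ ∑ x, ‖f x‖ * ‖∑ P ∈ 𝒯, a P * φ P x‖ := by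
      have : A = ‖(A : ℂ)‖ := (Complex.norm_of_nonneg hA0).symm
      rw [this, h1]
      refine (norm_sum_le _ _).trans (sum_le_sum fun x _ => ?_)
      rw [norm_mul, RCLike.norm_conj]
    calc A ^ 2 ≤ _ := pow_le_pow_left₀ hA0 h2 2
      _ ≤ _ := sum_mul_sq_le_sq_mul_sq _ _ _
  -- off diagonal part
  have hoff : ∑ P ∈ 𝒯, ∑ P' ∈ 𝒯, (if P'.s < P.s then ‖a P‖ * ‖a P'‖ * ‖ip φ P P'‖ else 0) ≤
      2048 * G.C0 ^ 4 * A := by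
    have inner : ∀ t ∈ F, ∀ P ∈ t.T, ∑ P' ∈ 𝒯,
        (if P'.s < P.s then ‖a P‖ * ‖a P'‖ * ‖ip φ P P'‖ else 0) ≤
        e ^ 2 * G.C0 ^ 3 * (16 * ∑ y ∈ univ.filter (fun y => G.tb t.s y ≠ t.i),
          G.wt P.s (G.c P) y ^ 4) := by
      intro t ht P hP
      have vP := hv P ((hF t ht).sub hP)
      refine le_trans ?_ (mul_le_mul_of_nonneg_left (off_inner hv hF hS ht hP) (by positivity))
      rw [sum_filter, mul_sum]
      apply sum_le_sum
      intro P' hP'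
      have vP' := hv P' (hsub hP')
      have w := G.wt_pos P.s (G.c P) (G.c P')
      have hb' := G.β_pos P'.s
      by_cases hs : P'.s < P.s
      · rw [if_pos hs]
        by_cases hR : G.Rel P P'
        · rw [if_pos hR]
          have a1 := hE.single G he ((hF t ht).sub hP) vP
          have a2 := hE.single G he (hsub hP') vP'
          have a3 := G.ip_bd hφ vP vP' hs.le
          have sb : 0 < √(G.β P.s) := Real.sqrt_pos.2 (G.β_pos _)
          have sb' : 0 < √(G.β P'.s) := Real.sqrt_pos.2 (G.β_pos _)
          calc _ ≤ (e * √(G.β P.s)) * (e * √(G.β P'.s)) * (G.C0 ^ 3 *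
                (√(G.β P'.s) / √(G.β P.s)) * G.wt P.s (G.c P) (G.c P') ^ 4) := by
                gcongr
            _ = e ^ 2 * G.C0 ^ 3 * ((√(G.β P'.s) * √(G.β P'.s)) *
                  G.wt P.s (G.c P) (G.c P') ^ 4) := by field_simp
            _ = _ := by rw [Real.mul_self_sqrt hb'.le]
        · rw [if_neg hR]
          have : ip φ P P' = 0 := by
            have : ‖ip φ P P'‖ = 0 := by
              rw [ip_symm, norm_eq_zero]
              by_contra h0
              obtain ⟨ξ, h1, h2, h3⟩ := hφ.orth P' P vP' vP hs.le h0
              exact hR ⟨hs, ξ, h2, h1, h3⟩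
            simpa using this
          simp [this]
      · rw [if_neg hs]
        split_ifs <;> positivity
    rw [hsum]
    calc _ ≤ ∑ t ∈ F, e ^ 2 * G.C0 ^ 3 * 16 * (32 * G.C0 * G.β t.s) := by
          apply sum_le_sum; intro t ht
          refine (sum_le_sum (inner t ht)).trans ?_
          rw [← mul_sum, ← mul_sum, ← mul_assoc]
          exact mul_le_mul_of_nonneg_left (off_tree hv (hF t ht)) (by positivity)
      _ = 2048 * G.C0 ^ 4 * (e' ^ 2 * ∑ t ∈ F, G.β t.s) := by
          rw [mul_sum, mul_sum, hee]
          apply sum_congr rfl; intro t _; ring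
      _ ≤ _ := mul_le_mul_of_nonneg_left hBA (by positivity)
  have hdiag : ∑ P ∈ 𝒯, ∑ P' ∈ 𝒯, (if P'.s = P.s then ‖a P‖ * ‖a P'‖ * ‖ip φ P P'‖ else 0) ≤
      4 * G.C0 ^ 4 * A := by
    refine le_trans ?_ (schur 𝒯 (fun P => ‖a P‖) G.dk (4 * G.C0 ^ 4) G.dk_nonneg G.dk_symm
      (fun P _ => G.dk_sum (fun P hP => hv P (hsub hP)) P))
    apply sum_le_sum; intro P hP; apply sum_le_sum; intro P' hP'
    have := G.dk_nonneg P P'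
    split_ifs with h
    · exact mul_le_mul_of_nonneg_left (G.ip_dk hφ (hv P (hsub hP)) (hv P' (hsub hP')) h.symm)
        (by positivity)
    · positivity
  have hoff' : ∑ P ∈ 𝒯, ∑ P' ∈ 𝒯, (if P.s < P'.s then ‖a P‖ * ‖a P'‖ * ‖ip φ P P'‖ else 0) ≤
      2048 * G.C0 ^ 4 * A := by
    rw [sum_comm]
    refine le_trans (le_of_eq ?_) hoff
    apply sum_congr rfl; intro P _; apply sum_congr rfl; intro P' _
    rw [ip_symm, mul_comm ‖a P'‖]
  have hQle : Q ≤ G.C0 ^ 5 * A := by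
    have h1 := sq_expand φ a 𝒯
    have h2 : ∑ P ∈ 𝒯, ∑ P' ∈ 𝒯, ‖a P‖ * ‖a P'‖ * ‖ip φ P P'‖ =
      ∑ P ∈ 𝒯, ∑ P' ∈ 𝒯, (if P'.s < P.s then ‖a P‖ * ‖a P'‖ * ‖ip φ P P'‖ else 0) +
      ∑ P ∈ 𝒯, ∑ P' ∈ 𝒯, (if P'.s = P.s then ‖a P‖ * ‖a P'‖ * ‖ip φ P P'‖ else 0) +
      ∑ P ∈ 𝒯, ∑ P' ∈ 𝒯, (if P.s < P'.s then ‖a P‖ * ‖a P'‖ * ‖ip φ P P'‖ else 0) := by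
      simp only [← sum_add_distrib]
      apply sum_congr rfl; intro P _; apply sum_congr rfl; intro P' _
      rcases lt_trichotomy P.s P'.s with h | h | h
      · simp [h, h.not_gt, h.ne']
      · simp [h]
      · simp [h, h.not_gt, h.ne]
    have h3 : Q ≤ 4100 * (G.C0 ^ 4 * A) := by
      rw [hQ]; linarith
    refine h3.trans ?_
    have : G.C0 ^ 5 * A = G.C0 * (G.C0 ^ 4 * A) := by ring
    rw [this]
    apply mul_le_mul_of_nonneg_right _ (by positivity)
    have := G.C0_ge; norm_num at this; linarith
  rcases hA0.eq_or_lt with h0 | h0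
  · rw [← h0]; positivity
  · have hf0 : 0 ≤ ∑ x, ‖f x‖ ^ 2 := by positivity
    have : A * A ≤ A * (G.C0 ^ 5 * ∑ x, ‖f x‖ ^ 2) := by
      calc A * A = A ^ 2 := by ring
        _ ≤ (∑ x, ‖f x‖ ^ 2) * Q := hCS
        _ ≤ (∑ x, ‖f x‖ ^ 2) * (G.C0 ^ 5 * A) := mul_le_mul_of_nonneg_left hQle hf0
        _ = _ := by ring
    exact le_of_mul_le_mul_left this h0

/-- **Energy lemma.** -/
lemma energy_lemma {φ : Tile → X → ℂ} (hφ : G.Packet φ) (f : X → ℂ) {a : Tile → ℂ}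
    (ha : ∀ P, a P = ∑ y, f y * (starRingEnd ℂ) (φ P y)) {e : ℝ} (he : 0 < e)
    {𝒬 : Finset Tile} (hv : ∀ P ∈ 𝒬, G.Valid P) (hE : G.Energy a 𝒬 (2 * e)) :
    ∃ p : Tile → Prop, G.Energy a (𝒬.filter (fun P => ¬ p P)) e ∧
      G.Cov (𝒬.filter p) (G.C0 ^ 5 * (∑ x, ‖f x‖ ^ 2) / e ^ 2) := by
  obtain ⟨F, h1, h2, h3⟩ := select (G := G) (a := a) (e := e) 𝒬.card 𝒬 le_rfl
  refine ⟨fun P => ∃ t ∈ F, G.InTree t.s t.i t.ξ P, h3.mono ?_, ?_⟩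
  · intro P hP; simp only [mem_filter] at hP ⊢; exact hP
  have hb := bessel hφ f ha (by positivity) rfl hv hE h1 h2
  have hcov := Cov.biUnion (G := G) F (fun t => 𝒬.filter (fun P => G.InTree t.s t.i t.ξ P))
    (fun t => G.β t.s) (fun t ht => Cov.tree (h1 t ht).hs (fun P hP => (mem_filter.1 hP).2))
  refine hcov.mono ?_ ?_
  · intro P hP
    simp only [mem_filter] at hP
    obtain ⟨hP, t, ht, h⟩ := hP
    exact mem_biUnion.2 ⟨t, ht, mem_filter.2 ⟨hP, h⟩⟩
  · rw [le_div_iff₀ (by positivity)]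
    linarith

end Geo
end
end CT

end

section
namespace CT
open Finset
open scoped Classical

section
variable {X : Type} [Fintype X]

namespace Geo
variable {G : Geo X}

lemma mass_triv (E : Finset X) (N : X → ℕ) (𝒬 : Finset Tile) : G.Mass E N 𝒬 (16 * G.C0) := by
  intro P _ P' _ _ l
  have hb := G.β_ge P'.s
  have hC := G.C0_pos
  have h1 : (1:ℝ) ≤ 2 ^ l := one_le_pow₀ (by norm_num)
  have h2 : (2:ℝ) ^ l ≤ 4 ^ l := pow_le_pow_left₀ (by norm_num) (by norm_num) l
  have h3 : (1:ℝ) ≤ 2 ^ l * G.β P'.s := by nlinarith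
  calc ((G.ms E N P' l).card : ℝ) ≤
      ((univ.filter (fun y => G.d (G.c P') y ≤ 3 * (2 ^ l * G.β P'.s))).card : ℝ) := by
        refine Nat.cast_le.2 (card_le_card ?_)
        intro x hx
        simp only [ms, mem_filter, mem_univ, true_and] at hx ⊢
        rw [G.d_symm]; linarith [hx.2.2]
    _ ≤ 16 * G.C0 * (2 ^ l * G.β P'.s) := G.ball_card _ h3
    _ = 16 * G.C0 * 2 ^ l * G.β P'.s := by ring
    _ ≤ _ := by gcongr

lemma Cov.triv (𝒬 : Finset Tile) (hv : ∀ P ∈ 𝒬, G.Valid P) :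
    G.Cov 𝒬 (∑ P ∈ 𝒬, G.β P.s) := by
  have := Cov.biUnion (G := G) 𝒬 (fun P => {P}) (fun P => G.β P.s) (by
    intro P hP
    obtain ⟨ξ, hξ⟩ := (hv P hP).2.2
    refine Cov.tree (i := P.i) (ξ := ξ) (hv P hP).1 ?_
    intro Q hQ
    rw [mem_singleton] at hQ; subst hQ
    exact ⟨le_rfl, (hv Q hP).2.1, hξ⟩)
  exact this.mono (fun P hP => mem_biUnion.2 ⟨P, hP, mem_singleton_self _⟩) le_rfl

/-- contribution of one step -/
lemma step_bd {E : Finset X} {N : X → ℕ} {a : Tile → ℂ} {ψ : Tile → X → ℂ} {θ x : ℝ}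
    (hψ : G.Packet ψ) (hL : G.LowPass ψ) (hθ : 0 < θ) (hx : 0 < x) {𝒬 : Finset Tile}
    (hv : ∀ P ∈ 𝒬, G.Valid P) (hE : G.Energy a 𝒬 (2 * (x * θ))) (hM : G.Mass E N 𝒬 (4 * x ^ 2))
    (h : G.Cov 𝒬 (G.C0 ^ 5 * E.card / x ^ 2)) :
    ∑ y ∈ E, ‖G.Tf N a ψ 𝒬 y‖ ≤
      192 * G.C0 ^ 13 * θ * E.card * (2 * x / (1 + 2 * x) - x / (1 + x)) := by
  have hC := G.C0_pos
  have hC1 := G.C0_one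
  have hid : 2 * x / (1 + 2 * x) - x / (1 + x) = x / ((1 + 2 * x) * (1 + x)) := by
    field_simp; ring
  rw [hid]
  rcases le_total x 1 with h1 | h1
  · refine (Cov.bd hψ hL (by positivity) (by positivity) hv hE hM h).trans ?_
    have e1 : G.C0 ^ 7 * (2 * (x * θ)) * (4 * x ^ 2) * (G.C0 ^ 5 * E.card / x ^ 2) =
        (8 * G.C0 ^ 12 * θ * E.card) * x := by field_simp; ring
    have e2 : x / 6 ≤ x / ((1 + 2 * x) * (1 + x)) := by
      apply div_le_div_of_nonneg_left hx.le (by positivity); nlinarith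
    rw [e1]
    calc _ ≤ (8 * G.C0 ^ 13 * θ * E.card) * x := by
          gcongr
          norm_num
      _ ≤ (192 * G.C0 ^ 13 * θ * E.card) * (x / 6) := by
          have : 0 ≤ G.C0 ^ 13 * θ * E.card * x := by positivity
          nlinarith
      _ ≤ _ := mul_le_mul_of_nonneg_left e2 (by positivity)
  · refine (Cov.bd hψ hL (by positivity) (by positivity) hv hE (mass_triv E N 𝒬) h).trans ?_
    have e1 : G.C0 ^ 7 * (2 * (x * θ)) * (16 * G.C0) * (G.C0 ^ 5 * E.card / x ^ 2) =
        (192 * G.C0 ^ 13 * θ * E.card) * (1 / (6 * x)) := by field_simp; ring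
    have e2 : 1 / (6 * x) ≤ x / ((1 + 2 * x) * (1 + x)) := by
      rw [div_le_div_iff₀ (by positivity) (by positivity)]; nlinarith
    rw [e1]
    exact mul_le_mul_of_nonneg_left e2 (by positivity)

lemma iter {E : Finset X} {N : X → ℕ} {a : Tile → ℂ} {φ ψ : Tile → X → ℂ} {θ B0 : ℝ}
    (hφ : G.Packet φ) (f : X → ℂ) (ha : ∀ P, a P = ∑ y, f y * (starRingEnd ℂ) (φ P y))
    (hψ : G.Packet ψ) (hL : G.LowPass ψ) (hθ : 0 < θ) (hf : ∑ x, ‖f x‖ ^ 2 = θ ^ 2 * E.card)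
    (K : ℕ) : ∀ y : ℝ, 0 < y → ∀ 𝒬 : Finset Tile,
    (∀ P ∈ 𝒬, G.Valid P) → G.Energy a 𝒬 (y * θ) → G.Mass E N 𝒬 (y ^ 2) → G.Cov 𝒬 B0 →
    ∑ x ∈ E, ‖G.Tf N a ψ 𝒬 x‖ ≤
      384 * G.C0 ^ 13 * θ * E.card * (y / (1 + y)) + 16 * G.C0 ^ 8 * θ * B0 * y / 2 ^ K := by
  have hC := G.C0_pos
  have hC1 := G.C0_one
  induction K with
  | zero =>
    intro y hy 𝒬 hv hE hM hB
    have := Cov.bd hψ hL (by positivity) (by positivity) hv hE (mass_triv E N 𝒬) hB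
    have h0 : 0 ≤ 384 * G.C0 ^ 13 * θ * E.card * (y / (1 + y)) := by positivity
    refine this.trans ?_
    have : G.C0 ^ 7 * (y * θ) * (16 * G.C0) * B0 = 16 * G.C0 ^ 8 * θ * B0 * y / 2 ^ 0 := by ring
    linarith
  | succ K ih =>
    intro y hy 𝒬 hv hE hM hB
    obtain ⟨x, hxy⟩ : ∃ x, y = 2 * x := ⟨y / 2, by ring⟩
    subst hxy
    have hx : 0 < x := by linarith
    rw [mul_assoc] at hE
    rw [mul_pow] at hM; norm_num at hM
    obtain ⟨p, p1, p2⟩ := energy_lemma hφ f ha (mul_pos hx hθ) hv hE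
    have hv1 : ∀ P ∈ 𝒬.filter (fun P => ¬ p P), G.Valid P := fun P hP => hv P (mem_filter.1 hP).1
    obtain ⟨q, q1, q2⟩ := mass_lemma (G := G) (E := E) (N := N) (μ := x ^ 2) (by positivity)
      (𝒬.filter (fun P => ¬ p P)) hv1
    have b1 := step_bd (E := E) (N := N) hψ hL hθ hx
      (fun P hP => hv P (mem_filter.1 hP).1 : ∀ P ∈ 𝒬.filter p, G.Valid P)
      (hE.mono (filter_subset _ _)) (hM.mono (filter_subset _ _)) (p2.mono subset_rfl (by
        rw [hf]; apply le_of_eq; field_simp))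
    have b2 := step_bd (E := E) (N := N) hψ hL hθ hx
      (fun P hP => hv1 P (mem_filter.1 hP).1 : ∀ P ∈ (𝒬.filter (fun P => ¬ p P)).filter q, G.Valid P)
      (hE.mono ((filter_subset _ _).trans (filter_subset _ _)))
      (hM.mono ((filter_subset _ _).trans (filter_subset _ _))) (q2.mono subset_rfl (by
        gcongr
        norm_num))
    have b3 := ih x hx ((𝒬.filter (fun P => ¬ p P)).filter (fun P => ¬ q P))
      (fun P hP => hv1 P (mem_filter.1 hP).1) (p1.mono (filter_subset _ _)) q1
      (hB.mono ((filter_subset _ _).trans (filter_subset _ _)) le_rfl)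
    have t1 := Tf_union (G := G) (N := N) (a := a) (ψ := ψ) E 𝒬 p
    have t2 := Tf_union (G := G) (N := N) (a := a) (ψ := ψ) E (𝒬.filter (fun P => ¬ p P)) q
    have e1 : 16 * G.C0 ^ 8 * θ * B0 * (2 * x) / 2 ^ (K + 1) = 16 * G.C0 ^ 8 * θ * B0 * x / 2 ^ K := by
      rw [pow_succ, div_eq_div_iff (by positivity) (by positivity)]; ring
    rw [e1]
    linarith

/-- **The model operator bound.** -/
theorem model_bd {E : Finset X} {N : X → ℕ} {a : Tile → ℂ} {φ ψ : Tile → X → ℂ}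
    (hφ : G.Packet φ) (f : X → ℂ) (ha : ∀ P, a P = ∑ y, f y * (starRingEnd ℂ) (φ P y))
    (hψ : G.Packet ψ) (hL : G.LowPass ψ) (𝒬 : Finset Tile) (hv : ∀ P ∈ 𝒬, G.Valid P) :
    ∑ x ∈ E, ‖G.Tf N a ψ 𝒬 x‖ ≤ G.C0 ^ 14 * √(∑ x, ‖f x‖ ^ 2) * √(E.card : ℝ) := by
  have hC := G.C0_pos
  set Φ := √(∑ x, ‖f x‖ ^ 2) with hΦ
  set ε := √(E.card : ℝ) with hε
  rcases E.eq_empty_or_nonempty with rfl | hEn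
  · simp; positivity
  have hEc : 0 < (E.card : ℝ) := by exact_mod_cast card_pos.2 hEn
  have hε0 : 0 < ε := Real.sqrt_pos.2 hEc
  have hε2 : ε ^ 2 = E.card := Real.sq_sqrt hEc.le
  have hΦ2 : Φ ^ 2 = ∑ x, ‖f x‖ ^ 2 := Real.sq_sqrt (by positivity)
  have hΦ0 : 0 ≤ Φ := Real.sqrt_nonneg _
  rcases hΦ0.eq_or_lt with h0 | h0
  · have : ∀ x, f x = 0 := by
      have h1 : ∑ x, ‖f x‖ ^ 2 = 0 := by rw [← hΦ2, ← h0]; norm_num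
      rw [sum_eq_zero_iff_of_nonneg (fun x _ => by positivity)] at h1
      intro x
      simpa using h1 x (mem_univ _)
    have ha0 : ∀ P, a P = 0 := fun P => by rw [ha]; simp [this]
    simp [Tf, ha0]
    positivity
  obtain ⟨θ, hθ⟩ : ∃ θ, θ = Φ / ε := ⟨_, rfl⟩
  have hθ0 : 0 < θ := hθ ▸ div_pos h0 hε0
  have hf : ∑ x, ‖f x‖ ^ 2 = θ ^ 2 * E.card := by
    rw [← hΦ2, ← hε2, hθ]; field_simp
  obtain ⟨A, hA⟩ : ∃ A, A = ∑ P ∈ 𝒬, ‖a P‖ ^ 2 := ⟨_, rfl⟩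
  have hA0 : 0 ≤ A := by rw [hA]; positivity
  obtain ⟨y, hy⟩ : ∃ y, y = 16 * G.C0 + √A / θ := ⟨_, rfl⟩
  have hy1 : √A / θ ≤ y := by rw [hy]; linarith
  have hy2 : 16 * G.C0 ≤ y := by
    have : 0 ≤ √A / θ := by positivity
    rw [hy]; linarith
  have hy0 : 0 < y := by linarith
  have hEn : G.Energy a 𝒬 (y * θ) := by
    intro s i ξ _ T hT _
    have hb := G.β_ge s
    have h1 : ∑ P ∈ T, ‖a P‖ ^ 2 ≤ A := hA ▸ sum_le_sum_of_subset_of_nonneg hT (fun _ _ _ => by positivity)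
    have h2 : √A ≤ y * θ := by rwa [div_le_iff₀ hθ0] at hy1
    have h3 : A ≤ (y * θ) ^ 2 := by
      rw [← Real.sq_sqrt hA0]; exact pow_le_pow_left₀ (Real.sqrt_nonneg _) h2 2
    nlinarith [sq_nonneg (y * θ)]
  have hMa : G.Mass E N 𝒬 (y ^ 2) := by
    intro P hP P' hv' hle l
    refine (mass_triv (G := G) E N 𝒬 P hP P' hv' hle l).trans ?_
    have hb := G.β_pos P'.s
    have : 16 * G.C0 ≤ y ^ 2 := by have := G.C0_one; nlinarith
    gcongr
  have hK := fun K => iter hφ f ha hψ hL hθ0 hf K y hy0 𝒬 hv hEn hMa (Cov.triv 𝒬 hv)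
  obtain ⟨M, hM⟩ : ∃ M, M = 16 * G.C0 ^ 8 * θ * (∑ P ∈ 𝒬, G.β P.s) * y := ⟨_, rfl⟩
  rw [← hM] at hK
  have hlim : Filter.Tendsto (fun K : ℕ => 384 * G.C0 ^ 13 * θ * E.card * (y / (1 + y)) + M * (1 / 2) ^ K)
      Filter.atTop (nhds (384 * G.C0 ^ 13 * θ * E.card * (y / (1 + y)) + M * 0)) :=
    tendsto_const_nhds.add (tendsto_const_nhds.mul
      (tendsto_pow_atTop_nhds_zero_of_lt_one (by norm_num) (by norm_num)))
  have hle : ∑ x ∈ E, ‖G.Tf N a ψ 𝒬 x‖ ≤ _ := ge_of_tendsto' hlim (fun K => by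
    have := hK K
    rwa [div_eq_mul_inv M, ← inv_pow, ← one_div] at this)
  refine hle.trans ?_
  have h1 : y / (1 + y) ≤ 1 := by rw [div_le_one (by positivity)]; linarith
  have h2 : θ * E.card = Φ * ε := by rw [hθ, ← hε2]; field_simp
  have h3 : 384 * G.C0 ^ 13 * θ * E.card * (y / (1 + y)) + M * 0 =
      384 * (G.C0 ^ 13 * (Φ * ε)) * (y / (1 + y)) := by rw [← h2]; ring
  have h4 : 0 ≤ G.C0 ^ 13 * (Φ * ε) :=
    mul_nonneg (pow_nonneg hC.le _) (mul_nonneg hΦ0 hε0.le)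
  have h5 := G.C0_ge
  rw [h3]
  calc _ ≤ 384 * (G.C0 ^ 13 * (Φ * ε)) * 1 := mul_le_mul_of_nonneg_left h1 (by linarith)
    _ ≤ G.C0 * (G.C0 ^ 13 * (Φ * ε)) := by
        rw [mul_one]
        exact mul_le_mul_of_nonneg_right (by linarith) h4
    _ = _ := by ring

end Geo
end
end CT

end

section
namespace CT
open Finset
open scoped Classical

def bN (M S t s : ℕ) : ℕ := 2 ^ (M - (t + 6 * S) + 6 * s)
def WN (S t s : ℕ) : ℕ := 2 ^ (t + 6 * (S - s))

lemma bN_pos (M S t s : ℕ) : 0 < bN M S t s := by unfold bN; positivity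
lemma WN_pos (S t s : ℕ) : 0 < WN S t s := by unfold WN; positivity

lemma bN_WN {M S t s : ℕ} (h : t + 6 * S + 6 ≤ M) (hs : s ≤ S) : bN M S t s * WN S t s = 2 ^ M := by
  unfold bN WN; rw [← pow_add]; congr 1; omega

lemma WN_succ {S t s : ℕ} (hs : s < S) : WN S t s = 64 * WN S t (s + 1) := by
  unfold WN
  have : t + 6 * (S - s) = 6 + (t + 6 * (S - (s + 1))) := by omega
  rw [this, pow_add]; norm_num

lemma WN_dvd {S t s s' : ℕ} (h : s ≤ s') : WN S t s' ∣ WN S t s := by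
  unfold WN; apply pow_dvd_pow; omega

lemma bN_dvd {M S t s s' : ℕ} (h : s ≤ s') : bN M S t s ∣ bN M S t s' := by
  unfold bN; apply pow_dvd_pow; omega

lemma div_eq_of_dvd {a b x y : ℕ} (h : a ∣ b) (hxy : x / a = y / a) : x / b = y / b := by
  obtain ⟨c, rfl⟩ := h
  rw [← Nat.div_div_eq_div_mul, ← Nat.div_div_eq_div_mul, hxy]

/-- circular absolute value -/
noncomputable def nz {L : ℕ} (x : ZMod L) : ℕ := x.valMinAbs.natAbs

lemma nz_neg {L : ℕ} [NeZero L] (x : ZMod L) : nz (-x) = nz x := ZMod.natAbs_valMinAbs_neg x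

lemma nz_add {L : ℕ} [NeZero L] (x y : ZMod L) : nz (x + y) ≤ nz x + nz y :=
  (ZMod.natAbs_valMinAbs_add_le x y).trans (Int.natAbs_add_le _ _)

lemma nz_sub {L : ℕ} [NeZero L] (x y : ZMod L) (h : y.val ≤ x.val) :
    nz (x - y) = min (x.val - y.val) (L - (x.val - y.val)) := by
  unfold nz
  rw [ZMod.valMinAbs_natAbs_eq_min, ZMod.val_sub h]

/-- sums over the circle -/
lemma sum_nz {L : ℕ} [NeZero L] (g : ℕ → ℝ) (hg : ∀ k, 0 ≤ g k) :
    ∑ y : ZMod L, g (nz y) ≤ 2 * ∑ k ∈ range L, g k := by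
  have h1 : ∀ y : ZMod L, g (nz y) ≤ g y.val + g ((-y).val) := by
    intro y
    have h2 : nz y = min y.val (L - y.val) := by
      unfold nz; rw [ZMod.valMinAbs_natAbs_eq_min]
    by_cases hy : y = 0
    · subst hy; simp [h2]; exact hg 0
    · have : (-y).val = L - y.val := by
        haveI : NeZero y := ⟨hy⟩
        exact ZMod.val_neg_of_ne_zero y
      rw [this, h2]
      rcases min_choice y.val (L - y.val) with h | h <;> rw [h]
      · linarith [hg (L - y.val)]
      · linarith [hg y.val]
  have h3 : ∑ y : ZMod L, g y.val = ∑ k ∈ range L, g k := by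
    apply sum_bij (fun y _ => y.val)
    · intro y _; exact mem_range.2 (ZMod.val_lt y)
    · intro a _ b _ h; exact ZMod.val_injective _ h
    · intro k hk; exact ⟨(k : ZMod L), mem_univ _, ZMod.val_cast_of_lt (mem_range.1 hk)⟩
    · intros; rfl
  have h4 : ∑ y : ZMod L, g ((-y).val) = ∑ y : ZMod L, g y.val :=
    Equiv.sum_comp (Equiv.neg (ZMod L)) (fun y : ZMod L => g y.val)
  calc _ ≤ ∑ y : ZMod L, (g y.val + g ((-y).val)) := sum_le_sum fun y _ => h1 y
    _ = _ := by rw [sum_add_distrib, h4, h3]; ring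

lemma sum_inv_sq {t : ℝ} (ht : 1 ≤ t) (n : ℕ) :
    ∑ k ∈ range n, (1 + (k:ℝ) / t)⁻¹ ^ 2 ≤ 2 * t := by
  have t0 : 0 < t := by linarith
  have key : ∀ n : ℕ, ∑ k ∈ range (n + 1), (1 + (k:ℝ) / t)⁻¹ ^ 2 ≤ 1 + t - t ^ 2 / (t + n) := by
    intro n
    induction n with
    | zero =>
      simp; rw [sq, mul_div_assoc, div_self t0.ne']; linarith
    | succ n ih =>
      rw [sum_range_succ]
      have hn : (0:ℝ) ≤ n := Nat.cast_nonneg n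
      have h1 : (1 + ((n + 1 : ℕ):ℝ) / t)⁻¹ ^ 2 ≤ t ^ 2 / (t + n) - t ^ 2 / (t + (n + 1 : ℕ)) := by
        push_cast
        have : (1 + ((n:ℝ) + 1) / t)⁻¹ ^ 2 = t ^ 2 / (t + (n + 1)) ^ 2 := by field_simp
        rw [this, div_sub_div _ _ (by positivity) (by positivity), div_le_div_iff₀ (by positivity) (by positivity)]
        have a : 0 < t + n := by positivity
        have : t ^ 2 * (t + (↑n + 1)) - (t + ↑n) * t ^ 2 = t ^ 2 := by ring
        rw [this]
        have : (t + ↑n) * (t + (↑n + 1)) ≤ (t + (↑n + 1)) ^ 2 := by nlinarith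
        exact mul_le_mul_of_nonneg_left this (by positivity)
      linarith
  have h := key n
  have hm : ∑ k ∈ range n, (1 + (k:ℝ) / t)⁻¹ ^ 2 ≤ ∑ k ∈ range (n + 1), (1 + (k:ℝ) / t)⁻¹ ^ 2 := by
    rw [sum_range_succ]
    have : 0 ≤ (1 + (n:ℝ) / t)⁻¹ ^ 2 := by positivity
    linarith
  have : 0 ≤ t ^ 2 / (t + n) := by positivity
  linarith

lemma cgrowth {L : ℕ} [NeZero L] {t : ℝ} (ht : 1 ≤ t) (x : ZMod L) :
    ∑ y : ZMod L, (1 + (nz (x - y) : ℝ) / t)⁻¹ ^ 2 ≤ 4 * t := by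
  have h1 : ∑ y : ZMod L, (1 + (nz (x - y) : ℝ) / t)⁻¹ ^ 2 = ∑ y : ZMod L, (1 + (nz y : ℝ) / t)⁻¹ ^ 2 :=
    Equiv.sum_comp (Equiv.subLeft x) (fun y : ZMod L => (1 + (nz y : ℝ) / t)⁻¹ ^ 2)
  rw [h1]
  have := sum_nz (L := L) (fun k => (1 + (k : ℝ) / t)⁻¹ ^ 2) (fun k => by positivity)
  have := sum_inv_sq ht L
  linarith

lemma nz_sub_comm {L : ℕ} [NeZero L] (x y : ZMod L) : nz (x - y) = nz (y - x) := by
  rw [← nz_neg, neg_sub]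

lemma nz_far {L b : ℕ} [NeZero L] (hb : 0 < b) (hbL : b ∣ L) (x y : ZMod L) (h : x.val / b ≠ y.val / b) :
    min (y.val % b) (b - 1 - y.val % b) ≤ nz (x - y) := by
  have hx := ZMod.val_lt x
  have hy := ZMod.val_lt y
  obtain ⟨m, hm⟩ := hbL
  have e1 := Nat.div_add_mod x.val b
  have e2 := Nat.div_add_mod y.val b
  have l1 := Nat.mod_lt x.val hb
  have l2 := Nat.mod_lt y.val hb
  have hym : y.val / b < m := by
    rw [Nat.div_lt_iff_lt_mul hb, mul_comm, ← hm]; exact hy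
  have hm2 : b * (y.val / b) + b ≤ L := by
    calc b * (y.val / b) + b = b * (y.val / b + 1) := by ring
      _ ≤ b * m := Nat.mul_le_mul_left _ hym
      _ = L := hm.symm
  rcases le_total y.val x.val with hle | hle
  · rw [nz_sub x y hle]
    have h3 : y.val / b + 1 ≤ x.val / b := by
      have := Nat.div_le_div_right (c := b) hle
      omega
    have h4 : b * (y.val / b) + b ≤ b * (x.val / b) := by
      calc b * (y.val / b) + b = b * (y.val / b + 1) := by ring
        _ ≤ _ := Nat.mul_le_mul_left _ h3
    have h5 : y.val % b ≤ y.val := Nat.mod_le _ _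
    omega
  · rw [nz_sub_comm, nz_sub y x hle]
    have h3 : x.val / b + 1 ≤ y.val / b := by
      have := Nat.div_le_div_right (c := b) hle
      omega
    have h4 : b * (x.val / b) + b ≤ b * (y.val / b) := by
      calc b * (x.val / b) + b = b * (x.val / b + 1) := by ring
        _ ≤ _ := Nat.mul_le_mul_left _ h3
    omega

lemma nz_near {L b : ℕ} [NeZero L] (hb : 0 < b) (x y : ZMod L) (h : x.val / b = y.val / b) :
    nz (x - y) ≤ b := by
  have e1 := Nat.div_add_mod x.val b
  have e2 := Nat.div_add_mod y.val b
  have l1 := Nat.mod_lt x.val hb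
  have l2 := Nat.mod_lt y.val hb
  rw [h] at e1
  rcases le_total y.val x.val with hle | hle
  · rw [nz_sub x y hle]; omega
  · rw [nz_sub_comm, nz_sub y x hle]; omega

/-- sum over one block -/
lemma sum_block {L b : ℕ} [NeZero L] (hb : 0 < b) (hbL : b ∣ L) (x0 : ZMod L) (g : ℕ → ℝ) :
    ∑ y ∈ univ.filter (fun y : ZMod L => y.val / b = x0.val / b), g (y.val % b) = ∑ k ∈ range b, g k := by
  obtain ⟨m, hm⟩ := hbL
  have hy := ZMod.val_lt x0
  have hym : x0.val / b < m := by
    rw [Nat.div_lt_iff_lt_mul hb, mul_comm, ← hm]; exact hy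
  have hm2 : b * (x0.val / b) + b ≤ L := by
    calc b * (x0.val / b) + b = b * (x0.val / b + 1) := by ring
      _ ≤ b * m := Nat.mul_le_mul_left _ hym
      _ = L := hm.symm
  apply sum_bij (fun y _ => y.val % b)
  · intro y _; exact mem_range.2 (Nat.mod_lt _ hb)
  · intro y hy z hz h
    simp only [mem_filter, mem_univ, true_and] at hy hz
    apply ZMod.val_injective
    rw [← Nat.div_add_mod y.val b, ← Nat.div_add_mod z.val b, hy, hz, h]
  · intro k hk
    have hk := mem_range.1 hk
    have hv : ((b * (x0.val / b) + k : ℕ) : ZMod L).val = b * (x0.val / b) + k :=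
      ZMod.val_cast_of_lt (by omega)
    refine ⟨((b * (x0.val / b) + k : ℕ) : ZMod L), ?_, ?_⟩
    · simp only [mem_filter, mem_univ, true_and]
      rw [hv, Nat.mul_add_div hb, Nat.div_eq_of_lt hk, add_zero]
    · rw [hv, Nat.mul_add_mod, Nat.mod_eq_of_lt hk]
  · intros; rfl

lemma cbdry {L b : ℕ} [NeZero L] (hb : 0 < b) (hbL : b ∣ L) {t : ℝ} (ht : 1 ≤ t) (x0 : ZMod L) :
    ∑ y ∈ univ.filter (fun y : ZMod L => y.val / b = x0.val / b),
      ∑ x ∈ univ.filter (fun x : ZMod L => x.val / b ≠ x0.val / b), (1 + (nz (x - y) : ℝ) / t)⁻¹ ^ 4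
      ≤ 16 * t ^ 2 := by
  have t0 : 0 < t := by linarith
  set g : ℕ → ℝ := fun k => (1 + (k:ℝ) / t)⁻¹ ^ 2 with hg
  have g0 : ∀ k, 0 ≤ g k := fun k => by simp only [hg]; positivity
  have gm : ∀ k l, k ≤ l → g l ≤ g k := by
    intro k l h
    simp only [hg]
    have : (k:ℝ) ≤ l := by exact_mod_cast h
    gcongr
  have step : ∀ y ∈ univ.filter (fun y : ZMod L => y.val / b = x0.val / b),
      ∑ x ∈ univ.filter (fun x : ZMod L => x.val / b ≠ x0.val / b), (1 + (nz (x - y) : ℝ) / t)⁻¹ ^ 4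
      ≤ (g (y.val % b) + g (b - 1 - y.val % b)) * (4 * t) := by
    intro y hy
    simp only [mem_filter, mem_univ, true_and] at hy
    calc _ ≤ ∑ x ∈ univ.filter (fun x : ZMod L => x.val / b ≠ x0.val / b),
          (g (y.val % b) + g (b - 1 - y.val % b)) * (1 + (nz (y - x) : ℝ) / t)⁻¹ ^ 2 := by
          apply sum_le_sum
          intro x hx
          simp only [mem_filter, mem_univ, true_and] at hx
          have h1 := nz_far hb hbL x y (by rw [hy]; exact hx)
          have h2 : g (nz (x - y)) ≤ g (y.val % b) + g (b - 1 - y.val % b) := by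
            refine (gm _ _ h1).trans ?_
            rcases min_choice (y.val % b) (b - 1 - y.val % b) with h | h <;> rw [h]
            · linarith [g0 (b - 1 - y.val % b)]
            · linarith [g0 (y.val % b)]
          rw [nz_sub_comm y x]
          have : (1 + (nz (x - y) : ℝ) / t)⁻¹ ^ 4 = g (nz (x - y)) * (1 + (nz (x - y) : ℝ) / t)⁻¹ ^ 2 := by
            simp only [hg]; ring
          rw [this]
          exact mul_le_mul_of_nonneg_right h2 (by positivity)
      _ ≤ ∑ x : ZMod L, (g (y.val % b) + g (b - 1 - y.val % b)) * (1 + (nz (y - x) : ℝ) / t)⁻¹ ^ 2 := by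
          apply sum_le_sum_of_subset_of_nonneg (filter_subset _ _)
          intro x _ _
          exact mul_nonneg (add_nonneg (g0 _) (g0 _)) (by positivity)
      _ ≤ _ := by
          rw [← mul_sum]
          exact mul_le_mul_of_nonneg_left (cgrowth ht y) (add_nonneg (g0 _) (g0 _))
  refine (sum_le_sum step).trans ?_
  rw [← sum_mul, sum_add_distrib, sum_block hb hbL x0 g, sum_block hb hbL x0 (fun k => g (b - 1 - k)),
    sum_range_reflect g b]
  have := sum_inv_sq ht b
  have h3 : ∑ k ∈ range b, g k ≤ 2 * t := this
  nlinarith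

lemma nz_zero {L : ℕ} : nz (0 : ZMod L) = 0 := by simp [nz]

instance neZ (M : ℕ) : NeZero (2 ^ M) := ⟨by positivity⟩

lemma bN_dvdL {M S t s : ℕ} (h : t + 6 * S + 6 ≤ M) (hs : s ≤ S) : bN M S t s ∣ 2 ^ M :=
  ⟨_, (bN_WN h hs).symm⟩

/-- the concrete geometry -/
noncomputable def CG (M S t : ℕ) (h : t + 6 * S + 6 ≤ M) : Geo (ZMod (2 ^ M)) where
  C0 := 2 ^ 40
  C0_ge := by norm_num
  d x y := (nz (x - y) : ℝ)
  d_nonneg x y := by positivity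
  d_symm x y := by rw [nz_sub_comm]
  d_self x := by simp [nz_zero]
  d_tri x y z := by
    have := nz_add (x - y) (y - z)
    rw [sub_add_sub_cancel] at this
    exact_mod_cast this
  S := S
  β s := (bN M S t s : ℝ)
  β_ge s := by exact_mod_cast bN_pos M S t s
  β_succ s := by
    have : bN M S t (s + 1) = 64 * bN M S t s := by
      unfold bN
      rw [mul_add, ← add_assoc, pow_add _ _ (6 * 1)]; norm_num; ring
    rw [this]; push_cast; ring
  tb s x := x.val / bN M S t s
  tb_mono s s' x y hs hxy := div_eq_of_dvd (bN_dvd hs) hxy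
  tb_card s hs x := by
    have := sum_block (bN_pos M S t s) (bN_dvdL h hs) x (fun _ => (1:ℝ))
    simp only [sum_const, card_range, nsmul_eq_mul, mul_one] at this
    rw [← this]
  d_tb s x y hxy := by exact_mod_cast nz_near (bN_pos M S t s) x y hxy
  ctr s i := ((i * bN M S t s : ℕ) : ZMod (2 ^ M))
  tb_ctr s hs x := by
    have hx := ZMod.val_lt x
    rw [ZMod.val_cast_of_lt, Nat.mul_div_cancel _ (bN_pos M S t s)]
    exact (Nat.div_mul_le_self _ _).trans_lt hx
  growth t' ht' x := by
    refine (cgrowth ht' x).trans ?_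
    nlinarith
  bdry s hs t' ht' x0 := by
    refine (cbdry (bN_pos M S t s) (bN_dvdL h hs) ht' x0).trans ?_
    nlinarith [sq_nonneg t']
  fb s ξ := ξ / WN S t s
  fb_mono s s' ξ η hs hxy := div_eq_of_dvd (WN_dvd hs) hxy
  up s ξ := s < S ∧ (ξ / WN S t (s + 1)) % 64 = 63
  up_congr s s' ξ η hs hxy := by
    rw [div_eq_of_dvd (WN_dvd (Nat.succ_le_of_lt hs)) hxy]
  up_lt s ξ η hxy h1 h2 := by
    obtain ⟨hs, h2⟩ := h2
    rw [WN_succ hs, mul_comm, ← Nat.div_div_eq_div_mul, ← Nat.div_div_eq_div_mul] at hxy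
    have h1 : (ξ / WN S t (s + 1)) % 64 ≠ 63 := fun h => h1 ⟨hs, h⟩
    have : ξ / WN S t (s + 1) < η / WN S t (s + 1) := by omega
    by_contra hc
    exact absurd (Nat.div_le_div_right (c := WN S t (s + 1)) (not_lt.1 hc)) (not_le.2 this)
  up_ex s ξ hs := by
    have hp := WN_pos S t (s + 1)
    refine ⟨(64 * (ξ / WN S t s) + 63) * WN S t (s + 1), ?_, hs, ?_⟩
    · rw [WN_succ hs, mul_comm 64 (WN S t (s + 1)), ← Nat.div_div_eq_div_mul, Nat.mul_div_cancel _ hp]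
      omega
    · rw [Nat.mul_div_cancel _ hp]; omega
end CT

end

section
namespace CT
open Finset
open scoped Classical

section
variable {L : ℕ} [NeZero L]

/-- the standard character -/
noncomputable def ee (x : ZMod L) : ℂ := ZMod.stdAddChar x

lemma ee_add (x y : ZMod L) : ee (x + y) = ee x * ee y := AddChar.map_add_eq_mul _ _ _
lemma ee_zero : ee (0 : ZMod L) = 1 := AddChar.map_zero_eq_one _
lemma ee_conj (x : ZMod L) : starRingEnd ℂ (ee x) = ee (-x) := by
  unfold ee; rw [AddChar.map_neg_eq_conj]
lemma ee_norm (x : ZMod L) : ‖ee x‖ = 1 := AddChar.norm_apply _ _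

lemma ee_natmul (n : ℕ) (x : ZMod L) : ee ((n : ZMod L) * x) = ee x ^ n := by
  unfold ee; rw [← nsmul_eq_mul, AddChar.map_nsmul_eq_pow]

lemma ee_sum (ξ : ZMod L) : ∑ x : ZMod L, ee (ξ * x) = if ξ = 0 then (L : ℂ) else 0 := by
  have h := AddChar.sum_mulShift (R := ZMod L) (R' := ℂ) (ψ := ZMod.stdAddChar) ξ (ZMod.isPrimitive_stdAddChar L)
  rw [ZMod.card] at h
  have h' : (if ξ = 0 then (L : ℂ) else 0) = ((if ξ = 0 then L else 0 : ℕ) : ℂ) := by split_ifs <;> simp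
  rw [h', ← h]
  apply sum_congr rfl
  intro x _
  rw [mul_comm]; rfl

lemma ee_sub_one (x : ZMod L) : 4 * (nz x : ℝ) / L ≤ ‖ee x - 1‖ := by
  have hL : (0:ℝ) < L := by exact_mod_cast Nat.pos_of_ne_zero (NeZero.ne L)
  set a := x.valMinAbs with ha
  have hx : x = ((a : ℤ) : ZMod L) := (ZMod.coe_valMinAbs x).symm
  have h1 : ee x = Complex.exp (Complex.I * ((2 * Real.pi * a / L : ℝ) : ℂ)) := by
    unfold ee
    rw [hx, ZMod.stdAddChar_coe]
    congr 1; push_cast; ring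
  rw [h1, Complex.norm_exp_I_mul_ofReal_sub_one]
  have hab : (nz x : ℝ) = |(a:ℝ)| := by
    unfold nz; rw [← ha]; rw [Nat.cast_natAbs]; simp
  have h2 : |(a:ℝ)| ≤ L / 2 := by
    rw [← hab]
    have : nz x ≤ L / 2 := ZMod.natAbs_valMinAbs_le x
    have h3 : 2 * nz x ≤ L := by omega
    have : (2:ℝ) * nz x ≤ L := by exact_mod_cast h3
    linarith
  rw [hab, norm_mul, Real.norm_eq_abs, Real.norm_eq_abs, Real.abs_sin_eq_sin_abs_of_abs_le_pi]
  · have e1 : |2 * Real.pi * (a:ℝ) / L / 2| = Real.pi * |(a:ℝ)| / L := by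
      rw [abs_div, abs_div, abs_mul, abs_mul, abs_of_pos Real.pi_pos, abs_of_pos hL]; norm_num; ring
    rw [e1]
    have hp := Real.pi_pos
    have := Real.mul_le_sin (x := Real.pi * |(a:ℝ)| / L) (by positivity)
      (by rw [div_le_div_iff₀ hL two_pos]; nlinarith)
    have e2 : 2 / Real.pi * (Real.pi * |(a:ℝ)| / L) = 2 * |(a:ℝ)| / L := by field_simp
    rw [e2] at this
    rw [abs_of_pos (two_pos : (0:ℝ) < 2)]
    calc 4 * |(a:ℝ)| / L = 2 * (2 * |(a:ℝ)| / L) := by ring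
      _ ≤ _ := by linarith
  · rw [abs_div, abs_div, abs_mul, abs_mul, abs_of_pos Real.pi_pos, abs_of_pos hL]
    norm_num
    rw [div_le_iff₀ two_pos, div_le_iff₀ hL]
    have := Real.pi_pos
    nlinarith

/-- Dirichlet-type sum -/
noncomputable def DD (n : ℕ) (y : ZMod L) : ℂ := ∑ v ∈ range n, ee (-((v : ZMod L) * y))

lemma DD_le (n : ℕ) (y : ZMod L) : ‖DD n y‖ ≤ n := by
  unfold DD
  refine (norm_sum_le _ _).trans ?_
  simp [ee_norm]

lemma DD_nz (n : ℕ) (y : ZMod L) : ‖DD n y‖ * nz y ≤ L / 2 := by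
  have hL : (0:ℝ) < L := by exact_mod_cast Nat.pos_of_ne_zero (NeZero.ne L)
  have h1 : DD n y * (ee (-y) - 1) = ee (-y) ^ n - 1 := by
    unfold DD
    rw [← geom_sum_mul]
    congr 1
    apply sum_congr rfl
    intro v _
    rw [← ee_natmul, mul_neg]
  have h2 : ‖ee (-y) ^ n - 1‖ ≤ 2 := by
    refine (norm_sub_le _ _).trans ?_
    rw [norm_pow, ee_norm]; norm_num
  have h3 := ee_sub_one (-y)
  rw [nz_neg] at h3
  rw [← h1, norm_mul] at h2
  have h4 : ‖DD n y‖ * (4 * (nz y : ℝ) / L) ≤ 2 :=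
    (mul_le_mul_of_nonneg_left h3 (norm_nonneg _)).trans h2
  rw [mul_div_assoc', div_le_iff₀ hL] at h4
  linarith

lemma DD_wt (n : ℕ) (y : ZMod L) {b c : ℝ} (hb : 0 < b) (h : (L:ℝ) ≤ 2 * n * c * b) :
    ‖DD n y‖ ≤ n * (1 + c) * (1 + (nz y : ℝ) / b)⁻¹ := by
  rw [← div_eq_mul_inv, le_div_iff₀ (by positivity)]
  have h1 := DD_le n y
  have h2 := DD_nz n y
  have : ‖DD n y‖ * ((nz y : ℝ) / b) ≤ n * c := by
    rw [mul_div_assoc', div_le_iff₀ hb]; linarith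
  linarith

/-- box convolution -/
noncomputable def AA (n : ℕ) (g : ℤ → ℂ) (u : ℤ) : ℂ := ∑ v ∈ range n, g (u - v)

/-- F is the trigonometric polynomial with coefficients m -/
def Rep (a : ℕ) (m : ℤ → ℂ) (F : ZMod L → ℂ) : Prop :=
  (∀ k, m k ≠ 0 → 0 ≤ k ∧ k < a) ∧ ∀ y, F y = ∑ k ∈ range a, m k * ee (-((k : ZMod L) * y))

lemma Rep.mono {a a' : ℕ} {m : ℤ → ℂ} {F : ZMod L → ℂ} (h : Rep a m F) (ha : a ≤ a') : Rep a' m F := by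
  refine ⟨fun k hk => ⟨(h.1 k hk).1, by have := (h.1 k hk).2; omega⟩, fun y => ?_⟩
  rw [h.2 y]
  apply sum_subset (range_subset_range.2 ha)
  intro k _ hk
  have : m k = 0 := by
    by_contra hc
    have := (h.1 k hc).2
    exact hk (mem_range.2 (by exact_mod_cast this))
  rw [this, zero_mul]

/-- delta -/
noncomputable def dl (k : ℤ) : ℂ := if k = 0 then 1 else 0

lemma Rep_one : Rep 1 dl (fun _ : ZMod L => (1:ℂ)) := by
  refine ⟨fun k hk => ?_, fun y => ?_⟩
  · unfold dl at hk
    have : k = 0 := by by_contra h; simp [h] at hk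
    subst this; simp
  · simp [dl, ee_zero]

lemma Rep.mul_DD {a : ℕ} {m : ℤ → ℂ} {F : ZMod L → ℂ} (h : Rep a m F) (n : ℕ) :
    Rep (a + n) (AA n m) (fun y => DD n y * F y) := by
  refine ⟨fun k hk => ?_, fun y => ?_⟩
  · unfold AA at hk
    obtain ⟨v, hv, hv2⟩ := exists_ne_zero_of_sum_ne_zero hk
    have := h.1 _ hv2
    have := mem_range.1 hv
    push_cast
    omega
  · simp only [DD, AA]
    have h2 : ∀ v ∈ range n, ∑ k ∈ range (a + n), m (k - v) * ee (-((k : ZMod L) * y)) =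
        ee (-((v : ZMod L) * y)) * F y := by
      intro v hv
      have hv := mem_range.1 hv
      rw [h.2 y, mul_sum]
      symm
      apply sum_of_injOn (fun k => k + v)
      · intro x _ z _ hxz; simpa using hxz
      · intro k hk; simp at hk ⊢; omega
      · intro k hk hk2
        have : m (k - v) = 0 := by
          by_contra hc
          have h3 := h.1 _ hc
          apply hk2
          refine ⟨k - v, ?_, ?_⟩
          · simp; omega
          · simp; omega
        rw [this, zero_mul]
      · intro k hk
        push_cast
        rw [add_sub_cancel_right, add_mul, neg_add, ee_add]; ring
    simp only [sum_mul]
    rw [sum_comm]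
    exact (sum_congr rfl h2).symm

lemma Rep.smul {a : ℕ} {m : ℤ → ℂ} {F : ZMod L → ℂ} (h : Rep a m F) (c : ℂ) :
    Rep a (fun k => c * m k) (fun y => c * F y) := by
  refine ⟨fun k hk => h.1 k (right_ne_zero_of_mul hk), fun y => ?_⟩
  show c * F y = _
  rw [h.2 y, mul_sum]
  exact sum_congr rfl fun k _ => by ring

lemma AA_smul (n : ℕ) (c : ℂ) (g : ℤ → ℂ) : AA n (fun k => c * g k) = fun k => c * AA n g k := by
  funext k; simp [AA, mul_sum]

end
end CT

end

section
namespace CT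
open Finset
open scoped Classical

section
variable {L : ℕ} [NeZero L]

lemma AA_dl {m : ℕ} {u : ℤ} : AA m dl u = if 0 ≤ u ∧ u < m then 1 else 0 := by
  unfold AA dl
  split_ifs with h
  · rw [sum_eq_single u.toNat]
    · rw [if_pos]; omega
    · intro v _ hv; rw [if_neg]; omega
    · intro h2; exfalso; apply h2; rw [mem_range]; omega
  · apply sum_eq_zero
    intro v hv
    have := mem_range.1 hv
    rw [if_neg]; omega

lemma Rep_DD (m : ℕ) : Rep (L := L) m (AA m dl) (DD m) := by
  refine ⟨fun k hk => ?_, fun y => ?_⟩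
  · rw [AA_dl] at hk
    by_contra hc
    rw [if_neg hc] at hk
    exact hk rfl
  · unfold DD
    apply sum_congr rfl
    intro k hk
    have := mem_range.1 hk
    rw [AA_dl, if_pos (by omega), one_mul]

noncomputable def FF (B n : ℕ) (y : ZMod L) : ℂ := ((n:ℂ)⁻¹) ^ 5 * (DD n y * (DD n y * (DD n y * (DD n y * (DD n y * DD (B * n) y)))))
noncomputable def mm (B n : ℕ) (k : ℤ) : ℂ := ((n:ℂ)⁻¹) ^ 5 * AA n (AA n (AA n (AA n (AA n (AA (B * n) dl))))) k

lemma Rep_FF (B n : ℕ) : Rep (L := L) ((B + 5) * n) (mm B n) (FF B n) := by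
  have h := (((((Rep_DD (L := L) (B * n)).mul_DD n).mul_DD n).mul_DD n).mul_DD n).mul_DD n
  have e : (B + 5) * n = B * n + n + n + n + n + n := by ring
  rw [e]
  exact h.smul _

lemma AA_const {n : ℕ} {g : ℤ → ℂ} {a b : ℤ} {c : ℂ} (h : ∀ u, a ≤ u → u < b → g u = c) :
    ∀ u, a + n ≤ u → u < b → AA n g u = n * c := by
  intro u h1 h2
  unfold AA
  have : ∑ v ∈ range n, g (u - (v : ℕ)) = ∑ v ∈ range n, c :=
    sum_congr rfl (fun v hv => h (u - (v : ℕ)) (by have := mem_range.1 hv; omega) (by omega))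
  rw [this]
  simp

lemma mm_one {n : ℕ} (hn : 0 < n) (u : ℤ) (h1 : 5 * n ≤ u) (h2 : u < 11 * n) : mm 11 n u = 1 := by
  have h0 : ∀ u : ℤ, 0 ≤ u → u < 11 * n → AA (11 * n) dl u = 1 := by
    intro u h1 h2; rw [AA_dl, if_pos]; push_cast; exact ⟨h1, h2⟩
  have h := AA_const (n := n) (AA_const (n := n) (AA_const (n := n) (AA_const (n := n) (AA_const (n := n) h0))))
    u (by linarith) h2
  unfold mm
  rw [h]
  have : (n:ℂ) ≠ 0 := by exact_mod_cast hn.ne'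
  field_simp

end

section
variable (M S t : ℕ)

/-- wave packets -/
noncomputable def pk (B q : ℕ) (P : Tile) (x : ZMod (2 ^ M)) : ℂ :=
  if (P.j + 1) * WN S t P.s ≤ 2 ^ M then
    ((√(bN M S t P.s : ℝ) / 2 ^ M : ℝ) : ℂ) * FF B (WN S t (P.s + 1)) (x - ((P.i * bN M S t P.s : ℕ) : ZMod (2 ^ M))) *
      ee ((((P.j * WN S t P.s + 63 * WN S t (P.s + 1) : ℤ) - q * WN S t (P.s + 1) : ℤ) : ZMod (2 ^ M)) *
        (x - ((P.i * bN M S t P.s : ℕ) : ZMod (2 ^ M))))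
  else 0

noncomputable def spc (P : Tile) : Finset ℕ := (range (2 ^ M)).filter fun ξ =>
  P.j * WN S t P.s + 31 * WN S t (P.s + 1) ≤ ξ ∧ ξ ≤ P.j * WN S t P.s + 60 * WN S t (P.s + 1)

variable {M S t}

lemma pk_spec {B q : ℕ} (h1 : 3 ≤ q) (h2 : q + B + 5 ≤ 32) {P : Tile} (hs : P.s < S) :
    ∃ coef : ℕ → ℂ, ∀ x, pk M S t B q P x = ∑ ξ ∈ spc M S t P, coef ξ * ee ((ξ : ZMod (2 ^ M)) * x) := by
  by_cases hc : (P.j + 1) * WN S t P.s ≤ 2 ^ M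
  swap
  · exact ⟨fun _ => 0, fun x => by simp [pk, hc]⟩
  obtain ⟨n, hn⟩ : ∃ n, n = WN S t (P.s + 1) := ⟨_, rfl⟩
  have hW : WN S t P.s = 64 * n := by rw [hn, WN_succ hs]
  have n0 : 0 < n := hn ▸ WN_pos _ _ _
  obtain ⟨c, hcc⟩ : ∃ c, c = ((P.i * bN M S t P.s : ℕ) : ZMod (2 ^ M)) := ⟨_, rfl⟩
  obtain ⟨A, hA⟩ : ∃ A, A = ((√(bN M S t P.s : ℝ) / 2 ^ M : ℝ) : ℂ) := ⟨_, rfl⟩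
  obtain ⟨Z, hZ⟩ : ∃ Z : ℕ, Z + q * n = P.j * WN S t P.s + 63 * n :=
    ⟨P.j * WN S t P.s + 63 * n - q * n, by
      have : q * n ≤ 63 * n := Nat.mul_le_mul_right _ (by omega)
      omega⟩
  have hZ' : (((P.j * WN S t P.s + 63 * WN S t (P.s + 1) : ℤ) - q * WN S t (P.s + 1) : ℤ) : ZMod (2 ^ M)) = (Z : ZMod (2 ^ M)) := by
    have : ((P.j * WN S t P.s + 63 * WN S t (P.s + 1) : ℤ) - q * WN S t (P.s + 1) : ℤ) = (Z : ℤ) := by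
      rw [← hn]; zify at hZ; linarith
    rw [this]; simp
  refine ⟨fun ξ => A * mm B n (Z - ξ) * ee (-((ξ : ZMod (2 ^ M)) * c)), fun x => ?_⟩
  have e1 : (B + 5) * n ≤ 32 * n - q * n := by
    have : (B + 5) * n + q * n ≤ 32 * n := by rw [← add_mul]; exact Nat.mul_le_mul_right _ (by omega)
    omega
  have e2 : 3 * n ≤ q * n := Nat.mul_le_mul_right _ h1
  have e3 : (P.j + 1) * WN S t P.s = P.j * WN S t P.s + 64 * n := by rw [← hW]; ring
  unfold pk
  rw [if_pos hc, hZ', ← hcc, ← hA, ← hn, (Rep_FF B n).2, mul_sum, sum_mul]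
  apply sum_of_injOn (fun k => Z - k)
  · intro x hx y hy hxy
    simp at hx hy hxy
    omega
  · intro k hk
    simp only [coe_range, Set.mem_Iio] at hk
    simp only [spc, coe_filter, mem_range, Set.mem_setOf_eq, ← hn]
    omega
  · intro ξ hξ hξ2
    simp only [spc, mem_filter, mem_range, ← hn] at hξ
    have : mm B n (Z - ξ) = 0 := by
      by_contra h
      have := (Rep_FF (L := 2 ^ M) B n).1 _ h
      apply hξ2
      refine ⟨Z - ξ, ?_, ?_⟩
      · simp only [coe_range, Set.mem_Iio]; omega
      · show Z - (Z - ξ) = ξ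
        omega
    beta_reduce
    rw [this]; simp
  · intro k hk
    beta_reduce
    have hk := mem_range.1 hk
    have hkZ : k ≤ Z := by omega
    have e4 : ((Z : ℤ) - ((Z - k : ℕ) : ℤ)) = k := by push_cast [hkZ]; ring
    rw [e4]
    have e5 : ((Z - k : ℕ) : ZMod (2 ^ M)) = Z - k := by push_cast [hkZ]; ring
    rw [e5]
    have e6 : ee (-((k : ZMod (2 ^ M)) * (x - c))) * ee ((Z : ZMod (2 ^ M)) * (x - c)) =
        ee (-(((Z : ZMod (2 ^ M)) - (k : ZMod (2 ^ M))) * c)) * ee (((Z : ZMod (2 ^ M)) - (k : ZMod (2 ^ M))) * x) := by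
      rw [← ee_add, ← ee_add]; congr 1; ring
    calc _ = A * mm B n k * (ee (-((k : ZMod (2 ^ M)) * (x - c))) * ee ((Z : ZMod (2 ^ M)) * (x - c))) := by ring
      _ = _ := by rw [e6]; ring

lemma cast_inj_lt {L a b : ℕ} (ha : a < L) (hb : b < L) (h : (a : ZMod L) = b) : a = b := by
  rw [ZMod.natCast_eq_natCast_iff', Nat.mod_eq_of_lt ha, Nat.mod_eq_of_lt hb] at h
  exact h

lemma spc_fb {P : Tile} (hs : P.s < S) {ξ : ℕ} (h : ξ ∈ spc M S t P) :
    ξ / WN S t P.s = P.j ∧ ξ / WN S t (P.s + 1) % 64 ≠ 63 := by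
  simp only [spc, mem_filter] at h
  obtain ⟨_, h1, h2⟩ := h
  have n0 := WN_pos S t (P.s + 1)
  rw [WN_succ hs] at h1 h2 ⊢
  generalize WN S t (P.s + 1) = n at *
  have h3 : (64 * P.j) * n ≤ ξ := by nlinarith
  have h4 : ξ < (64 * P.j + 61) * n := by nlinarith
  have h5 : 64 * P.j ≤ ξ / n := (Nat.le_div_iff_mul_le n0).2 h3
  have h6 : ξ / n < 64 * P.j + 61 := (Nat.div_lt_iff_lt_mul n0).2 h4
  rw [mul_comm 64 n, ← Nat.div_div_eq_div_mul]
  omega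

lemma pk_orth {B q : ℕ} (h1 : 3 ≤ q) (h2 : q + B + 5 ≤ 32) {P P' : Tile} (hs : P.s < S) (hs' : P'.s < S)
    (h : ∑ x, pk M S t B q P x * starRingEnd ℂ (pk M S t B q P' x) ≠ 0) :
    ∃ ξ, ξ ∈ spc M S t P ∧ ξ ∈ spc M S t P' := by
  obtain ⟨c, hc⟩ := pk_spec (M := M) (t := t) h1 h2 hs
  obtain ⟨c', hc'⟩ := pk_spec (M := M) (t := t) h1 h2 hs'
  by_contra hno
  push Not at hno
  apply h
  have : ∀ x, pk M S t B q P x * starRingEnd ℂ (pk M S t B q P' x) =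
      ∑ ξ ∈ spc M S t P, ∑ η ∈ spc M S t P', c ξ * starRingEnd ℂ (c' η) * ee (((ξ : ZMod (2 ^ M)) - (η : ZMod (2 ^ M))) * x) := by
    intro x
    rw [hc, hc', map_sum, sum_mul_sum]
    apply sum_congr rfl; intro ξ _
    apply sum_congr rfl; intro η _
    rw [map_mul, ee_conj, sub_mul, sub_eq_add_neg, ee_add]; ring
  simp only [this]
  rw [sum_comm]
  apply sum_eq_zero; intro ξ hξ
  rw [sum_comm]
  apply sum_eq_zero; intro η hη
  rw [← mul_sum, ee_sum, if_neg, mul_zero]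
  intro h0
  have : ξ = η := cast_inj_lt (mem_range.1 (mem_filter.1 hξ).1) (mem_range.1 (mem_filter.1 hη).1) (sub_eq_zero.1 h0)
  subst this
  exact hno ξ hξ hη

lemma pk_bd {B q : ℕ} (hB : 1 ≤ B) (hB' : B ≤ 11) (hM : t + 6 * S + 6 ≤ M) {P : Tile} (hs : P.s < S)
    (x : ZMod (2 ^ M)) :
    ‖pk M S t B q P x‖ ≤ 2 ^ 40 / √(bN M S t P.s : ℝ) *
      (1 + (nz (x - ((P.i * bN M S t P.s : ℕ) : ZMod (2 ^ M))) : ℝ) / bN M S t P.s)⁻¹ ^ 6 := by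
  have hb0 : (0:ℝ) < bN M S t P.s := by exact_mod_cast bN_pos M S t P.s
  obtain ⟨y, hy⟩ : ∃ y, y = x - ((P.i * bN M S t P.s : ℕ) : ZMod (2 ^ M)) := ⟨_, rfl⟩
  rw [← hy]
  by_cases hc : (P.j + 1) * WN S t P.s ≤ 2 ^ M
  swap
  · simp only [pk, hc, if_false, norm_zero]; positivity
  obtain ⟨n, hn⟩ : ∃ n, n = WN S t (P.s + 1) := ⟨_, rfl⟩
  have hW : WN S t P.s = 64 * n := by rw [hn, WN_succ hs]
  have n0 : 0 < n := hn ▸ WN_pos _ _ _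
  have n0' : (0:ℝ) < n := by exact_mod_cast n0
  have hbW := bN_WN hM hs.le
  rw [hW] at hbW
  obtain ⟨b, hb⟩ : ∃ b : ℝ, b = bN M S t P.s := ⟨_, rfl⟩
  rw [← hb] at hb0 ⊢
  have hL : ((2 ^ M : ℕ) : ℝ) = b * (64 * n) := by rw [hb]; exact_mod_cast hbW.symm
  obtain ⟨w, hw⟩ : ∃ w, w = (1 + (nz y : ℝ) / b)⁻¹ := ⟨_, rfl⟩
  have w0 : 0 ≤ w := by rw [hw]; positivity
  have d1 : ‖DD n y‖ ≤ n * 33 * w := by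
    have := DD_wt n y (b := b) (c := 32) hb0 (by rw [hL]; linarith)
    rw [← hw] at this; norm_num at this ⊢; exact this
  have d2 : ‖DD (B * n) y‖ ≤ n * 363 * w := by
    have hBr : (1:ℝ) ≤ B := by exact_mod_cast hB
    have hBr' : (B:ℝ) ≤ 11 := by exact_mod_cast hB'
    have := DD_wt (B * n) y (b := b) (c := 32) hb0 (by
      rw [hL]; push_cast
      have : 0 < b * n := by positivity
      nlinarith)
    rw [← hw] at this; push_cast at this
    refine this.trans ?_
    have : 0 ≤ n * w := by positivity
    nlinarith
  have hF : ‖FF B n y‖ ≤ n * (33 ^ 5 * 363) * w ^ 6 := by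
    unfold FF
    rw [norm_mul, norm_pow, norm_inv, Complex.norm_natCast]
    simp only [norm_mul]
    calc _ ≤ ((n:ℝ)⁻¹) ^ 5 * ((n * 33 * w) * ((n * 33 * w) * ((n * 33 * w) * ((n * 33 * w) * ((n * 33 * w) * (n * 363 * w)))))) := by
          gcongr
      _ = _ := by field_simp
  have e1 : ‖pk M S t B q P x‖ = √b / 2 ^ M * ‖FF B n y‖ := by
    unfold pk
    rw [if_pos hc, ← hy, ← hn, ← hb, norm_mul, norm_mul, ee_norm, mul_one, Complex.norm_real, Real.norm_of_nonneg (by positivity)]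
  have hL2 : (2:ℝ) ^ M = b * (64 * n) := by rw [← hL]; push_cast; rfl
  rw [e1, ← hw, hL2]
  have sb : √b * √b = b := Real.mul_self_sqrt hb0.le
  have sb0 : 0 < √b := Real.sqrt_pos.2 hb0
  calc _ ≤ √b / (b * (64 * n)) * (n * (33 ^ 5 * 363) * w ^ 6) := by gcongr
    _ = (33 ^ 5 * 363 / 64) / √b * w ^ 6 := by
        field_simp
        rw [sq, sb]
    _ ≤ _ := by
        gcongr; norm_num

lemma pk_packet {B q : ℕ} (hM : t + 6 * S + 6 ≤ M) (hB : 1 ≤ B) (hB' : B ≤ 11) (h1 : 3 ≤ q) (h2 : q + B + 5 ≤ 32) :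
    (CG M S t hM).Packet (pk M S t B q) := by
  constructor
  · intro P hP x
    exact pk_bd hB hB' hM hP.1 x
  · intro P P' hP hP' hss h
    obtain ⟨ξ, hx, hx'⟩ := pk_orth h1 h2 hP.1 hP'.1 h
    exact ⟨ξ, (spc_fb hP.1 hx).1, (spc_fb hP'.1 hx').1, fun hu => (spc_fb hP.1 hx).2 hu.2⟩

end
end CT

end

section
namespace CT
open Finset
open scoped Classical

section
variable {L : ℕ} [NeZero L]

/-- low pass kernel -/
noncomputable def KK (k W : ℕ) (y : ZMod L) : ℂ :=
  ((L : ℂ)⁻¹ * (W : ℂ)⁻¹) * (DD (2 * W) (-y) * DD W y * ee (((k * W : ℕ) : ZMod L) * y))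

lemma KK_eq (k W : ℕ) (y : ZMod L) : KK k W y = ((L : ℂ)⁻¹ * (W : ℂ)⁻¹) *
    ∑ u ∈ range (2 * W), ∑ v ∈ range W, ee ((((k * W + u : ℤ) - v : ℤ) : ZMod L) * y) := by
  unfold KK DD
  rw [sum_mul_sum, sum_mul]
  congr 1
  apply sum_congr rfl; intro u _
  rw [sum_mul]
  apply sum_congr rfl; intro v _
  rw [← ee_add, ← ee_add]
  congr 1; push_cast; ring

lemma KK_bd {k W : ℕ} (hW : 0 < W) {b : ℝ} (hb : 0 < b) (hL : (L:ℝ) = b * W) (y : ZMod L) :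
    ‖KK k W y‖ ≤ 18 / b * (1 + (nz y : ℝ) / b)⁻¹ ^ 2 := by
  have W0 : (0:ℝ) < W := by exact_mod_cast hW
  have h1 := DD_wt (2 * W) (-y) (b := b) (c := 2) hb (by rw [hL]; push_cast; nlinarith [mul_pos hb W0])
  have h2 := DD_wt W y (b := b) (c := 2) hb (by rw [hL]; nlinarith [mul_pos hb W0])
  rw [nz_neg] at h1
  generalize (1 + (nz y : ℝ) / b)⁻¹ = w at *
  unfold KK
  simp only [norm_mul, norm_inv, Complex.norm_natCast, ee_norm, mul_one]
  calc _ ≤ ((L:ℝ)⁻¹ * (W:ℝ)⁻¹) * ((((2 * W : ℕ) : ℝ) * (1 + 2) * w) * (W * (1 + 2) * w)) := by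
        gcongr
        exact (norm_nonneg _).trans h1
    _ = _ := by rw [hL]; push_cast; field_simp; ring

/-- the action of the kernel on a character -/
lemma KK_act (k W : ℕ) (ξ : ℕ) (x : ZMod L) :
    ∑ y : ZMod L, KK k W (x - y) * ee ((ξ : ZMod L) * y) =
      ((W : ℂ)⁻¹ * ∑ u ∈ range (2 * W), ∑ v ∈ range W,
        if ((((k * W + u : ℤ) - v - ξ : ℤ)) : ZMod L) = 0 then (1:ℂ) else 0) * ee ((ξ : ZMod L) * x) := by
  have L0 : (L:ℂ) ≠ 0 := by exact_mod_cast NeZero.ne L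
  have h1 : ∀ y : ZMod L, KK k W (x - y) * ee ((ξ : ZMod L) * y) = ((L : ℂ)⁻¹ * (W : ℂ)⁻¹) *
      ∑ u ∈ range (2 * W), ∑ v ∈ range W, ee ((((k * W + u : ℤ) - v : ℤ) : ZMod L) * x) *
        ee (-((((k * W + u : ℤ) - v - ξ : ℤ)) : ZMod L) * y) := by
    intro y
    rw [KK_eq, mul_assoc, sum_mul]
    congr 1
    apply sum_congr rfl; intro u _
    rw [sum_mul]
    apply sum_congr rfl; intro v _
    rw [← ee_add, ← ee_add]
    congr 1; push_cast; ring
  simp only [h1]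
  rw [← mul_sum, sum_comm]
  have h2 : ∀ u ∈ range (2 * W), ∑ y : ZMod L, ∑ v ∈ range W, ee ((((k * W + u : ℤ) - v : ℤ) : ZMod L) * x) *
        ee (-((((k * W + u : ℤ) - v - ξ : ℤ)) : ZMod L) * y) =
      (∑ v ∈ range W, if ((((k * W + u : ℤ) - v - ξ : ℤ)) : ZMod L) = 0 then (1:ℂ) else 0) * (L * ee ((ξ : ZMod L) * x)) := by
    intro u _
    rw [sum_comm, sum_mul]
    apply sum_congr rfl; intro v _
    rw [← mul_sum, ee_sum]
    by_cases h : ((((k * W + u : ℤ) - v - ξ : ℤ)) : ZMod L) = 0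
    · rw [if_pos h, if_pos (by rw [h, neg_zero])]
      have : (((k * W + u : ℤ) - v : ℤ) : ZMod L) = (ξ : ZMod L) := by
        have h' := h
        push_cast at h' ⊢
        exact sub_eq_zero.1 h'
      rw [this]; ring
    · rw [if_neg h, if_neg (by rw [neg_eq_zero]; exact h)]; ring
  rw [sum_congr rfl h2, ← sum_mul]
  field_simp

lemma zcast_zero_small {a : ℤ} (h1 : -(L:ℤ) < a) (h2 : a < L) : ((a : ZMod L) = 0) ↔ a = 0 := by
  constructor
  · intro h
    rw [ZMod.intCast_zmod_eq_zero_iff_dvd] at h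
    exact Int.eq_zero_of_abs_lt_dvd h (abs_lt.2 ⟨h1, h2⟩)
  · rintro rfl; simp

lemma KK_one {k W : ℕ} (hW : 0 < W) (hL : 2 * W ≤ L) {ξ : ℕ} (h1 : k * W ≤ ξ) (h2 : ξ < k * W + W) (x : ZMod L) :
    ∑ y : ZMod L, KK k W (x - y) * ee ((ξ : ZMod L) * y) = ee ((ξ : ZMod L) * x) := by
  have W0 : (W:ℂ) ≠ 0 := by exact_mod_cast hW.ne'
  rw [KK_act, sum_comm]
  have : ∀ v ∈ range W, ∑ u ∈ range (2 * W), (if ((((k * W + u : ℤ) - v - ξ : ℤ)) : ZMod L) = 0 then (1:ℂ) else 0) = 1 := by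
    intro v hv
    have hv := mem_range.1 hv
    rw [sum_eq_single (ξ - k * W + v)]
    · rw [if_pos]
      have : (k * W + ((ξ - k * W + v : ℕ) : ℤ) - v - ξ : ℤ) = 0 := by
        push_cast [h1]; ring
      rw [this]; simp
    · intro u hu hne
      have hu := mem_range.1 hu
      rw [if_neg]
      rw [zcast_zero_small]
      · zify [h1] at hne ⊢
        intro h
        apply hne
        linarith
      · zify at *; linarith
      · zify at *; linarith
    · intro h; exfalso; apply h; rw [mem_range]; omega
  rw [sum_congr rfl this]
  simp [W0]

lemma KK_zero {k W : ℕ} {ξ : ℕ} (h1 : ξ + W ≤ k * W) (h2 : k * W + 2 * W ≤ ξ + L) (x : ZMod L) :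
    ∑ y : ZMod L, KK k W (x - y) * ee ((ξ : ZMod L) * y) = 0 := by
  rw [KK_act]
  have : ∀ u ∈ range (2 * W), ∑ v ∈ range W, (if ((((k * W + u : ℤ) - v - ξ : ℤ)) : ZMod L) = 0 then (1:ℂ) else 0) = 0 := by
    intro u hu
    apply sum_eq_zero
    intro v hv
    have hv := mem_range.1 hv
    have hu := mem_range.1 hu
    rw [if_neg]
    rw [zcast_zero_small]
    · zify at *; intro h; linarith
    · zify at *; linarith
    · zify at *; linarith
  rw [sum_congr rfl this]
  simp

end

section
variable {M S t : ℕ}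

lemma pk_zero_of {B q : ℕ} {P : Tile} (h : ¬ (P.j + 1) * WN S t P.s ≤ 2 ^ M) (x : ZMod (2 ^ M)) : pk M S t B q P x = 0 := by
  simp [pk, h]

lemma WN_le {S t s s' : ℕ} (h : s ≤ s') : WN S t s' ≤ WN S t s := Nat.le_of_dvd (WN_pos _ _ _) (WN_dvd h)

lemma WN_L (hM : t + 6 * S + 6 ≤ M) (s : ℕ) : 64 * WN S t s ≤ 2 ^ M := by
  have : 64 * WN S t s = 2 ^ (6 + (t + 6 * (S - s))) := by unfold WN; rw [pow_add 2 6]; norm_num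
  rw [this]
  apply Nat.pow_le_pow_right (by norm_num); omega

lemma pk_lowpass {B q : ℕ} (hM : t + 6 * S + 6 ≤ M) (h1 : 3 ≤ q) (h2 : q + B + 5 ≤ 32) :
    (CG M S t hM).LowPass (pk M S t B q) := by
  intro s hs ξ0
  change s ≤ S at hs
  obtain ⟨W, hW⟩ : ∃ W, W = WN S t s := ⟨_, rfl⟩
  have W0 : 0 < W := hW ▸ WN_pos _ _ _
  obtain ⟨k, hk⟩ : ∃ k, k = ξ0 / W := ⟨_, rfl⟩
  have hk1 : k * W ≤ ξ0 := by rw [hk]; exact Nat.div_mul_le_self _ _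
  have hk2 : ξ0 < k * W + W := by rw [hk]; have := Nat.lt_div_mul_add (a := ξ0) W0; linarith
  have hWL := WN_L hM s
  rw [← hW] at hWL
  refine ⟨fun x y => KK k W (x - y), ?_, ?_⟩
  · intro x y
    have hbW := bN_WN hM hs
    have := KK_bd (L := 2 ^ M) (k := k) W0 (b := (bN M S t s : ℝ)) (by exact_mod_cast bN_pos M S t s)
      (by rw [hW, ← hbW]; push_cast; rfl) (x - y)
    refine this.trans ?_
    show _ ≤ (2:ℝ) ^ 40 / (bN M S t s : ℝ) * (1 + (nz (x - y) : ℝ) / (bN M S t s : ℝ))⁻¹ ^ 2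
    gcongr
    norm_num
  · intro P hP hfb
    have hPs : P.s < S := hP.1
    change ξ0 / WN S t P.s = P.j at hfb
    obtain ⟨c, hc⟩ := pk_spec (M := M) (t := t) h1 h2 hPs
    obtain ⟨n, hn⟩ : ∃ n, n = WN S t (P.s + 1) := ⟨_, rfl⟩
    have hW' : WN S t P.s = 64 * n := by rw [hn, WN_succ hPs]
    have n0 : 0 < n := hn ▸ WN_pos _ _ _
    have key : ∀ r : ℂ, (∀ ξ ∈ spc M S t P, ∀ x : ZMod (2 ^ M),
        ∑ y : ZMod (2 ^ M), KK k W (x - y) * ee ((ξ : ZMod (2 ^ M)) * y) = r * ee ((ξ : ZMod (2 ^ M)) * x)) →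
        ∀ x, ∑ y, KK k W (x - y) * pk M S t B q P y = r * pk M S t B q P x := by
      intro r hr x
      simp only [hc, mul_sum]
      rw [sum_comm]
      apply sum_congr rfl; intro ξ hξ
      have := hr ξ hξ x
      calc _ = c ξ * ∑ y : ZMod (2 ^ M), KK k W (x - y) * ee ((ξ : ZMod (2 ^ M)) * y) := by
            rw [mul_sum]; exact sum_congr rfl fun y _ => by ring
        _ = _ := by rw [this]; ring
    refine ⟨fun hss x => ?_, fun hss hup x => ?_⟩
    · have := key 1 (fun ξ hξ x => ?_) x
      · rw [one_mul] at this; exact this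
      rw [one_mul]
      have e := (spc_fb hPs hξ).1
      have : ξ / W = k := by
        rw [hk, hW]; exact div_eq_of_dvd (WN_dvd hss) (e.trans hfb.symm)
      apply KK_one W0 (by omega)
      · rw [← this]; exact Nat.div_mul_le_self _ _
      · have h3 := Nat.lt_div_mul_add (a := ξ) W0; rw [this] at h3; exact h3
    · have := key 0 (fun ξ hξ x => ?_) x
      · rw [zero_mul] at this; exact this
      rw [zero_mul]
      have hWn : W ≤ n := by rw [hW, hn]; exact WN_le hss
      obtain ⟨hx0, hx1, hx2⟩ := by simpa only [spc, mem_filter, mem_range, ← hn] using hξ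
      have hL2 := WN_L hM P.s
      rw [hW'] at hfb hx1 hx2 hL2
      have hup2 : ξ0 / n % 64 = 63 := by rw [hn]; exact hup.2
      rw [mul_comm 64 n, ← Nat.div_div_eq_div_mul] at hfb
      have hq : ξ0 / n = 64 * P.j + 63 := by omega
      have f1 := Nat.div_mul_le_self ξ0 n
      have f2 := Nat.lt_div_mul_add (a := ξ0) n0
      rw [hq] at f1 f2
      have f3 : (64 * P.j + 63) * n = P.j * (64 * n) + 63 * n := by ring
      rw [f3] at f1 f2
      apply KK_zero
      · omega
      · omega
end
end CT

end

section
namespace CT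
open Finset
open scoped Classical

lemma AA_conj {n : ℕ} {g : ℤ → ℂ} (h : ∀ u, starRingEnd ℂ (g u) = g u) : ∀ u, starRingEnd ℂ (AA n g u) = AA n g u := by
  intro u; unfold AA; rw [map_sum]; exact sum_congr rfl fun v _ => h _

lemma mm_conj (B n : ℕ) (u : ℤ) : starRingEnd ℂ (mm B n u) = mm B n u := by
  unfold mm
  have h0 : ∀ u, starRingEnd ℂ (dl u) = dl u := by intro u; unfold dl; split_ifs <;> simp
  rw [map_mul, AA_conj (AA_conj (AA_conj (AA_conj (AA_conj (AA_conj h0)))))]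
  simp

section
variable {L : ℕ} [NeZero L]

lemma sum_ee_block {W b : ℕ} (hbW : b * W = L) (a : ℤ) (h1 : -(W:ℤ) < a) (h2 : a < W) :
    ∑ i ∈ range W, ee ((a : ZMod L) * ((i * b : ℕ) : ZMod L)) = if a = 0 then (W:ℂ) else 0 := by
  split_ifs with h
  · subst h; simp [ee_zero]
  · have e1 : ∀ i ∈ range W, ee ((a : ZMod L) * ((i * b : ℕ) : ZMod L)) = ee ((a : ZMod L) * (b : ZMod L)) ^ i := by
      intro i _
      rw [← ee_natmul]; congr 1; push_cast; ring
    rw [sum_congr rfl e1]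
    have hz : ee ((a : ZMod L) * (b : ZMod L)) ^ W = 1 := by
      rw [← ee_natmul]
      have : (W : ZMod L) * ((a : ZMod L) * (b : ZMod L)) = 0 := by
        have : ((b * W : ℕ) : ZMod L) = 0 := by rw [hbW]; simp
        push_cast at this
        linear_combination (a : ZMod L) * this
      rw [this, ee_zero]
    have hne : ee ((a : ZMod L) * (b : ZMod L)) ≠ 1 := by
      intro h1'
      rw [← ee_zero (L := L)] at h1'
      have := ZMod.injective_stdAddChar h1'
      have h3 : (((a * b : ℤ)) : ZMod L) = 0 := by push_cast; exact this
      rw [ZMod.intCast_zmod_eq_zero_iff_dvd, ← hbW] at h3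
      push_cast at h3
      have hb : (b:ℤ) ≠ 0 := by
        intro hb; have : b = 0 := by exact_mod_cast hb
        apply NeZero.ne L; rw [← hbW, this, zero_mul]
      rw [mul_comm a] at h3
      have h4 := (mul_dvd_mul_iff_left hb).1 h3
      exact h (Int.eq_zero_of_abs_lt_dvd h4 (abs_lt.2 ⟨h1, h2⟩))
    have := geom_sum_mul (ee ((a : ZMod L) * (b : ZMod L))) W
    rw [hz, sub_self] at this
    exact (mul_eq_zero.1 this).resolve_right (sub_ne_zero.2 hne)

end

section
variable {M S t : ℕ}

/-- first half : coefficients of a character -/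
lemma coef_char {q : ℕ} (h1 : 3 ≤ q) (h2 : q ≤ 26) (hM : t + 6 * S + 6 ≤ M) {P : Tile} (hs : P.s < S)
    (hc : (P.j + 1) * WN S t P.s ≤ 2 ^ M) {Z : ℕ}
    (hZ : Z + q * WN S t (P.s + 1) = P.j * WN S t P.s + 63 * WN S t (P.s + 1)) {k : ℕ} (hk : k < 2 ^ M) :
    ∑ y, ee ((k : ZMod (2 ^ M)) * y) * starRingEnd ℂ (pk M S t 1 q P y) =
      ((√(bN M S t P.s : ℝ) : ℝ) : ℂ) * ee ((k : ZMod (2 ^ M)) * ((P.i * bN M S t P.s : ℕ) : ZMod (2 ^ M))) *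
        mm 1 (WN S t (P.s + 1)) (Z - k) := by
  have hW0 := WN_succ (t := t) hs
  obtain ⟨n, hn⟩ : ∃ n, n = WN S t (P.s + 1) := ⟨_, rfl⟩
  have n0 : 0 < n := hn ▸ WN_pos _ _ _
  rw [← hn] at hZ hW0 ⊢
  have hZ' : (((P.j * WN S t P.s + 63 * WN S t (P.s + 1) : ℤ) - q * WN S t (P.s + 1) : ℤ) : ZMod (2 ^ M)) = (Z : ZMod (2 ^ M)) := by
    have : ((P.j * WN S t P.s + 63 * WN S t (P.s + 1) : ℤ) - q * WN S t (P.s + 1) : ℤ) = (Z : ℤ) := by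
      rw [← hn]; zify at hZ; linarith
    rw [this]; simp
  obtain ⟨c, hcc⟩ : ∃ c, c = ((P.i * bN M S t P.s : ℕ) : ZMod (2 ^ M)) := ⟨_, rfl⟩
  rw [← hcc]
  have L0 : ((2:ℂ) ^ M) ≠ 0 := pow_ne_zero _ two_ne_zero
  have e3 : (P.j + 1) * WN S t P.s = P.j * WN S t P.s + 64 * n := by rw [← hW0]; ring
  have e2 : 3 * n ≤ q * n := Nat.mul_le_mul_right _ h1
  have e2' : q * n ≤ 26 * n := Nat.mul_le_mul_right _ h2
  have hpk : ∀ y, ee ((k : ZMod (2 ^ M)) * y) * starRingEnd ℂ (pk M S t 1 q P y) =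
      ∑ v ∈ range (6 * n), ((√(bN M S t P.s : ℝ) : ℝ) : ℂ) / 2 ^ M * mm 1 n v * ee ((k : ZMod (2 ^ M)) * c) *
        ee ((((k:ℤ) - Z + v : ℤ) : ZMod (2 ^ M)) * (y - c)) := by
    intro y
    unfold pk
    rw [if_pos hc, hZ', ← hcc, ← hn, (Rep_FF 1 n).2]
    simp only [map_mul, map_sum, mul_sum, sum_mul, ee_conj, mm_conj]
    apply sum_congr (by ring_nf)
    intro v _
    rw [Complex.conj_ofReal]
    have e6 : ee ((k : ZMod (2 ^ M)) * y) * ee (-(-((v : ZMod (2 ^ M)) * (y - c)))) * ee (-((Z : ZMod (2 ^ M)) * (y - c))) =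
        ee ((k : ZMod (2 ^ M)) * c) * ee ((((k:ℤ) - Z + v : ℤ) : ZMod (2 ^ M)) * (y - c)) := by
      simp only [← ee_add]; congr 1; push_cast; ring
    push_cast
    push_cast at e6
    linear_combination (((√(bN M S t P.s : ℝ) : ℝ) : ℂ) / 2 ^ M * mm 1 n v) * e6
  simp only [hpk]
  rw [sum_comm]
  have hin : ∀ v ∈ range (6 * n), ∑ y : ZMod (2 ^ M), ((√(bN M S t P.s : ℝ) : ℝ) : ℂ) / 2 ^ M * mm 1 n v * ee ((k : ZMod (2 ^ M)) * c) *
        ee ((((k:ℤ) - Z + v : ℤ) : ZMod (2 ^ M)) * (y - c)) =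
      if (v:ℤ) = Z - k then ((√(bN M S t P.s : ℝ) : ℝ) : ℂ) * ee ((k : ZMod (2 ^ M)) * c) * mm 1 n (Z - k) else 0 := by
    intro v hv
    have hv := mem_range.1 hv
    rw [← mul_sum]
    have : ∑ y : ZMod (2 ^ M), ee ((((k:ℤ) - Z + v : ℤ) : ZMod (2 ^ M)) * (y - c)) =
        ∑ y : ZMod (2 ^ M), ee ((((k:ℤ) - Z + v : ℤ) : ZMod (2 ^ M)) * y) :=
      Equiv.sum_comp (Equiv.subRight c) (fun y : ZMod (2 ^ M) => ee ((((k:ℤ) - Z + v : ℤ) : ZMod (2 ^ M)) * y))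
    rw [this, ee_sum]
    have hiff : (((k:ℤ) - Z + v : ℤ) : ZMod (2 ^ M)) = 0 ↔ (v:ℤ) = Z - k := by
      rw [zcast_zero_small (by omega) (by omega)]; constructor <;> intro h <;> linarith
    by_cases h : (v:ℤ) = Z - k
    · rw [if_pos (hiff.2 h), if_pos h, ← h]; push_cast; field_simp
    · rw [if_neg (fun h' => h (hiff.1 h')), if_neg h, mul_zero]
  rw [sum_congr rfl hin]
  by_cases hz : mm 1 n (Z - k) = 0
  · rw [hz]; simp
  · have hr := (Rep_FF (L := 2 ^ M) 1 n).1 _ hz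
    rw [sum_eq_single ((Z - k : ℤ).toNat)]
    · rw [if_pos]; omega
    · intro v _ hv; rw [if_neg]; omega
    · intro h; exfalso; apply h; rw [mem_range]; omega

lemma repro_char {q : ℕ} (h1 : 8 ≤ q) (h2 : q ≤ 21) (hM : t + 6 * S + 6 ≤ M) {s j : ℕ} (hs : s < S)
    (hc : (j + 1) * WN S t s ≤ 2 ^ M) {Z : ℕ}
    (hZ : Z + q * WN S t (s + 1) = j * WN S t s + 63 * WN S t (s + 1)) {k : ℕ} (hk : k < 2 ^ M) (x : ZMod (2 ^ M)) :
    ∑ i ∈ range (WN S t s), (∑ y, ee ((k : ZMod (2 ^ M)) * y) * starRingEnd ℂ (pk M S t 1 q ⟨s, i, j⟩ y)) *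
      pk M S t 11 (q - 5) ⟨s, i, j⟩ x = mm 1 (WN S t (s + 1)) (Z - k) * ee ((k : ZMod (2 ^ M)) * x) := by
  have step : ∀ i, (∑ y, ee ((k : ZMod (2 ^ M)) * y) * starRingEnd ℂ (pk M S t 1 q ⟨s, i, j⟩ y)) = _ :=
    fun i => coef_char (P := ⟨s, i, j⟩) (by omega) (by omega) hM hs hc hZ hk
  simp only [step]
  have hW0 := WN_succ (t := t) hs
  have hbW := bN_WN hM hs.le
  have W0 := WN_pos S t s
  obtain ⟨n, hn⟩ : ∃ n, n = WN S t (s + 1) := ⟨_, rfl⟩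
  have n0 : 0 < n := hn ▸ WN_pos _ _ _
  by_cases hz : mm 1 (WN S t (s + 1)) (Z - k) = 0
  · simp [hz]
  rw [← hn] at hZ hW0 hz ⊢
  have hr := (Rep_FF (L := 2 ^ M) 1 n).1 _ hz
  have hZ' : (((j * WN S t s + 63 * WN S t (s + 1) : ℤ) - (q - 5 : ℕ) * WN S t (s + 1) : ℤ) : ZMod (2 ^ M)) = ((Z + 5 * n : ℤ) : ZMod (2 ^ M)) := by
    have : ((j * WN S t s + 63 * WN S t (s + 1) : ℤ) - (q - 5 : ℕ) * WN S t (s + 1) : ℤ) = (Z + 5 * n : ℤ) := by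
      rw [← hn]; zify at hZ; push_cast [(by omega : 5 ≤ q)]; linarith
    rw [this]
  obtain ⟨w0, hw0⟩ : ∃ w0 : ℕ, (w0 : ℤ) = 5 * n + (Z - k) := ⟨(5 * n + (Z - k) : ℤ).toNat, by omega⟩
  obtain ⟨b, hb⟩ : ∃ b, b = bN M S t s := ⟨_, rfl⟩
  obtain ⟨m, hm⟩ : ∃ m, m = mm 1 n (Z - k) := ⟨_, rfl⟩
  rw [← hb] at hbW ⊢
  rw [← hm]
  have b0 : 0 < b := hb ▸ bN_pos _ _ _ _
  have sb : ((√(b:ℝ) : ℝ) : ℂ) * ((√(b:ℝ) : ℝ) : ℂ) = b := by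
    rw [← Complex.ofReal_mul, Real.mul_self_sqrt (by positivity)]; simp
  have hterm : ∀ i ∈ range (WN S t s), ((√(b:ℝ) : ℝ) : ℂ) * ee ((k : ZMod (2 ^ M)) * ((i * b : ℕ) : ZMod (2 ^ M))) * m *
      pk M S t 11 (q - 5) ⟨s, i, j⟩ x = ∑ w ∈ range (16 * n), (b:ℂ) / 2 ^ M * m * mm 11 n w *
        ee (((Z + 5 * n - w : ℤ) : ZMod (2 ^ M)) * x) *
        ee (((w - w0 : ℤ) : ZMod (2 ^ M)) * ((i * b : ℕ) : ZMod (2 ^ M))) := by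
    intro i _
    unfold pk
    simp only
    rw [if_pos hc, hZ', ← hb, ← hn, (Rep_FF 11 n).2]
    simp only [mul_sum, sum_mul]
    apply sum_congr (by norm_num)
    intro w _
    generalize ((i * b : ℕ) : ZMod (2 ^ M)) = c
    have e0 : ((w - w0 : ℤ) : ZMod (2 ^ M)) = (k : ZMod (2 ^ M)) - (Z + 5 * n - w) := by rw [hw0]; push_cast; ring
    have e6 : ee ((k : ZMod (2 ^ M)) * c) * ee (-((w : ZMod (2 ^ M)) * (x - c))) * ee (((Z + 5 * n : ℤ) : ZMod (2 ^ M)) * (x - c)) =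
        ee (((Z + 5 * n - w : ℤ) : ZMod (2 ^ M)) * x) * ee (((w - w0 : ℤ) : ZMod (2 ^ M)) * c) := by
      rw [e0]; simp only [← ee_add]; congr 1; push_cast; ring
    push_cast at e6 ⊢
    linear_combination (((√(b : ℝ) : ℝ) : ℂ) * m * ((√(b : ℝ) : ℝ) : ℂ) / 2 ^ M * mm 11 n w) * e6 +
      (m / 2 ^ M * mm 11 n w * ee (((Z:ZMod (2 ^ M)) + 5 * (n : ZMod (2 ^ M)) - (w : ZMod (2 ^ M))) * x) * ee (((w:ZMod (2 ^ M)) - (w0 : ZMod (2 ^ M))) * c)) * sb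
  rw [sum_congr rfl hterm, sum_comm]
  have hin : ∀ w ∈ range (16 * n), ∑ i ∈ range (WN S t s), (b:ℂ) / 2 ^ M * m * mm 11 n w *
        ee (((Z + 5 * n - w : ℤ) : ZMod (2 ^ M)) * x) *
        ee (((w - w0 : ℤ) : ZMod (2 ^ M)) * ((i * b : ℕ) : ZMod (2 ^ M))) =
      if w = w0 then m * ee ((k : ZMod (2 ^ M)) * x) else 0 := by
    intro w hw
    have hw := mem_range.1 hw
    rw [← mul_sum, sum_ee_block hbW _ (by omega) (by omega)]
    by_cases h : w = w0
    · rw [if_pos h, if_pos (by omega), h]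
      have e1 : mm 11 n w0 = 1 := mm_one n0 _ (by omega) (by omega)
      have e2 : (Z + 5 * n - w0 : ℤ) = k := by omega
      rw [e1, e2]
      have hbW' : (b:ℂ) * (WN S t s : ℂ) = 2 ^ M := by exact_mod_cast hbW
      have L0 : ((2:ℂ) ^ M) ≠ 0 := pow_ne_zero _ two_ne_zero
      have e7 : (b:ℂ) / 2 ^ M * (WN S t s : ℂ) = 1 := by
        rw [div_mul_eq_mul_div, hbW', div_self L0]
      push_cast
      linear_combination (m * ee ((k : ZMod (2 ^ M)) * x)) * e7
    · rw [if_neg h, if_neg (by omega), mul_zero]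
  rw [sum_congr rfl hin, sum_ite_eq', if_pos]
  rw [mem_range]; omega

end
end CT

end

section
namespace CT
open Finset
open scoped Classical

/-- all tiles -/
noncomputable def QQ (M S t : ℕ) : Finset Tile :=
  ((range S).sigma (fun s => range (2 ^ M) ×ˢ range (WN S t s))).image (fun p => (⟨p.1, p.2.2, p.2.1⟩ : Tile))

lemma sum_QQ (M S t : ℕ) (F : Tile → ℂ) :
    ∑ P ∈ QQ M S t, F P = ∑ s ∈ range S, ∑ j ∈ range (2 ^ M), ∑ i ∈ range (WN S t s), F ⟨s, i, j⟩ := by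
  unfold QQ
  rw [sum_image]
  · rw [sum_sigma]
    apply sum_congr rfl; intro s _
    rw [sum_product]
  · rintro ⟨s, j, i⟩ _ ⟨s', j', i'⟩ _ h
    simp at h
    obtain ⟨rfl, rfl, rfl⟩ := h
    rfl

/-- the shifted multiplier -/
noncomputable def sg (n q N k : ℕ) : ℂ :=
  if N / n % 64 = 63 then mm 1 n (((n * (N / n) : ℕ) : ℤ) - q * n - k) else 0

section
variable {M S t : ℕ}

lemma QQ_valid (hM : t + 6 * S + 6 ≤ M) : ∀ P ∈ QQ M S t, (CG M S t hM).Valid P := by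
  intro P hP
  unfold QQ at hP
  rw [mem_image] at hP
  obtain ⟨⟨s, j, i⟩, h, rfl⟩ := hP
  simp at h
  obtain ⟨hs, hj, hi⟩ := h
  have b0 := bN_pos M S t s
  refine ⟨hs, ?_, j * WN S t s, ?_⟩
  · show (((i * bN M S t s : ℕ) : ZMod (2 ^ M))).val / bN M S t s = i
    rw [ZMod.val_cast_of_lt, Nat.mul_div_cancel _ b0]
    rw [← bN_WN hM hs.le, mul_comm]
    exact Nat.mul_lt_mul_of_pos_left hi b0
  · show j * WN S t s / WN S t s = j
    exact Nat.mul_div_cancel _ (WN_pos _ _ _)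

lemma Tf_eq {q : ℕ} (h1 : 8 ≤ q) (h2 : q ≤ 21) (hM : t + 6 * S + 6 ≤ M) (A : Finset ℕ) (hA : ∀ k ∈ A, k < 2 ^ M)
    (c : ℕ → ℂ) (N : ZMod (2 ^ M) → ℕ) (x : ZMod (2 ^ M)) (hN : N x < 2 ^ M) :
    (CG M S t hM).Tf N (fun P => ∑ y, (∑ k ∈ A, c k * ee ((k : ZMod (2 ^ M)) * y)) * starRingEnd ℂ (pk M S t 1 q P y))
      (pk M S t 11 (q - 5)) (QQ M S t) x =
    ∑ s ∈ range S, ∑ k ∈ A, c k * sg (WN S t (s + 1)) q (N x) k * ee ((k : ZMod (2 ^ M)) * x) := by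
  unfold Geo.Tf
  rw [sum_QQ]
  apply sum_congr rfl
  intro s hs
  have hs := mem_range.1 hs
  have hact : ∀ i j, (CG M S t hM).act N ⟨s, i, j⟩ x ↔ (N x / WN S t s = j ∧ (N x / WN S t (s + 1) % 64 = 63)) := by
    intro i j
    show (N x / WN S t s = j ∧ (s < S ∧ N x / WN S t (s + 1) % 64 = 63)) ↔ _
    tauto
  have W0 := WN_pos S t s
  have hW0 := WN_succ (t := t) hs
  have hbW := bN_WN hM hs.le
  simp only [hact]
  by_cases hu : N x / WN S t (s + 1) % 64 = 63
  swap
  · simp [hu, sg]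
  obtain ⟨j0, hj0⟩ : ∃ j0, j0 = N x / WN S t s := ⟨_, rfl⟩
  have hj : j0 < bN M S t s := by
    rw [hj0, Nat.div_lt_iff_lt_mul W0, hbW]; exact hN
  have hjL : (j0 + 1) * WN S t s ≤ 2 ^ M := by
    rw [← hbW]; exact Nat.mul_le_mul_right _ hj
  have hj2 : j0 ∈ range (2 ^ M) := by
    rw [mem_range]; nlinarith
  rw [sum_eq_single_of_mem j0 hj2]
  swap
  · intro j _ hne
    apply sum_eq_zero; intro i _
    rw [if_neg]; rintro ⟨h, _⟩; exact hne (by rw [hj0, h])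
  simp only [hu, ← hj0, and_self, if_true]
  have n0 : 0 < WN S t (s + 1) := WN_pos _ _ _
  have hq : N x / WN S t (s + 1) = 64 * j0 + 63 := by
    rw [hW0, mul_comm, ← Nat.div_div_eq_div_mul] at hj0
    omega
  obtain ⟨Z, hZ⟩ : ∃ Z, Z + q * WN S t (s + 1) = j0 * WN S t s + 63 * WN S t (s + 1) :=
    ⟨j0 * WN S t s + 63 * WN S t (s + 1) - q * WN S t (s + 1), by
      have : q * WN S t (s + 1) ≤ 63 * WN S t (s + 1) := Nat.mul_le_mul_right _ (by omega)
      omega⟩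
  calc _ = ∑ k ∈ A, c k * ∑ i ∈ range (WN S t s), (∑ y, ee ((k : ZMod (2 ^ M)) * y) * starRingEnd ℂ (pk M S t 1 q ⟨s, i, j0⟩ y)) *
      pk M S t 11 (q - 5) ⟨s, i, j0⟩ x := by
        simp only [mul_sum]
        rw [sum_comm]
        apply sum_congr rfl; intro i _
        simp only [sum_mul]
        rw [sum_comm]
        simp only [mul_sum]
        apply sum_congr rfl; intro k _
        apply sum_congr rfl; intro y _
        ring
    _ = _ := by
        apply sum_congr rfl; intro k hk
        rw [repro_char h1 h2 hM hs hjL hZ (hA k hk) x]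
        unfold sg
        rw [if_pos hu, hq]
        have : ((WN S t (s + 1) * ((64 * j0 + 63 : ℕ) : ℤ)) - q * WN S t (s + 1) - k : ℤ) = (Z : ℤ) - k := by
          rw [hW0] at hZ
          zify at hZ; push_cast; linarith
        push_cast at this ⊢
        rw [this]; ring

/-- the bound for one shift -/
lemma shift_bd {q : ℕ} (h1 : 8 ≤ q) (h2 : q ≤ 21) (hM : t + 6 * S + 6 ≤ M) (K : ℕ) (η : ℕ) (hK : K + η ≤ 2 ^ M)
    (c : ℕ → ℂ) (N : ZMod (2 ^ M) → ℕ) (hN : ∀ x, N x + η < 2 ^ M) (E : Finset (ZMod (2 ^ M))) :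
    ∑ x ∈ E, ‖∑ k ∈ range K, c k * ee ((k : ZMod (2 ^ M)) * x) * ∑ s ∈ range S, sg (WN S t (s + 1)) q (N x + η) (k + η)‖ ≤
      (2 ^ 40) ^ 14 * √(∑ x : ZMod (2 ^ M), ‖∑ k ∈ range K, c k * ee ((k : ZMod (2 ^ M)) * x)‖ ^ 2) * √(E.card : ℝ) := by
  have hf : ∀ y : ZMod (2 ^ M), ∑ k ∈ Ico η (K + η), c (k - η) * ee ((k : ZMod (2 ^ M)) * y) =
      ee ((η : ZMod (2 ^ M)) * y) * ∑ k ∈ range K, c k * ee ((k : ZMod (2 ^ M)) * y) := by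
    intro y
    rw [sum_Ico_eq_sum_range, mul_sum]
    simp only [add_tsub_cancel_right, add_tsub_cancel_left]
    apply sum_congr rfl; intro k _
    push_cast; rw [add_mul, ee_add]; ring
  have hmod := (CG M S t hM).model_bd (E := E) (N := fun x => N x + η)
    (a := fun P => ∑ y, (∑ k ∈ Ico η (K + η), c (k - η) * ee ((k : ZMod (2 ^ M)) * y)) * starRingEnd ℂ (pk M S t 1 q P y))
    (pk_packet (B := 1) (q := q) hM (by omega) (by omega) (by omega) (by omega))
    (fun y => ∑ k ∈ Ico η (K + η), c (k - η) * ee ((k : ZMod (2 ^ M)) * y)) (fun P => rfl)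
    (pk_packet (B := 11) (q := q - 5) hM (by omega) (by omega) (by omega) (by omega))
    (pk_lowpass (B := 11) (q := q - 5) hM (by omega) (by omega))
    (QQ M S t) (QQ_valid hM)
  have e1 : ∀ x, ‖∑ k ∈ range K, c k * ee ((k : ZMod (2 ^ M)) * x) * ∑ s ∈ range S, sg (WN S t (s + 1)) q (N x + η) (k + η)‖ =
      ‖(CG M S t hM).Tf (fun x => N x + η) (fun P => ∑ y, (∑ k ∈ Ico η (K + η), c (k - η) * ee ((k : ZMod (2 ^ M)) * y)) * starRingEnd ℂ (pk M S t 1 q P y))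
      (pk M S t 11 (q - 5)) (QQ M S t) x‖ := by
    intro x
    rw [Tf_eq h1 h2 hM (Ico η (K + η)) (fun k hk => by have := (mem_Ico.1 hk).2; omega) _ _ x (hN x)]
    rw [sum_comm]
    have : ∑ k ∈ Ico η (K + η), ∑ s ∈ range S, c (k - η) * sg (WN S t (s + 1)) q (N x + η) k * ee ((k : ZMod (2 ^ M)) * x) =
        ee ((η : ZMod (2 ^ M)) * x) * ∑ k ∈ range K, c k * ee ((k : ZMod (2 ^ M)) * x) * ∑ s ∈ range S, sg (WN S t (s + 1)) q (N x + η) (k + η) := by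
      rw [sum_Ico_eq_sum_range, mul_sum]
      simp only [add_tsub_cancel_right, add_tsub_cancel_left]
      apply sum_congr rfl; intro k _
      push_cast; rw [add_mul, ee_add, mul_sum, mul_sum]
      apply sum_congr rfl; intro s _
      rw [add_comm η k]; ring
    rw [this, norm_mul, ee_norm, one_mul]
  rw [sum_congr rfl (fun x _ => e1 x)]
  refine hmod.trans (le_of_eq ?_)
  simp only [hf, norm_mul, ee_norm, one_mul]
  rfl

end

/-- averaging of a periodic function -/
lemma sum_periodic (T : ℕ) (h : ℕ → ℂ) (hp : ∀ m, h (m + T) = h m) (p N : ℕ) :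
    ∑ η ∈ range (p * T), h (N + η) = p * ∑ m ∈ range T, h m := by
  have h1 : ∀ N, ∑ η ∈ range T, h (N + η) = ∑ m ∈ range T, h m := by
    intro N
    induction N with
    | zero => simp
    | succ N ih =>
      rw [← ih]
      have e1 := sum_range_succ (fun η => h (N + η)) T
      have e2 := sum_range_succ' (fun η => h (N + η)) T
      rw [e1] at e2
      simp only [add_zero] at e2
      rw [hp N] at e2
      have e3 := add_right_cancel e2
      rw [e3]
      apply sum_congr rfl; intro η _; congr 1; ring
  induction p with
  | zero => simp
  | succ p ih =>
    rw [add_mul, one_mul, sum_range_add, ih]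
    have : ∑ x ∈ range T, h (N + (p * T + x)) = ∑ m ∈ range T, h m := by
      rw [← h1 (N + p * T)]; apply sum_congr rfl; intro x _; congr 1; ring
    rw [this]; push_cast; ring

lemma sg_avg {n : ℕ} (n0 : 0 < n) (q N k p : ℕ) :
    ∑ η ∈ range (p * (64 * n)), sg n q (N + η) (k + η) = p * AA n (mm 1 n) ((N:ℤ) - k - q * n) := by
  set h : ℕ → ℂ := fun m => if m / n % 64 = 63 then mm 1 n ((N:ℤ) - k - q * n - (m % n : ℕ)) else 0 with hh
  have e1 : ∀ η ∈ range (p * (64 * n)), sg n q (N + η) (k + η) = h (N + η) := by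
    intro η _
    simp only [hh, sg]
    congr 2
    have := Nat.div_add_mod (N + η) n
    zify at this ⊢
    linear_combination this
  rw [sum_congr rfl e1, sum_periodic]
  · congr 1
    have e2 : 64 * n = 63 * n + n := by ring
    rw [e2, sum_range_add]
    have z1 : ∑ x ∈ range (63 * n), h x = 0 := by
      apply sum_eq_zero; intro x hx
      have : x / n < 63 := (Nat.div_lt_iff_lt_mul n0).2 (mem_range.1 hx)
      have h3 : x / n % 64 ≠ 63 := by
        rw [Nat.mod_eq_of_lt (this.trans (by norm_num))]; exact this.ne
      simp only [hh]; rw [if_neg h3]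
    rw [z1, zero_add]
    unfold AA
    apply sum_congr rfl; intro r hr
    have hr := mem_range.1 hr
    have d1 : (63 * n + r) / n = 63 := by
      rw [mul_comm, Nat.mul_add_div n0, Nat.div_eq_of_lt hr]
    have d2 : (63 * n + r) % n = r := by
      rw [mul_comm, Nat.mul_add_mod, Nat.mod_eq_of_lt hr]
    simp only [hh]
    rw [d1, d2, if_pos rfl]
  · intro m
    have d1 : (m + 64 * n) / n = m / n + 64 := by rw [Nat.add_mul_div_right _ _ n0]
    have d2 : (m + 64 * n) % n = m % n := Nat.add_mul_mod_self_right _ _ _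
    simp only [hh, d1, d2]
    congr 1
    simp
end CT

end

section
namespace CT
open Finset
open scoped Classical

noncomputable def VV (n q : ℕ) (u : ℤ) : ℂ := (n:ℂ)⁻¹ * AA n (mm 1 n) (u - q * n)
noncomputable def JJ (m : ℤ) (u : ℤ) : ℂ := if u < m then 1 else 0
noncomputable def XX (n i : ℕ) (m : ℤ) : ℤ → ℂ := (AA n)^[i] (JJ m)
noncomputable def YY (n d : ℕ) (u : ℤ) : ℂ := ((n:ℂ)⁻¹) ^ 6 * XX n 6 (d * n) u

lemma AA_sub (n : ℕ) (g h : ℤ → ℂ) : AA n (fun u => g u - h u) = fun u => AA n g u - AA n h u := by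
  funext u; simp [AA, sum_sub_distrib]

lemma AA_shift (n : ℕ) (g : ℤ → ℂ) (a : ℤ) : AA n (fun u => g (u - a)) = fun u => AA n g (u - a) := by
  funext u; unfold AA; apply sum_congr rfl; intro v _; congr 1; ring

lemma AA_sum (n : ℕ) {ι : Type} (A : Finset ι) (c : ι → ℂ) (g : ι → ℤ → ℂ) :
    AA n (fun u => ∑ i ∈ A, c i * g i u) = fun u => ∑ i ∈ A, c i * AA n (g i) u := by
  funext u; unfold AA; rw [sum_comm]; apply sum_congr rfl; intro i _; rw [mul_sum]

lemma XX_succ (n i : ℕ) (m : ℤ) : XX n (i + 1) m = AA n (XX n i m) := by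
  unfold XX; rw [Function.iterate_succ_apply']

lemma XX_shift (n i : ℕ) (m a : ℤ) : (fun u => XX n i m (u - a)) = XX n i (m + a) := by
  induction i with
  | zero =>
    funext u; simp only [XX, Function.iterate_zero, id, JJ]
    congr 1
    simp only [eq_iff_iff]; constructor <;> intro h <;> linarith
  | succ i ih =>
    rw [XX_succ, XX_succ, ← ih, AA_shift]

lemma VV_eq {n : ℕ} (q : ℕ) (u : ℤ) : VV n q u = YY n (q + 1) u - YY n q u := by
  have h1 : ∀ u : ℤ, AA (1 * n) dl (u - q * n) = JJ ((q + 1 : ℕ) * n) u - JJ (q * n) u := by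
    intro u
    rw [AA_dl]; unfold JJ
    have e : (((q + 1 : ℕ) : ℤ) * n) = q * n + n := by push_cast; ring
    rw [e]
    have hn : (0:ℤ) ≤ n := by positivity
    by_cases a : u < q * n
    · rw [if_neg (by omega), if_pos (by omega), if_pos a]; simp
    · by_cases b : u < q * n + n
      · rw [if_pos (by omega), if_pos b, if_neg a]; simp
      · rw [if_neg (by omega), if_neg b, if_neg a]; simp
  have h2 : (fun u : ℤ => AA (1 * n) dl (u - q * n)) = fun u => JJ ((q + 1 : ℕ) * n) u - JJ (q * n) u := funext h1
  have h3 : AA n (AA n (AA n (AA n (AA n (AA n (AA (1 * n) dl)))))) (u - q * n) =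
      XX n 6 ((q + 1 : ℕ) * n) u - XX n 6 (q * n) u := by
    have : (fun u : ℤ => AA n (AA n (AA n (AA n (AA n (AA n (AA (1 * n) dl)))))) (u - q * n)) =
        AA n (AA n (AA n (AA n (AA n (AA n (fun u : ℤ => AA (1 * n) dl (u - q * n))))))) := by
      simp only [AA_shift]
    have h4 := congrFun this u
    rw [h4, h2]
    simp only [AA_sub]
    rfl
  unfold VV YY
  have h5 : mm 1 n = fun k => ((n:ℂ)⁻¹) ^ 5 * AA n (AA n (AA n (AA n (AA n (AA (1 * n) dl))))) k := rfl
  rw [h5, AA_smul]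
  simp only
  rw [h3]; ring

lemma pascal_sum (i : ℕ) (f : ℕ → ℂ) :
    ∑ k ∈ range (i + 2), ((i + 1).choose k : ℂ) * f k =
      ∑ k ∈ range (i + 1), (i.choose k : ℂ) * (f k + f (k + 1)) := by
  rw [sum_range_succ']
  simp only [Nat.choose_succ_succ, Nat.cast_add, add_mul, sum_add_distrib, mul_add]
  have := sum_range_succ' (fun k => (i.choose k : ℂ) * f k) (i + 1)
  rw [sum_range_succ] at this
  simp at this
  simp
  rw [this]; ring

lemma AA_two (n : ℕ) (g : ℤ → ℂ) (u : ℤ) : AA (2 * n) g u = AA n g u + AA n g (u - n) := by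
  unfold AA
  rw [two_mul, sum_range_add]
  congr 1; apply sum_congr rfl; intro v _; congr 1; push_cast; ring

lemma XX_two (n i : ℕ) (m : ℤ) :
    XX (2 * n) i m = fun u => ∑ k ∈ range (i + 1), (i.choose k : ℂ) * XX n i (m + k * n) u := by
  induction i with
  | zero => funext u; simp [XX]
  | succ i ih =>
    rw [XX_succ, ih, AA_sum]
    funext u
    rw [pascal_sum i (fun k => XX n (i + 1) (m + k * n) u)]
    apply sum_congr rfl; intro k _
    congr 1
    rw [AA_two, ← XX_succ]
    congr 1
    have := congrFun (XX_shift n (i + 1) (m + k * n) n) u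
    have this : XX n (i + 1) (m + k * n) (u - n) = XX n (i + 1) (m + k * n + n) u := this
    rw [this]; congr 1; push_cast; ring

lemma YY_two {n : ℕ} (u : ℤ) : YY (2 * n) 8 u = 64⁻¹ * ∑ k ∈ range 7, (Nat.choose 6 k : ℂ) * YY n (16 + k) u := by
  unfold YY
  rw [XX_two]
  simp only [mul_sum]
  apply sum_congr rfl; intro k _
  have : ((8 : ℕ) : ℤ) * ((2 * n : ℕ) : ℤ) + k * n = ((16 + k : ℕ) : ℤ) * n := by push_cast; ring
  rw [this]
  push_cast
  rw [mul_inv]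
  ring

/-- weights -/
noncomputable def wq (q : ℕ) : ℝ := (∑ k ∈ range 7, if q ≤ 15 + k then (Nat.choose 6 k : ℝ) else 0) / 64

lemma wq_nonneg (q : ℕ) : 0 ≤ wq q := by
  unfold wq; apply div_nonneg _ (by norm_num)
  apply sum_nonneg; intro k _; split_ifs <;> positivity

lemma wq_le (q : ℕ) : wq q ≤ 1 := by
  unfold wq
  rw [div_le_one (by norm_num)]
  calc _ ≤ ∑ k ∈ range 7, (Nat.choose 6 k : ℝ) := by
        apply sum_le_sum; intro k _; split_ifs <;> simp
    _ = 64 := by simp [sum_range_succ, Nat.choose]; norm_num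

lemma wq_tel (Y : ℕ → ℂ) : ∑ q ∈ Ico 8 22, (wq q : ℂ) * (Y (q + 1) - Y q) =
    64⁻¹ * ∑ k ∈ range 7, (Nat.choose 6 k : ℂ) * Y (16 + k) - Y 8 := by
  simp [sum_Ico_succ_top, wq, sum_range_succ, Nat.choose]
  ring

lemma tel_step {n : ℕ} (u : ℤ) : ∑ q ∈ Ico 8 22, (wq q : ℂ) * VV n q u = YY (2 * n) 8 u - YY n 8 u := by
  simp only [VV_eq]
  rw [wq_tel (fun d => YY n d u), YY_two]

lemma tel_all (T : ℕ) (u : ℤ) : ∑ τ ∈ range T, ∑ q ∈ Ico 8 22, (wq q : ℂ) * VV (2 ^ τ) q u = YY (2 ^ T) 8 u - YY 1 8 u := by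
  have : ∀ τ ∈ range T, ∑ q ∈ Ico 8 22, (wq q : ℂ) * VV (2 ^ τ) q u = YY (2 ^ (τ + 1)) 8 u - YY (2 ^ τ) 8 u := by
    intro τ _; rw [tel_step, pow_succ, mul_comm]
  rw [sum_congr rfl this, sum_range_sub (fun τ => YY (2 ^ τ) 8 u)]; simp

lemma YY_one (u : ℤ) : YY 1 8 u = JJ 8 u := by
  have : AA 1 = id := by funext g u; simp [AA]
  simp [YY, XX, this]

lemma AA_const' {n : ℕ} {g : ℤ → ℂ} {b : ℤ} {c : ℂ} (h : ∀ u, u < b → g u = c) :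
    ∀ u, u < b → AA n g u = n * c := by
  intro u h2
  unfold AA
  have : ∑ v ∈ range n, g (u - (v : ℕ)) = ∑ v ∈ range n, c :=
    sum_congr rfl (fun v hv => h (u - (v : ℕ)) (by omega))
  rw [this]
  simp

lemma YY_top {n : ℕ} (hn : 0 < n) (u : ℤ) (h : u < 8 * n) : YY n 8 u = 1 := by
  have h0 : ∀ u : ℤ, u < 8 * n → JJ ((8:ℕ) * n) u = 1 := by
    intro u h; unfold JJ; rw [if_pos]; push_cast; exact h
  have h := AA_const' (n := n) (AA_const' (n := n) (AA_const' (n := n) (AA_const' (n := n) (AA_const' (n := n) (AA_const' (n := n) h0))))) u h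
  unfold YY
  have : XX n 6 ((8:ℕ) * n) u = _ := h
  rw [this]
  have : (n:ℂ) ≠ 0 := by exact_mod_cast hn.ne'
  field_simp

lemma sum_split (S : ℕ) (f : ℕ → ℂ) :
    ∑ t ∈ range 6, ∑ s ∈ range S, f (t + 6 * (S - (s + 1))) = ∑ τ ∈ range (6 * S), f τ := by
  have h1 : ∀ t ∈ range 6, ∑ s ∈ range S, f (t + 6 * (S - (s + 1))) = ∑ s ∈ range S, f (t + 6 * s) := by
    intro t _
    rw [← sum_range_reflect (fun s => f (t + 6 * s))]
    apply sum_congr rfl; intro s _; congr 3; omega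
  rw [sum_congr rfl h1]
  induction S with
  | zero => simp
  | succ S ih =>
    have e : 6 * (S + 1) = 6 * S + 6 := by ring
    rw [e, sum_range_add, ← ih (by intro t _
                                   rw [← sum_range_reflect (fun s => f (t + 6 * s))]
                                   apply sum_congr rfl; intro s _; congr 3; omega)]
    simp only [sum_range_succ _ S, sum_add_distrib]
    congr 1
    apply sum_congr rfl; intro t _; congr 1; ring

lemma avg_bd {M S t q K : ℕ} (h1 : 8 ≤ q) (h2 : q ≤ 21) (ht : t < 6) (hM : M = 6 * S + 20) (hK : K ≤ 2 ^ (6 * S + 5))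
    (c : ℕ → ℂ) (N : ZMod (2 ^ M) → ℕ) (hN : ∀ x, N x ≤ 2 ^ (6 * S + 5)) (E : Finset (ZMod (2 ^ M))) :
    ∑ x ∈ E, ‖∑ k ∈ range K, c k * ee ((k : ZMod (2 ^ M)) * x) * ∑ s ∈ range S, VV (WN S t (s + 1)) q ((N x : ℤ) - k)‖ ≤
      64 * ((2 ^ 40) ^ 14 * √(∑ x : ZMod (2 ^ M), ‖∑ k ∈ range K, c k * ee ((k : ZMod (2 ^ M)) * x)‖ ^ 2) * √(E.card : ℝ)) := by
  have hM' : t + 6 * S + 6 ≤ M := by omega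
  obtain ⟨C, hC⟩ : ∃ C, C = (2 ^ 40) ^ 14 * √(∑ x : ZMod (2 ^ M), ‖∑ k ∈ range K, c k * ee ((k : ZMod (2 ^ M)) * x)‖ ^ 2) * √(E.card : ℝ) := ⟨_, rfl⟩
  rw [← hC]
  obtain ⟨R, hR⟩ : ∃ R : ℕ, R = 2 ^ (6 * S + 5) := ⟨_, rfl⟩
  have R0 : (0:ℝ) < R := by rw [hR]; positivity
  have hRM : 8 * R ≤ 2 ^ M := by
    rw [hR, hM]; calc 8 * 2 ^ (6 * S + 5) = 2 ^ (6 * S + 8) := by rw [pow_add, pow_add]; ring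
      _ ≤ _ := Nat.pow_le_pow_right (by norm_num) (by omega)
  have R0' : 0 < R := by exact_mod_cast R0
  have hsum : ∀ s ∈ range S, ∀ N k : ℕ, ∑ η ∈ range R, sg (WN S t (s + 1)) q (N + η) (k + η) =
      (R / 64 : ℂ) * VV (WN S t (s + 1)) q ((N : ℤ) - k) := by
    intro s hs N k
    have hs := mem_range.1 hs
    obtain ⟨p, hp⟩ : (64 * WN S t (s + 1)) ∣ R := by
      rw [hR, ← WN_succ hs]; unfold WN; apply pow_dvd_pow; omega
    have n0 : (WN S t (s + 1) : ℂ) ≠ 0 := by exact_mod_cast (WN_pos S t (s + 1)).ne'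
    have := sg_avg (WN_pos S t (s + 1)) q N k p
    rw [mul_comm p, ← hp] at this
    rw [this, hp]; unfold VV; push_cast; field_simp
  have hpt : ∀ x, (R / 64 : ℝ) * ‖∑ k ∈ range K, c k * ee ((k : ZMod (2 ^ M)) * x) * ∑ s ∈ range S, VV (WN S t (s + 1)) q ((N x : ℤ) - k)‖ ≤
      ∑ η ∈ range R, ‖∑ k ∈ range K, c k * ee ((k : ZMod (2 ^ M)) * x) * ∑ s ∈ range S, sg (WN S t (s + 1)) q (N x + η) (k + η)‖ := by
    intro x
    refine le_trans (le_of_eq ?_) (norm_sum_le _ _)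
    rw [sum_comm]
    have : ∀ k ∈ range K, ∑ η ∈ range R, c k * ee ((k : ZMod (2 ^ M)) * x) * ∑ s ∈ range S, sg (WN S t (s + 1)) q (N x + η) (k + η) =
        (R / 64 : ℂ) * (c k * ee ((k : ZMod (2 ^ M)) * x) * ∑ s ∈ range S, VV (WN S t (s + 1)) q ((N x : ℤ) - k)) := by
      intro k _
      rw [← mul_sum, sum_comm, sum_congr rfl (fun s hs => hsum s hs (N x) k), ← mul_sum]; ring
    rw [sum_congr rfl this, ← mul_sum, norm_mul]
    congr 1
    simp
  have hall : (R / 64 : ℝ) * ∑ x ∈ E, ‖∑ k ∈ range K, c k * ee ((k : ZMod (2 ^ M)) * x) * ∑ s ∈ range S, VV (WN S t (s + 1)) q ((N x : ℤ) - k)‖ ≤ R * C := by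
    rw [mul_sum]
    refine (sum_le_sum fun x _ => hpt x).trans ?_
    rw [sum_comm]
    calc _ ≤ ∑ η ∈ range R, C := by
          apply sum_le_sum; intro η hη
          have hη := mem_range.1 hη
          rw [hC]
          exact shift_bd h1 h2 hM' K η (by rw [← hR] at hK; omega) c N (fun x => by have := hN x; rw [← hR] at this; omega) E
      _ = R * C := by simp
  have : (R / 64 : ℝ) * ∑ x ∈ E, ‖∑ k ∈ range K, c k * ee ((k : ZMod (2 ^ M)) * x) * ∑ s ∈ range S, VV (WN S t (s + 1)) q ((N x : ℤ) - k)‖ ≤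
      (R / 64 : ℝ) * (64 * C) := by
    refine hall.trans (le_of_eq (by ring))
  exact le_of_mul_le_mul_left this (by positivity)

lemma ind_eq {S K : ℕ} (hK : K + 8 ≤ 2 ^ (6 * S + 3)) (N : ℕ) (hN : N ≤ K) (k : ℕ) :
    (if k < N then (1:ℂ) else 0) =
        ∑ t ∈ range 6, ∑ q ∈ Ico 8 22, (wq q : ℂ) * ∑ s ∈ range S, VV (WN S t (s + 1)) q (((N + 7 : ℕ) : ℤ) - k) := by
  obtain ⟨u, hu⟩ : ∃ u : ℤ, u = ((N + 7 : ℕ) : ℤ) - k := ⟨_, rfl⟩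
  rw [← hu]
  have h3 := sum_split S (fun τ => ∑ q ∈ Ico 8 22, (wq q : ℂ) * VV (2 ^ τ) q u)
  beta_reduce at h3
  rw [tel_all] at h3
  have h4 : ∀ t ∈ range 6, ∑ q ∈ Ico 8 22, (wq q : ℂ) * ∑ s ∈ range S, VV (WN S t (s + 1)) q u =
      ∑ s ∈ range S, ∑ q ∈ Ico 8 22, (wq q : ℂ) * VV (2 ^ (t + 6 * (S - (s + 1)))) q u := by
    intro t _
    simp only [mul_sum]
    rw [sum_comm]
    rfl
  rw [sum_congr rfl h4, h3, YY_one]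
  have e8 : 2 ^ (6 * S + 3) = 8 * (2:ℕ) ^ (6 * S) := by rw [pow_add]; ring
  rw [e8] at hK
  have pp : 0 < (2:ℕ) ^ (6 * S) := by positivity
  generalize (2:ℕ) ^ (6 * S) = P at hK pp
  rw [YY_top pp _ (by omega)]
  unfold JJ
  by_cases hk : k < N
  · rw [if_pos hk, if_neg (by omega)]; simp
  · rw [if_neg hk, if_pos (by omega)]; simp

lemma comb_pt {ι : Type} (K N : ℕ) (hN : N ≤ K) (a : ℕ → ℂ) (A : Finset ℕ) (B : Finset ℕ) (w : ℕ → ℝ) (w0 : ∀ q, 0 ≤ w q)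
    (w1 : ∀ q, w q ≤ 1) (F : ℕ → ℕ → ℕ → ℂ)
    (h : ∀ k, (if k < N then (1:ℂ) else 0) = ∑ t ∈ A, ∑ q ∈ B, (w q : ℂ) * F t q k) :
    ‖∑ k ∈ range N, a k‖ ≤ ∑ t ∈ A, ∑ q ∈ B, ‖∑ k ∈ range K, a k * F t q k‖ := by
  have e : ∑ k ∈ range N, a k = ∑ t ∈ A, ∑ q ∈ B, (w q : ℂ) * ∑ k ∈ range K, a k * F t q k := by
    have e1 : ∑ k ∈ range N, a k = ∑ k ∈ range K, a k * (if k < N then (1:ℂ) else 0) := by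
      simp only [mul_ite, mul_one, mul_zero]
      rw [← sum_filter]
      congr 1; ext k; simp; omega
    rw [e1]
    simp only [h, mul_sum]
    rw [sum_comm]
    apply sum_congr rfl; intro t _
    rw [sum_comm]
    apply sum_congr rfl; intro q _
    apply sum_congr rfl; intro k _
    ring
  rw [e]
  refine (norm_sum_le _ _).trans (sum_le_sum fun t _ => (norm_sum_le _ _).trans (sum_le_sum fun q _ => ?_))
  rw [norm_mul, Complex.norm_real, Real.norm_of_nonneg (w0 q)]
  exact mul_le_of_le_one_left (norm_nonneg _) (w1 q)

lemma const_le : (6 * (14 * (64 * (2 ^ 40) ^ 14)) : ℝ) ≤ 2 ^ 600 := by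
  rw [← pow_mul]
  calc (6 * (14 * (64 * 2 ^ (40 * 14))) : ℝ) = 5376 * 2 ^ (40 * 14) := by ring
    _ ≤ 2 ^ 40 * 2 ^ (40 * 14) := by gcongr; norm_num
    _ = 2 ^ 600 := by rw [← pow_add]

/-- the discrete Carleson theorem -/
theorem discrete_carleson {M S K : ℕ} (hM : M = 6 * S + 20) (hK : K + 8 ≤ 2 ^ (6 * S + 3))
    (c : ℕ → ℂ) (N : ZMod (2 ^ M) → ℕ) (hN : ∀ x, N x ≤ K) (E : Finset (ZMod (2 ^ M))) :
    ∑ x ∈ E, ‖∑ k ∈ range (N x), c k * ee ((k : ZMod (2 ^ M)) * x)‖ ≤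
      2 ^ 600 * (√(∑ x : ZMod (2 ^ M), ‖∑ k ∈ range K, c k * ee ((k : ZMod (2 ^ M)) * x)‖ ^ 2) * √(E.card : ℝ)) := by
  obtain ⟨D, hD⟩ : ∃ D, D = √(∑ x : ZMod (2 ^ M), ‖∑ k ∈ range K, c k * ee ((k : ZMod (2 ^ M)) * x)‖ ^ 2) * √(E.card : ℝ) := ⟨_, rfl⟩
  have D0 : 0 ≤ D := by rw [hD]; exact mul_nonneg (Real.sqrt_nonneg _) (Real.sqrt_nonneg _)
  have hK5 : K + 8 ≤ 2 ^ (6 * S + 5) := hK.trans (Nat.pow_le_pow_right (by norm_num) (by omega))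
  have hpt : ∀ x, ‖∑ k ∈ range (N x), c k * ee ((k : ZMod (2 ^ M)) * x)‖ ≤
      ∑ t ∈ range 6, ∑ q ∈ Ico 8 22, ‖∑ k ∈ range K, c k * ee ((k : ZMod (2 ^ M)) * x) *
        ∑ s ∈ range S, VV (WN S t (s + 1)) q (((N x + 7 : ℕ) : ℤ) - k)‖ := fun x =>
    comb_pt (ι := ℕ) K (N x) (hN x) (fun k => c k * ee ((k : ZMod (2 ^ M)) * x)) (range 6) (Ico 8 22) wq wq_nonneg wq_le
      (fun t q k => ∑ s ∈ range S, VV (WN S t (s + 1)) q (((N x + 7 : ℕ) : ℤ) - k)) (fun k => ind_eq hK (N x) (hN x) k)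
  have hb : ∀ t ∈ range 6, ∀ q ∈ Ico 8 22, ∑ x ∈ E, ‖∑ k ∈ range K, c k * ee ((k : ZMod (2 ^ M)) * x) *
        ∑ s ∈ range S, VV (WN S t (s + 1)) q (((N x + 7 : ℕ) : ℤ) - k)‖ ≤ 64 * (2 ^ 40) ^ 14 * D := by
    intro t ht q hq
    have ht := mem_range.1 ht
    have hq := mem_Ico.1 hq
    have := avg_bd hq.1 (by omega) ht hM (by omega : K ≤ 2 ^ (6 * S + 5)) c (fun x => N x + 7) (fun x => by have := hN x; omega) E
    rw [mul_assoc ((2 ^ 40) ^ 14), ← hD, ← mul_assoc] at this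
    exact this
  rw [← hD]
  refine (sum_le_sum fun x _ => hpt x).trans ?_
  rw [sum_comm]
  have h6 : ∀ t ∈ range 6, ∑ x ∈ E, ∑ q ∈ Ico 8 22, ‖∑ k ∈ range K, c k * ee ((k : ZMod (2 ^ M)) * x) *
        ∑ s ∈ range S, VV (WN S t (s + 1)) q (((N x + 7 : ℕ) : ℤ) - k)‖ ≤ 14 * (64 * (2 ^ 40) ^ 14 * D) := by
    intro t ht
    rw [sum_comm]
    refine (sum_le_sum fun q hq => hb t ht q hq).trans ?_
    rw [sum_const, Nat.card_Ico, nsmul_eq_mul]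
    norm_num only [Nat.cast_ofNat]
    exact le_refl _
  refine (sum_le_sum h6).trans ?_
  rw [sum_const, card_range, nsmul_eq_mul]
  refine le_trans (le_of_eq ?_) (mul_le_mul_of_nonneg_right const_le D0)
  generalize (2 ^ 40 : ℝ) ^ 14 = Z
  push_cast; ring
end CT

end

section
namespace CT
open Finset
open scoped Classical

lemma planch_sum {L : ℕ} [NeZero L] {K : ℕ} (hK : K ≤ L) (c : ℕ → ℂ) :
    ∑ x : ZMod L, ‖∑ k ∈ range K, c k * ee ((k : ZMod L) * x)‖ ^ 2 = L * ∑ k ∈ range K, ‖c k‖ ^ 2 := by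
  have e : ∀ z : ℂ, ((‖z‖ ^ 2 : ℝ) : ℂ) = z * starRingEnd ℂ z := by
    intro z; rw [Complex.mul_conj, Complex.normSq_eq_norm_sq]
  have : ((∑ x : ZMod L, ‖∑ k ∈ range K, c k * ee ((k : ZMod L) * x)‖ ^ 2 : ℝ) : ℂ) = ((L * ∑ k ∈ range K, ‖c k‖ ^ 2 : ℝ) : ℂ) := by
    rw [Complex.ofReal_sum]
    simp only [e]
    rw [Complex.ofReal_mul, Complex.ofReal_sum]
    simp only [e, map_sum, map_mul, ee_conj, sum_mul_sum]
    rw [sum_comm, mul_sum]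
    apply sum_congr rfl; intro k hk
    rw [sum_comm]
    have h2 : ∀ l ∈ range K, ∑ x : ZMod L, c k * ee ((k : ZMod L) * x) * (starRingEnd ℂ (c l) * ee (-((l : ZMod L) * x))) =
        if k = l then (L : ℂ) * (c k * starRingEnd ℂ (c k)) else 0 := by
      intro l hl
      have h3 : ∀ x : ZMod L, c k * ee ((k : ZMod L) * x) * (starRingEnd ℂ (c l) * ee (-((l : ZMod L) * x))) =
          c k * starRingEnd ℂ (c l) * ee (((k : ZMod L) - (l : ZMod L)) * x) := by
        intro x
        rw [sub_mul, sub_eq_add_neg, ee_add]; ring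
      simp only [h3]
      rw [← mul_sum, ee_sum]
      have hk := mem_range.1 hk
      have hl := mem_range.1 hl
      by_cases hkl : k = l
      · subst hkl; simp; ring
      · rw [if_neg hkl, if_neg, mul_zero]
        intro h
        rw [sub_eq_zero] at h
        have := congrArg ZMod.val h
        rw [ZMod.val_cast_of_lt (by omega), ZMod.val_cast_of_lt (by omega)] at this
        exact hkl this
    rw [sum_congr rfl h2, sum_ite_eq, if_pos hk]; push_cast; rfl
  exact_mod_cast this

noncomputable def SS (a : ℤ → ℂ) (N : ℕ) (x : ℝ) : ℂ :=
  ∑ n ∈ Icc (-(N : ℤ)) (N : ℤ), a n * Complex.exp (Complex.I * (n : ℂ) * (x : ℂ))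

lemma SS_eq (a : ℤ → ℂ) {N R : ℕ} (h : N ≤ R) (x : ℝ) :
    SS a N x = ∑ k ∈ range (R + N + 1), a ((k : ℤ) - R) * Complex.exp (Complex.I * (((k : ℤ) - R : ℤ) : ℂ) * (x : ℂ)) -
      ∑ k ∈ range (R - N), a ((k : ℤ) - R) * Complex.exp (Complex.I * (((k : ℤ) - R : ℤ) : ℂ) * (x : ℂ)) := by
  rw [← sum_Ico_eq_sub _ (by omega)]
  unfold SS
  symm
  apply sum_bij (fun (k : ℕ) _ => (k : ℤ) - R)
  · intro k hk; rw [mem_Ico] at hk; rw [mem_Icc]; omega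
  · intro k _ l _ h; simpa using h
  · intro n hn; rw [mem_Icc] at hn
    refine ⟨(n + R).toNat, ?_, ?_⟩
    · rw [mem_Ico]; omega
    · omega
  · intro k _; rfl

lemma exp_split {L : ℕ} [NeZero L] (k R : ℕ) (θ : ℝ) (j : ZMod L) :
    Complex.exp (Complex.I * (((k : ℤ) - R : ℤ) : ℂ) * ((θ + 2 * Real.pi / L * (j.val : ℕ) : ℝ) : ℂ)) =
      Complex.exp (-(Complex.I * R * ((θ + 2 * Real.pi / L * (j.val : ℕ) : ℝ) : ℂ))) *
        (Complex.exp (Complex.I * k * θ) * ee ((k : ZMod L) * j)) := by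
  have hj : (k : ZMod L) * j = (((k * j.val : ℕ) : ℤ) : ZMod L) := by
    push_cast; rw [ZMod.natCast_zmod_val]
  unfold ee
  rw [hj, ZMod.stdAddChar_coe, ← Complex.exp_add, ← Complex.exp_add]
  congr 1
  push_cast
  ring

lemma SS_bd {L : ℕ} [NeZero L] (a : ℤ → ℂ) {N R : ℕ} (h : N ≤ R) (θ : ℝ) (j : ZMod L) :
    ‖SS a N (θ + 2 * Real.pi / L * (j.val : ℕ))‖ ≤
      ‖∑ k ∈ range (R + N + 1), (a ((k : ℤ) - R) * Complex.exp (Complex.I * k * θ)) * ee ((k : ZMod L) * j)‖ +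
      ‖∑ k ∈ range (R - N), (a ((k : ℤ) - R) * Complex.exp (Complex.I * k * θ)) * ee ((k : ZMod L) * j)‖ := by
  have h1 : ∀ m : ℕ, ‖∑ k ∈ range m, a ((k : ℤ) - R) * Complex.exp (Complex.I * (((k : ℤ) - R : ℤ) : ℂ) * ((θ + 2 * Real.pi / L * (j.val : ℕ) : ℝ) : ℂ))‖ =
      ‖∑ k ∈ range m, (a ((k : ℤ) - R) * Complex.exp (Complex.I * k * θ)) * ee ((k : ZMod L) * j)‖ := by
    intro m
    have e : ∀ k ∈ range m, a ((k : ℤ) - R) * Complex.exp (Complex.I * (((k : ℤ) - R : ℤ) : ℂ) * ((θ + 2 * Real.pi / L * (j.val : ℕ) : ℝ) : ℂ)) =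
        Complex.exp (-(Complex.I * R * ((θ + 2 * Real.pi / L * (j.val : ℕ) : ℝ) : ℂ))) *
          ((a ((k : ℤ) - R) * Complex.exp (Complex.I * k * θ)) * ee ((k : ZMod L) * j)) := by
      intro k _; rw [exp_split]; ring
    rw [sum_congr rfl e, ← mul_sum, norm_mul]
    have : ‖Complex.exp (-(Complex.I * R * ((θ + 2 * Real.pi / L * (j.val : ℕ) : ℝ) : ℂ)))‖ = 1 := by
      rw [Complex.norm_exp]
      simp
    rw [this, one_mul]
  rw [SS_eq a h]
  refine (norm_sub_le _ _).trans ?_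
  rw [h1, h1]

lemma quad_bd {l m C D : ℝ} (hl : 0 < l) (hm : 0 ≤ m) (hD : 0 ≤ D) (hC : 0 ≤ C) (h : l * m ≤ C * (√D * √m)) : m ≤ C ^ 2 * D / l ^ 2 := by
  rw [le_div_iff₀ (by positivity)]
  rcases hm.eq_or_lt with h0 | h0
  · rw [← h0]; simp; positivity
  have h1 : (l * m) ^ 2 ≤ (C * (√D * √m)) ^ 2 := by gcongr
  rw [mul_pow, mul_pow, mul_pow, Real.sq_sqrt hD, Real.sq_sqrt hm] at h1
  have : m * (m * l ^ 2) ≤ m * (C ^ 2 * D) := by nlinarith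
  exact le_of_mul_le_mul_left this h0

/-- number of bad points on a translate of the lattice -/
lemma count_bd {M S R : ℕ} (hM : M = 6 * S + 20) (hR : 2 * R + 1 + 8 ≤ 2 ^ (6 * S + 3)) (a : ℤ → ℂ) (δ l : ℝ)
    (ha : ∑ k ∈ range (2 * R + 1), ‖a ((k : ℤ) - R)‖ ^ 2 ≤ δ ^ 2) (hl : 0 < l) (θ : ℝ)
    (E : Finset (ZMod (2 ^ M)))
    (hE : ∀ j ∈ E, ∃ N ≤ R, l ≤ ‖SS a N (θ + 2 * Real.pi / ((2 ^ M : ℕ) : ℝ) * (j.val : ℕ))‖) :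
    (E.card : ℝ) ≤ ((2 ^ M : ℕ) : ℝ) * ((2 * 2 ^ 600) ^ 2 * δ ^ 2 / l ^ 2) := by
  have hE' : ∀ j, ∃ N, N ≤ R ∧ (j ∈ E → l ≤ ‖SS a N (θ + 2 * Real.pi / ((2 ^ M : ℕ) : ℝ) * (j.val : ℕ))‖) := by
    intro j
    by_cases hj : j ∈ E
    · obtain ⟨N, h1, h2⟩ := hE j hj; exact ⟨N, h1, fun _ => h2⟩
    · exact ⟨0, Nat.zero_le _, fun h => absurd h hj⟩
  choose N hN1 hN2 using hE'
  obtain ⟨c, hc⟩ : ∃ c : ℕ → ℂ, c = fun k : ℕ => a ((k : ℤ) - R) * Complex.exp (Complex.I * k * θ) := ⟨_, rfl⟩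
  have cn : ∀ k, ‖c k‖ = ‖a ((k : ℤ) - R)‖ := by
    intro k; rw [hc]; beta_reduce; rw [norm_mul, Complex.norm_exp]; simp
  obtain ⟨D, hD⟩ : ∃ D, D = ∑ x : ZMod (2 ^ M), ‖∑ k ∈ range (2 * R + 1), c k * ee ((k : ZMod (2 ^ M)) * x)‖ ^ 2 := ⟨_, rfl⟩
  have hKL : 2 * R + 1 ≤ 2 ^ M := by
    have : 2 ^ (6 * S + 3) ≤ 2 ^ M := Nat.pow_le_pow_right (by norm_num) (by omega)
    omega
  have D0 : 0 ≤ D := by rw [hD]; exact sum_nonneg fun _ _ => sq_nonneg _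
  have hD2 : D ≤ ((2 ^ M : ℕ) : ℝ) * δ ^ 2 := by
    rw [hD, planch_sum hKL]
    simp only [cn]
    exact mul_le_mul_of_nonneg_left ha (Nat.cast_nonneg _)
  have b1 := discrete_carleson hM hR c (fun j => R + N j + 1) (fun j => by have := hN1 j; omega) E
  have b2 := discrete_carleson hM hR c (fun j => R - N j) (fun j => by omega) E
  rw [← hD] at b1 b2
  have hsum : l * (E.card : ℝ) ≤ ∑ j ∈ E, (‖∑ k ∈ range (R + N j + 1), c k * ee ((k : ZMod (2 ^ M)) * j)‖ +
      ‖∑ k ∈ range (R - N j), c k * ee ((k : ZMod (2 ^ M)) * j)‖) := by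
    rw [mul_comm, ← nsmul_eq_mul]
    apply card_nsmul_le_sum
    intro j hj
    refine (hN2 j hj).trans ?_
    rw [hc]
    exact SS_bd a (hN1 j) θ j
  rw [sum_add_distrib] at hsum
  have Z0 : (0:ℝ) ≤ 2 ^ 600 := pow_nonneg (by norm_num) _
  generalize (2 ^ 600 : ℝ) = Z at *
  have h3 : l * (E.card : ℝ) ≤ (2 * Z) * (√D * √(E.card : ℝ)) := by linarith
  refine (quad_bd hl (Nat.cast_nonneg _) D0 (by linarith) h3).trans ?_
  have l2 : 0 < l ^ 2 := by positivity
  rw [← mul_div_assoc, div_le_div_iff_of_pos_right l2]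
  have := mul_le_mul_of_nonneg_left hD2 (sq_nonneg (2 * Z))
  linarith

open MeasureTheory in
lemma avg_meas {L : ℕ} (hL : 0 < L) {U : Set ℝ} (hU : MeasurableSet U) (B : ℝ)
    (h : ∀ θ : ℝ, ∑ j ∈ range L, U.indicator (fun _ => (1:ℝ)) (θ + 2 * Real.pi / L * j) ≤ L * B) :
    volume (U ∩ Set.Icc 0 (2 * Real.pi)) ≤ ENNReal.ofReal (2 * Real.pi * B) := by
  have L0 : (0:ℝ) < L := by exact_mod_cast hL
  have pi0 := Real.pi_pos
  obtain ⟨f, hf⟩ : ∃ f : ℝ → ℝ, f = U.indicator (fun _ => (1:ℝ)) := ⟨_, rfl⟩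
  rw [← hf] at h
  have fm : Measurable f := by rw [hf]; exact measurable_const.indicator hU
  have fb : ∀ x, ‖f x‖ ≤ 1 := by
    intro x; rw [hf]; unfold Set.indicator; split_ifs <;> simp
  have fi : ∀ g : ℝ → ℝ, Measurable g → (∀ x, ‖g x‖ ≤ 1) → ∀ a b, IntervalIntegrable g volume a b := by
    intro g gm gb a b
    refine (intervalIntegrable_const (c := (1:ℝ))).mono_fun gm.aestronglyMeasurable ?_
    filter_upwards with x
    simpa using gb x
  have e1 : volume (U ∩ Set.Icc 0 (2 * Real.pi)) = ENNReal.ofReal (∫ x in (0:ℝ)..(2 * Real.pi), f x) := by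
    rw [intervalIntegral.integral_of_le (by linarith), hf, integral_indicator_const _ hU]
    rw [smul_eq_mul, mul_one, measureReal_def, ENNReal.ofReal_toReal (measure_ne_top _ _), Measure.restrict_apply hU]
    apply measure_congr
    exact (Filter.EventuallyEq.refl _ _).inter Ioc_ae_eq_Icc.symm
  rw [e1]
  apply ENNReal.ofReal_le_ofReal
  have h1 := intervalIntegral.sum_integral_adjacent_intervals (f := f) (μ := volume) (a := fun k : ℕ => 2 * Real.pi / L * k) (n := L)
    (fun k _ => fi f fm fb _ _)
  have h2 : 2 * Real.pi / L * (L : ℝ) = 2 * Real.pi := by field_simp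
  beta_reduce at h1
  rw [h2] at h1
  simp only [Nat.cast_zero, mul_zero] at h1
  rw [← h1]
  have h3 : ∀ k ∈ range L, ∫ x in (2 * Real.pi / L * (k:ℕ))..(2 * Real.pi / L * ((k + 1 : ℕ) : ℝ)), f x =
      ∫ x in (0:ℝ)..(2 * Real.pi / L), f (x + 2 * Real.pi / L * k) := by
    intro k _
    rw [intervalIntegral.integral_comp_add_right]
    congr 1
    · ring
    · push_cast; ring
  rw [sum_congr rfl h3, ← intervalIntegral.integral_finsetSum]
  · calc _ ≤ ∫ x in (0:ℝ)..(2 * Real.pi / L), (L * B : ℝ) := by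
          apply intervalIntegral.integral_mono (by positivity)
          · have := IntervalIntegrable.sum (a := 0) (b := 2 * Real.pi / L) (μ := volume) (range L) (f := fun (k : ℕ) (u : ℝ) => f (u + 2 * Real.pi / L * k)) ?_
            · have e9 : (fun u => ∑ i ∈ range L, f (u + 2 * Real.pi / L * i)) = ∑ i ∈ range L, fun u => f (u + 2 * Real.pi / L * i) := by
                funext u; simp
              rw [e9]; exact this
            intro k _
            exact fi _ (by fun_prop) (fun x => fb _) _ _
          · exact intervalIntegrable_const
          · intro x; exact h x
      _ = _ := by
          rw [intervalIntegral.integral_const, smul_eq_mul]; field_simp; ring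
  · intro k _
    exact fi _ (by fun_prop) (fun x => fb _) _ _

lemma SS_cont (a : ℤ → ℂ) (N : ℕ) : Continuous (SS a N) := by
  unfold SS; fun_prop

open MeasureTheory in
lemma ER_bd (a : ℤ → ℂ) (R : ℕ) (δ l : ℝ)
    (ha : ∑ k ∈ range (2 * R + 1), ‖a ((k : ℤ) - R)‖ ^ 2 ≤ δ ^ 2) (hl : 0 < l) :
    volume ({x | ∃ N ≤ R, l < ‖SS a N x‖} ∩ Set.Icc 0 (2 * Real.pi)) ≤
      ENNReal.ofReal (2 * Real.pi * ((2 * 2 ^ 600) ^ 2 * δ ^ 2 / l ^ 2)) := by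
  obtain ⟨S, hS⟩ : ∃ S : ℕ, 2 * R + 1 + 8 ≤ 2 ^ (6 * S + 3) := by
    refine ⟨2 * R + 1 + 8, ?_⟩
    have : 6 * (2 * R + 1 + 8) + 3 < 2 ^ (6 * (2 * R + 1 + 8) + 3) := Nat.lt_two_pow_self
    omega
  obtain ⟨M, hM⟩ : ∃ M : ℕ, M = 6 * S + 20 := ⟨_, rfl⟩
  have hU : MeasurableSet {x | ∃ N ≤ R, l < ‖SS a N x‖} := by
    have : {x | ∃ N ≤ R, l < ‖SS a N x‖} = ⋃ N : ℕ, ⋃ _ : N ≤ R, {x | l < ‖SS a N x‖} := by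
      ext x; simp
    rw [this]
    refine MeasurableSet.iUnion fun N => MeasurableSet.iUnion fun _ => ?_
    exact (isOpen_lt continuous_const (SS_cont a N).norm).measurableSet
  apply avg_meas (L := 2 ^ M) (by positivity) hU
  intro θ
  obtain ⟨E, hE⟩ : ∃ E : Finset (ZMod (2 ^ M)), E = univ.filter (fun j => ∃ N ≤ R, l < ‖SS a N (θ + 2 * Real.pi / ((2 ^ M : ℕ) : ℝ) * (j.val : ℕ))‖) := ⟨_, rfl⟩
  have := count_bd hM hS a δ l ha hl θ E (by
    intro j hj; rw [hE, mem_filter] at hj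
    obtain ⟨N, h1, h2⟩ := hj.2
    exact ⟨N, h1, h2.le⟩)
  refine le_trans (le_of_eq ?_) this
  have e : ∑ j ∈ range (2 ^ M), {x | ∃ N ≤ R, l < ‖SS a N x‖}.indicator (fun _ => (1:ℝ)) (θ + 2 * Real.pi / ((2 ^ M : ℕ) : ℝ) * (j : ℕ)) =
      ∑ j : ZMod (2 ^ M), {x | ∃ N ≤ R, l < ‖SS a N x‖}.indicator (fun _ => (1:ℝ)) (θ + 2 * Real.pi / ((2 ^ M : ℕ) : ℝ) * (j.val : ℕ)) := by
    symm
    apply sum_bij (fun (j : ZMod (2 ^ M)) _ => j.val)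
    · intro j _; exact mem_range.2 (ZMod.val_lt j)
    · intro i _ j _ h; exact ZMod.val_injective _ h
    · intro n hn; exact ⟨(n : ZMod (2 ^ M)), mem_univ _, ZMod.val_cast_of_lt (mem_range.1 hn)⟩
    · intro j _; rfl
  rw [e, hE, card_filter]
  push_cast
  apply sum_congr rfl
  intro j _
  rw [Set.indicator_apply]
  by_cases hj : ∃ N ≤ R, l < ‖SS a N (θ + 2 * Real.pi / 2 ^ M * (j.val : ℝ))‖
  · rw [if_pos hj]; exact if_pos hj
  · rw [if_neg hj]; exact if_neg hj

open MeasureTheory in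
lemma E_bd (a : ℤ → ℂ) (δ l : ℝ)
    (ha : ∀ R : ℕ, ∑ k ∈ range (2 * R + 1), ‖a ((k : ℤ) - R)‖ ^ 2 ≤ δ ^ 2) (hl : 0 < l) :
    volume ({x | ∃ N, l < ‖SS a N x‖} ∩ Set.Icc 0 (2 * Real.pi)) ≤
      ENNReal.ofReal (2 * Real.pi * ((2 * 2 ^ 600) ^ 2 * δ ^ 2 / l ^ 2)) := by
  have : {x | ∃ N, l < ‖SS a N x‖} ∩ Set.Icc 0 (2 * Real.pi) = ⋃ R : ℕ, ({x | ∃ N ≤ R, l < ‖SS a N x‖} ∩ Set.Icc 0 (2 * Real.pi)) := by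
    ext x
    simp only [Set.mem_inter_iff, Set.mem_setOf_eq, Set.mem_iUnion]
    constructor
    · rintro ⟨⟨N, h⟩, h2⟩; exact ⟨N, ⟨N, le_rfl, h⟩, h2⟩
    · rintro ⟨R, ⟨N, _, h⟩, h2⟩; exact ⟨⟨N, h⟩, h2⟩
  rw [this, Monotone.measure_iUnion]
  · exact iSup_le fun R => ER_bd a R δ l (ha R) hl
  · intro R R' h x hx
    obtain ⟨⟨N, h1, h2⟩, h3⟩ := hx
    exact ⟨⟨N, h1.trans h, h2⟩, h3⟩

open MeasureTheory in
lemma bessel {δ : ℝ} (hδ : 0 < δ) {g : ℝ → ℂ} (hg : Measurable g) (hb : ∀ x, ‖g x‖ ≤ δ) (a : ℤ → ℂ)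
    (ha : ∀ n, a n = (((2 * Real.pi)⁻¹ : ℝ) : ℂ) *
        ∫ y in (0 : ℝ)..(2 * Real.pi), g y * Complex.exp (-(Complex.I * (n : ℂ) * (y : ℂ)))) (A : Finset ℤ) :
    ∑ n ∈ A, ‖a n‖ ^ 2 ≤ δ ^ 2 := by
  have pi0 := Real.pi_pos
  have hab : (0:ℝ) < 2 * Real.pi := by positivity
  have e : ∀ n, a n = fourierCoeffOn hab g n := by
    intro n
    rw [ha, fourierCoeffOn_eq_integral]
    rw [Complex.real_smul]
    congr 1
    · simp
    · apply intervalIntegral.integral_congr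
      intro y _
      beta_reduce
      rw [fourier_coe_apply, smul_eq_mul, mul_comm]
      congr 2
      have : (Real.pi : ℂ) ≠ 0 := by exact_mod_cast pi0.ne'
      push_cast
      field_simp
      ring
  have hL : MemLp g 2 (volume.restrict (Set.Ioc 0 (2 * Real.pi))) :=
    MemLp.of_bound hg.aestronglyMeasurable δ (Filter.Eventually.of_forall hb)
  have hs := hasSum_sq_fourierCoeffOn hab hL
  simp only [e]
  refine (sum_le_hasSum A (fun _ _ => sq_nonneg _) hs).trans ?_
  rw [sub_zero, smul_eq_mul, inv_mul_le_iff₀ hab]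
  have := intervalIntegral.norm_integral_le_of_norm_le_const (a := 0) (b := 2 * Real.pi) (f := fun x => ‖g x‖ ^ 2) (C := δ ^ 2)
    (fun x _ => by
      rw [Real.norm_of_nonneg (sq_nonneg _)]
      have := hb x
      gcongr)
  rw [sub_zero, abs_of_pos hab] at this
  have := (le_abs_self _).trans this
  linarith

lemma pow_bd {ε δ : ℝ} (hε : 0 < ε) (hδ : 0 < δ) (l : ℝ) (hl : l = ((8 / (Real.pi * ε)) ^ (1 / 2 : ℝ) * 2 ^ (474 * 4 ^ 3) + Real.pi) * δ) :
    2 * Real.pi * ((2 * 2 ^ 600) ^ 2 * δ ^ 2 / l ^ 2) < ε := by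
  have pi0 := Real.pi_pos
  rw [← Real.sqrt_eq_rpow] at hl
  have h8 : 0 < 8 / (Real.pi * ε) := by positivity
  have hs : 0 < √(8 / (Real.pi * ε)) := Real.sqrt_pos.2 h8
  have z1 : (1:ℝ) ≤ 2 ^ 600 := one_le_pow₀ (by norm_num)
  have z2 : (2 ^ 10 * 2 ^ 600 : ℝ) ≤ 2 ^ (474 * 4 ^ 3) := by
    rw [← pow_add]; exact pow_le_pow_right₀ (by norm_num) (by norm_num)
  generalize (2 ^ 600 : ℝ) = Z at *
  generalize (2 ^ (474 * 4 ^ 3) : ℝ) = W at *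
  have l1 : √(8 / (Real.pi * ε)) * (2 ^ 10 * Z) * δ ≤ l := by
    rw [hl]
    gcongr
    have := mul_le_mul_of_nonneg_left z2 hs.le
    linarith
  have l0 : 0 < √(8 / (Real.pi * ε)) * (2 ^ 10 * Z) * δ := by positivity
  have l2 : 8 / (Real.pi * ε) * (2 ^ 10 * Z) ^ 2 * δ ^ 2 ≤ l ^ 2 := by
    calc _ = (√(8 / (Real.pi * ε)) * (2 ^ 10 * Z) * δ) ^ 2 := by
          have := Real.sq_sqrt h8.le
          generalize √(8 / (Real.pi * ε)) = q at this ⊢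
          rw [← this]; ring
      _ ≤ _ := by gcongr
  have l3 : 0 < l ^ 2 := by have := l0.trans_le l1; positivity
  rw [← mul_div_assoc, div_lt_iff₀ l3]
  refine lt_of_lt_of_le ?_ (mul_le_mul_of_nonneg_left l2 hε.le)
  have e : ε * (8 / (Real.pi * ε) * (2 ^ 10 * Z) ^ 2 * δ ^ 2) = 8 / Real.pi * (2 ^ 10 * Z) ^ 2 * δ ^ 2 := by
    field_simp
  rw [e]
  have h4 := Real.pi_le_four
  have h5 : 2 ≤ 8 / Real.pi := by rw [le_div_iff₀ pi0]; linarith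
  have h6 : 0 < Z ^ 2 * δ ^ 2 := by positivity
  nlinarith
end CT

end

open MeasureTheory
open scoped Real ENNReal

/-- **Partial Fourier sums of small functions**: if `g` is measurable, `2π`-periodic and
`|g| ≤ δ`, then for every `ε > 0` there is a measurable set `E ⊆ [0, 2π]` with `|E| < ε` such
that `|S_N g(x)| ≤ C_ε δ` for all `x ∈ [0, 2π] \ E` and all `N > 0`, where
`C_ε = (8/(πε))^{1/2} · 2^{474·4³} + π`. -/
theorem control_approximation_effect {δ : ℝ} (hδ : 0 < δ) {g : ℝ → ℂ} (hg_meas : Measurable g)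
    (periodic_g : Function.Periodic g (2 * π)) (hg_bdd : ∀ x, ‖g x‖ ≤ δ)
    {ε : ℝ} (hε : 0 < ε) :
    ∃ E ⊆ Set.Icc 0 (2 * π), MeasurableSet E ∧ volume E < ENNReal.ofReal ε ∧
      ∀ x ∈ Set.Icc 0 (2 * π) \ E, ∀ N : ℕ, 0 < N →
        ‖partialFourierSum N g x‖ ≤
          ((8 / (π * ε)) ^ (1 / 2 : ℝ) * 2 ^ (474 * 4 ^ 3) + π) * δ := by
  obtain ⟨l, hl⟩ : ∃ l, l = ((8 / (π * ε)) ^ (1 / 2 : ℝ) * 2 ^ (474 * 4 ^ 3) + π) * δ := ⟨_, rfl⟩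
  obtain ⟨a, ha⟩ : ∃ a : ℤ → ℂ, a = fun n : ℤ => (((2 * π)⁻¹ : ℝ) : ℂ) *
        ∫ y in (0 : ℝ)..(2 * π), g y * Complex.exp (-(Complex.I * (n : ℂ) * (y : ℂ))) := ⟨_, rfl⟩
  have hS : ∀ N x, partialFourierSum N g x = CT.SS a N x := by
    intro N x; rw [ha]; rfl
  have l0 : 0 < l := by
    rw [hl]
    apply mul_pos _ hδ
    have h1 : 0 ≤ (8 / (π * ε)) ^ (1 / 2 : ℝ) := by
      apply Real.rpow_nonneg
      have := Real.pi_pos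
      positivity
    have h2 : (0:ℝ) ≤ 2 ^ (474 * 4 ^ 3) := pow_nonneg (by norm_num) _
    exact add_pos_of_nonneg_of_pos (mul_nonneg h1 h2) Real.pi_pos
  have hB := CT.bessel hδ hg_meas hg_bdd a (fun n => by rw [ha])
  have hB2 : ∀ R : ℕ, ∑ k ∈ Finset.range (2 * R + 1), ‖a ((k : ℤ) - R)‖ ^ 2 ≤ δ ^ 2 := by
    intro R
    have h := hB ((Finset.range (2 * R + 1)).image (fun k : ℕ => (k : ℤ) - R))
    rw [Finset.sum_image] at h
    · exact h
    · intro i _ j _ h; simpa using h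
  refine ⟨{x | ∃ N, l < ‖CT.SS a N x‖} ∩ Set.Icc 0 (2 * π), Set.inter_subset_right, ?_, ?_, ?_⟩
  · refine MeasurableSet.inter ?_ measurableSet_Icc
    rw [Set.ofPred_exists]
    exact MeasurableSet.iUnion fun N => (isOpen_lt continuous_const (CT.SS_cont a N).norm).measurableSet
  · refine (CT.E_bd a δ l hB2 l0).trans_lt ?_
    exact (ENNReal.ofReal_lt_ofReal_iff hε).2 (CT.pow_bd hε hδ l hl)
  · intro x hx N _
    rw [← hl, hS]
    by_contra h
    push Not at h
    exact hx.2 ⟨⟨N, h⟩, hx.1⟩
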